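/- For every ε > 0 there exists C > 0 such that for all z ∈ ℂ with Re z ≥ C, C·(Re z)^{1/3} ≤ Im z, and Im z ≤ (Re z)/C: m(z) > 0 and |1/m(z) − K(z)| ≤ ε·K(z) + C·(Re z)^{−1/4}·(Im z)^{−1/4}, where, setting y = Im z / Re z, K(z) = √π · exp((Re z)·Im ∫_{−√y}^{√y} (1 + i y − i x²)^{1/2} dx) / (2·(Re z)^{1/4}·(Im z)^{1/4}). (This expresses the precise resolvent asymptotics of the non-self-adjoint harmonic oscillator in the regime (Re z)^{1/3} ≪ Im z ≪ Re z; the exponent equals (2/3)(Im z)^{3/2}/(Re z)^{1/2}(1 + O(Im z/Re z)).) -/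

import Mathlib

open Complex MeasureTheory

/-- `mQ z` is the infimum of `‖Qu − zu‖_{L²}/‖u‖_{L²}` over nonzero Schwartz functions,
where `Q = Dₓ² + ix²` is the non-self-adjoint harmonic oscillator;
`1/mQ z = ‖(Q − z)^{-1}‖`. -/
noncomputable def mQ (z : ℂ) : ℝ :=
  sInf {r : ℝ | ∃ u : SchwartzMap ℝ ℂ, u ≠ 0 ∧
    r = (eLpNorm (fun x : ℝ =>
          -(deriv (deriv ⇑u) x) + Complex.I * (x:ℂ) ^ 2 * u x - z * u x) 2 volume).toReal
        / (eLpNorm (⇑u) 2 volume).toReal}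

/-- The wedge on which the WKB solution is holomorphic. -/
def wD : Set ℂ := {t : ℂ | -(1/100 : ℝ) < t.im ∧ t.re + 2 * t.im < 1/4}

/-- The direction of the rays. -/
noncomputable def wtau : ℂ := 2 - I

/-- The potential. -/
noncomputable def wP (y : ℝ) (t : ℂ) : ℂ := 1 + I * (y:ℂ) - I * t ^ 2

/-- The momentum. -/
noncomputable def wp (y : ℝ) (t : ℂ) : ℂ := (wP y t) ^ ((1:ℂ)/2)

lemma wD_open : IsOpen wD := by
  apply IsOpen.inter
  · exact isOpen_lt continuous_const Complex.continuous_im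
  · exact isOpen_lt (f := fun t : ℂ => t.re + 2 * t.im)
      (Complex.continuous_re.add (continuous_const.mul Complex.continuous_im)) continuous_const

lemma wD_convex : Convex ℝ wD := by
  intro s hs t ht a b ha hb hab
  obtain ⟨h1, h2⟩ := hs
  obtain ⟨h3, h4⟩ := ht
  constructor
  · simp
    rcases eq_or_lt_of_le ha with h | h
    · subst h; simp at hab; subst hab; simpa using h3
    · nlinarith
  · simp
    rcases eq_or_lt_of_le ha with h | h
    · subst h; simp at hab; subst hab; norm_num at h4 ⊢; linarith
    · nlinarith

lemma wD_ray {t : ℂ} (ht : t ∈ wD) {s : ℝ} (hs : 0 ≤ s) : t - s * wtau ∈ wD := by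
  obtain ⟨h1, h2⟩ := ht
  constructor <;> simp [wtau] <;> linarith

lemma wD_real {x : ℝ} (hx : x < 1/4) : (x:ℂ) ∈ wD := by
  constructor <;> simp <;> linarith

lemma wP_re (y : ℝ) (t : ℂ) : (wP y t).re = 1 + 2 * t.re * t.im := by
  simp [wP, pow_two]; ring

lemma wP_im (y : ℝ) (t : ℂ) : (wP y t).im = y - t.re ^ 2 + t.im ^ 2 := by
  simp [wP, pow_two]; ring

lemma wP_cases {y : ℝ} (hy0 : 0 ≤ y) (hy : y ≤ 1/100) {t : ℂ} (ht : t ∈ wD) :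
    (1/2 ≤ (wP y t).re ∧ (wP y t).im ≤ 1/10 ∧ -(1/2) ≤ t.re) ∨
      ((wP y t).im ≤ -(1/20) * (1 + normSq t) ∧ t.re ≤ -(1/2)) := by
  obtain ⟨h1, h2⟩ := ht
  rw [wP_re, wP_im, normSq_apply]
  set ξ := t.re
  set η := t.im
  rcases le_total (-(1/2)) ξ with h | h
  · left
    refine ⟨?_, ?_, h⟩
    · by_cases h3 : 0 ≤ η
      · by_cases h4 : 0 ≤ ξ
        · nlinarith [mul_nonneg h3 h4]
        · nlinarith
      · have : ξ < 0.27 := by norm_num; linarith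
        norm_num at this
        nlinarith
    · by_cases h3 : 0 ≤ η
      · nlinarith [sq_nonneg (ξ + 1/12)]
      · nlinarith [sq_nonneg ξ]
  · right
    refine ⟨?_, h⟩
    have : η ≤ 1/8 - ξ/2 := by linarith
    nlinarith

lemma wP_slit {y : ℝ} (hy0 : 0 ≤ y) (hy : y ≤ 1/100) {t : ℂ} (ht : t ∈ wD) :
    wP y t ∈ slitPlane := by
  rw [mem_slitPlane_iff]
  rcases wP_cases hy0 hy ht with ⟨h, _⟩ | ⟨h, _⟩
  · left; linarith
  · right
    have := normSq_nonneg t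
    intro h0
    linarith

lemma wP_ne {y : ℝ} (hy0 : 0 ≤ y) (hy : y ≤ 1/100) {t : ℂ} (ht : t ∈ wD) :
    wP y t ≠ 0 := slitPlane_ne_zero (wP_slit hy0 hy ht)

lemma wP_lower {y : ℝ} (hy0 : 0 ≤ y) (hy : y ≤ 1/100) {t : ℂ} (ht : t ∈ wD) :
    1/20 * (1 + normSq t) ≤ ‖wP y t‖ := by
  rcases wP_cases hy0 hy ht with ⟨h, _, h3⟩ | ⟨h, _⟩
  · refine le_trans ?_ ((le_abs_self _).trans (abs_re_le_norm _))
    refine le_trans ?_ h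
    obtain ⟨h1, h2⟩ := ht
    rw [normSq_apply]
    have : t.re ≤ 1 := by linarith
    have : t.im ≤ 1 := by linarith
    nlinarith
  · refine le_trans ?_ ((neg_le_abs _).trans (abs_im_le_norm _))
    linarith

lemma wP_upper {y : ℝ} (hy0 : 0 ≤ y) (hy : y ≤ 1/100) (t : ℂ) :
    ‖wP y t‖ ≤ 2 * (1 + normSq t) := by
  unfold wP
  have h1 : ‖(1:ℂ) + I * (y:ℂ) - I * t ^ 2‖ ≤ ‖(1:ℂ)‖ + ‖I * (y:ℂ)‖ + ‖I * t^2‖ :=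
    (norm_sub_le _ _).trans (add_le_add (norm_add_le _ _) le_rfl)
  simp only [norm_one, norm_mul, norm_I, one_mul, norm_pow] at h1
  rw [norm_real, Real.norm_of_nonneg hy0] at h1
  rw [normSq_eq_norm_sq]
  nlinarith [sq_nonneg ‖t‖]

lemma wp_sq (y : ℝ) (t : ℂ) : wp y t ^ 2 = wP y t := by
  unfold wp
  have := Complex.cpow_nat_inv_pow (wP y t) (n := 2) (by norm_num)
  simpa using this

lemma wp_re_nonneg (y : ℝ) (t : ℂ) : 0 ≤ (wp y t).re := by
  unfold wp
  by_cases h : wP y t = 0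
  · rw [h]; simp
  · rw [show ((1:ℂ)/2) = (((1/2):ℝ):ℂ) by push_cast; rfl]
    rw [Complex.cpow_def_of_ne_zero h, Complex.exp_re]
    apply mul_nonneg (Real.exp_pos _).le
    apply Real.cos_nonneg_of_mem_Icc
    have h1 := Complex.neg_pi_lt_arg (wP y t)
    have h2 := Complex.arg_le_pi (wP y t)
    rw [mul_comm, Complex.re_ofReal_mul |> fun _ => Complex.im_ofReal_mul]
    rw [Complex.log_im]
    constructor <;> linarith

lemma wp_relations (y : ℝ) (t : ℂ) :
    (wp y t).re ^ 2 - (wp y t).im ^ 2 = (wP y t).re ∧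
    2 * (wp y t).re * (wp y t).im = (wP y t).im := by
  rw [← wp_sq]
  simp [pow_two]
  ring

lemma wp_re_pos {y : ℝ} (hy0 : 0 ≤ y) (hy : y ≤ 1/100) {t : ℂ} (ht : t ∈ wD) :
    0 < (wp y t).re := by
  rcases eq_or_lt_of_le (wp_re_nonneg y t) with h | h
  · exfalso
    obtain ⟨h1, h2⟩ := wp_relations y t
    rw [← h] at h1 h2
    have h3 := wP_slit hy0 hy ht
    rw [mem_slitPlane_iff] at h3
    rcases h3 with h3 | h3
    · nlinarith [sq_nonneg (wp y t).im]
    · apply h3; rw [← h2]; ring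
  · exact h

lemma wp_ne {y : ℝ} (hy0 : 0 ≤ y) (hy : y ≤ 1/100) {t : ℂ} (ht : t ∈ wD) :
    wp y t ≠ 0 := by
  intro h
  have := wp_re_pos hy0 hy ht
  rw [h] at this; simp at this

lemma wp_norm_sq (y : ℝ) (t : ℂ) : ‖wp y t‖ ^ 2 = ‖wP y t‖ := by
  rw [← wp_sq, norm_pow]

lemma wp_norm_lower {y : ℝ} (hy0 : 0 ≤ y) (hy : y ≤ 1/100) {t : ℂ} (ht : t ∈ wD) :
    1/5 ≤ ‖wp y t‖ := by
  have h1 := wP_lower hy0 hy ht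
  rw [← wp_norm_sq] at h1
  have := normSq_nonneg t
  by_contra h
  push Not at h
  nlinarith [norm_nonneg (wp y t)]

/-- Growth along the rays. -/
lemma wp_growth {y : ℝ} (hy0 : 0 ≤ y) (hy : y ≤ 1/100) {t : ℂ} (ht : t ∈ wD) :
    (wtau * wp y t).im ≤ -(1/10) := by
  have hn := wp_norm_lower hy0 hy ht
  have hp := wp_re_pos hy0 hy ht
  obtain ⟨h1, h2⟩ := wp_relations y t
  have h3 : ‖wp y t‖ ≤ |(wp y t).re| + |(wp y t).im| := norm_le_abs_re_add_abs_im _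
  have h4 : (wtau * wp y t).im = 2 * (wp y t).im - (wp y t).re := by
    simp [wtau]; ring
  rw [h4]
  rw [abs_of_pos hp] at h3
  by_cases hb : (wp y t).im ≤ 0
  · rw [abs_of_nonpos hb] at h3
    linarith
  · push Not at hb
    have h5 : 0 < (wP y t).im := by rw [← h2]; positivity
    rcases wP_cases hy0 hy ht with ⟨h6, h7, _⟩ | ⟨h6, _⟩
    · rw [← h1] at h6
      rw [← h2] at h7
      set α := (wp y t).re
      set β := (wp y t).im
      have ha : 7/10 ≤ α := by nlinarith
      nlinarith
    · have := normSq_nonneg t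
      linarith

lemma wray_norm {t : ℂ} (ht : t ∈ wD) {s : ℝ} (hs : 0 ≤ s) :
    1 + normSq t ≤ 2 * (1 + normSq (t - s * wtau)) ∧
    1 + s ^ 2 ≤ 2 * (1 + normSq (t - s * wtau)) := by
  obtain ⟨h1, h2⟩ := ht
  rw [normSq_apply, normSq_apply]
  simp only [sub_re, sub_im, mul_re, mul_im, ofReal_re, ofReal_im, wtau]
  simp
  have h3 : t.re < 27/100 := by linarith
  set ξ := t.re
  set η := t.im
  constructor
  · nlinarith [mul_nonneg hs (by linarith : 0 ≤ 27/100 - ξ), mul_nonneg hs (by linarith : 0 ≤ η + 1/100), sq_nonneg (s - 1/8), mul_self_nonneg ξ, mul_self_nonneg η]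
  · nlinarith [mul_nonneg hs (by linarith : 0 ≤ 27/100 - ξ), mul_nonneg hs (by linarith : 0 ≤ η + 1/100), sq_nonneg (s - 1/8), mul_self_nonneg ξ, mul_self_nonneg η]

lemma wP_hasDeriv (y : ℝ) (t : ℂ) : HasDerivAt (wP y) (-2 * I * t) t := by
  unfold wP
  have := ((hasDerivAt_pow 2 t).const_mul I).const_sub (1 + I * (y:ℂ))
  refine this.congr_deriv ?_
  norm_num; ring

lemma wp_hasDeriv {y : ℝ} (hy0 : 0 ≤ y) (hy : y ≤ 1/100) {t : ℂ} (ht : t ∈ wD) :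
    HasDerivAt (wp y) (-I * t / wp y t) t := by
  have h := (wP_hasDeriv y t).cpow_const (c := (1:ℂ)/2) (wP_slit hy0 hy ht)
  have hne := wP_ne hy0 hy ht
  have hpne := wp_ne hy0 hy ht
  unfold wp
  convert h using 1
  rw [Complex.cpow_sub _ _ hne, cpow_one]
  change _ = 1/2 * (wp y t / wP y t) * _
  change -I * t / wp y t = _
  rw [← wp_sq]
  field_simp

/-- the constant `μ` with `μ² = -i` -/
noncomputable def wmu : ℂ := ((1 / Real.sqrt 2 : ℝ) : ℂ) * (-1 + I)

lemma wmu_sq : wmu ^ 2 = -I := by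
  unfold wmu
  rw [mul_pow, ← ofReal_pow, div_pow, Real.sq_sqrt (by norm_num)]
  have : (-1 + I) ^ 2 = -2 * I := by
    have := I_sq
    linear_combination this
  rw [this]; push_cast; ring

lemma wmu_ne : wmu ≠ 0 := by
  intro h
  have := wmu_sq
  rw [h] at this
  simp at this

/-- Primitive of `wp`. -/
noncomputable def wF (y : ℝ) (t : ℂ) : ℂ :=
  (1/2) * (t * wp y t + ((1 + I * (y:ℂ)) / wmu) * log (wp y t + wmu * t))

lemma wF_arg {y : ℝ} (hy0 : 0 ≤ y) (hy : y ≤ 1/100) {t : ℂ} (ht : t ∈ wD) :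
    wp y t + wmu * t ∈ slitPlane := by
  rw [mem_slitPlane_iff]
  left
  have hp := wp_re_pos hy0 hy ht
  have : (wp y t + wmu * t).re = (wp y t).re - (t.re + t.im) / Real.sqrt 2 := by
    simp only [wmu, add_re, add_im, mul_re, ofReal_re, ofReal_im, mul_im, neg_re, one_re, I_re,
      neg_im, one_im, I_im]
    ring
  rw [this]
  have hs : (1:ℝ) < Real.sqrt 2 := by
    rw [Real.lt_sqrt (by norm_num)]; norm_num
  by_cases h : t.re + t.im ≤ 0
  · have : (t.re + t.im) / Real.sqrt 2 ≤ 0 := div_nonpos_of_nonpos_of_nonneg h (by positivity)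
    linarith
  · push Not at h
    have h1 : (t.re + t.im) / Real.sqrt 2 ≤ t.re + t.im := div_le_self h.le hs.le
    obtain ⟨h3, h4⟩ := ht
    have h5 : 1/2 ≤ (wP y t).re := by
      rw [wP_re]
      by_cases h6 : 0 ≤ t.im
      · by_cases h7 : 0 ≤ t.re
        · nlinarith [mul_nonneg h6 h7]
        · nlinarith
      · nlinarith
    obtain ⟨h8, _⟩ := wp_relations y t
    rw [← h8] at h5
    have : 7/10 ≤ (wp y t).re := by nlinarith [sq_nonneg (wp y t).im]
    linarith

lemma wF_hasDeriv {y : ℝ} (hy0 : 0 ≤ y) (hy : y ≤ 1/100) {t : ℂ} (ht : t ∈ wD) :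
    HasDerivAt (wF y) (wp y t) t := by
  have hp := wp_hasDeriv hy0 hy ht
  have hpne := wp_ne hy0 hy ht
  have hs := wF_arg hy0 hy ht
  have hlog := (hp.add ((hasDerivAt_id t).const_mul wmu)).clog hs
  have h := (((hasDerivAt_id t).mul hp).add (hlog.const_mul ((1 + I * (y:ℂ)) / wmu))).const_mul (1/2 : ℂ)
  unfold wF
  refine h.congr_deriv ?_
  have hsne := slitPlane_ne_zero hs
  have hmu := wmu_ne
  simp only [id, mul_one, one_mul, Pi.add_apply]
  have e1 : -I * t / wp y t + wmu = wmu * (wp y t + wmu * t) / wp y t := by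
    rw [← wmu_sq]; field_simp; ring
  rw [e1]
  have e2 : (1 + I * (y:ℂ)) = wp y t ^ 2 + I * t ^ 2 := by rw [wp_sq, wP]; ring
  rw [e2]
  clear h hlog
  generalize wp y t + wmu * t = X at hsne
  field_simp
  ring

/-- Integral of `f` along the ray from `x` to infinity in direction `-wtau`. -/
noncomputable def wJ (f : ℂ → ℂ) (x : ℂ) : ℂ := ∫ s in Set.Ioi (0:ℝ), wtau * f (x - s * wtau)

lemma wray_cont {f : ℂ → ℂ} (hf : ContinuousOn f wD) {x : ℂ} (hx : x ∈ wD) :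
    ContinuousOn (fun s : ℝ => f (x - s * wtau)) (Set.Ici 0) := by
  apply hf.comp (by fun_prop)
  intro s hs
  exact wD_ray hx hs

lemma wray_meas {f : ℂ → ℂ} (hf : ContinuousOn f wD) {x : ℂ} (hx : x ∈ wD) :
    AEStronglyMeasurable (fun s : ℝ => wtau * f (x - s * wtau))
      (volume.restrict (Set.Ioi (0:ℝ))) := by
  have h := (wray_cont hf hx).mono (Set.Ioi_subset_Ici_self)
  exact (continuousOn_const.mul h).aestronglyMeasurable measurableSet_Ioi

lemma wray_hasDeriv {f : ℂ → ℂ} {f' : ℂ} {x : ℂ} {s : ℝ}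
    (h : HasDerivAt f f' (x - s * wtau)) :
    HasDerivAt (fun s : ℝ => f (x - s * wtau)) (-(wtau * f')) s := by
  have h1 : HasDerivAt (fun s : ℝ => x - (s:ℂ) * wtau) (-wtau) s := by
    have := ((Complex.ofRealCLM.hasDerivAt (x := s)).mul_const wtau).const_sub x
    simpa using this
  have := h.comp s h1
  refine this.congr_deriv ?_
  ring

lemma wJ_hasDeriv {f : ℂ → ℂ} (hf : DifferentiableOn ℂ f wD) {x0 : ℂ}
    {ε : ℝ} (hε : 0 < ε) {b : ℝ → ℝ} (hb : IntegrableOn b (Set.Ioi 0))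
    (hbd : ∀ x ∈ Metric.ball x0 ε, x ∈ wD ∧ ∀ s : ℝ, 0 ≤ s → ‖f (x - s * wtau)‖ ≤ b s) :
    HasDerivAt (wJ f) (f x0) x0 := by
  have hx0 : x0 ∈ wD := (hbd x0 (Metric.mem_ball_self hε)).1
  have hderiv : ∀ t ∈ wD, HasDerivAt f (deriv f t) t := fun t ht =>
    (hf.differentiableAt (wD_open.mem_nhds ht)).hasDerivAt
  have hdc : ContinuousOn (deriv f) wD :=
    (hf.deriv wD_open).continuousOn
  have hcauchy : ∀ x ∈ Metric.ball x0 (ε/2), ∀ s : ℝ, 0 ≤ s →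
      ‖deriv f (x - s * wtau)‖ ≤ b s / (ε/3) := by
    intro x hx s hs
    have hsub : Metric.closedBall (x - s * wtau) (ε/3) ⊆ wD := by
      intro w hw
      have : w + s * wtau ∈ Metric.ball x0 ε := by
        simp [Complex.dist_eq] at hx hw ⊢
        calc ‖w + s * wtau - x0‖ = ‖(w + s * wtau - x) + (x - x0)‖ := by ring_nf
          _ ≤ _ := norm_add_le _ _
          _ < ε := by linarith
      have h2 := wD_ray (hbd _ this).1 hs
      simpa using h2
    apply Complex.norm_deriv_le_of_forall_mem_sphere_norm_le (by positivity)
    · exact (hf.diffContOnCl_ball hsub)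
    · intro w hw
      have : w + s * wtau ∈ Metric.ball x0 ε := by
        simp [Complex.dist_eq] at hx hw ⊢
        calc ‖w + s * wtau - x0‖ = ‖(w - (x - s * wtau)) + (x - x0)‖ := by ring_nf
          _ ≤ _ := norm_add_le _ _
          _ < ε := by linarith
      have h2 := (hbd _ this).2 s hs
      simpa using h2
  have hae : ∀ {p : ℝ → Prop}, (∀ s, 0 ≤ s → p s) →
      ∀ᵐ s ∂(volume.restrict (Set.Ioi (0:ℝ))), p s := by
    intro p hp
    filter_upwards [ae_restrict_mem measurableSet_Ioi] with s hs
    exact hp s (le_of_lt hs)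
  have hbi : Integrable (fun s => ‖wtau‖ * (b s / (ε/3))) (volume.restrict (Set.Ioi (0:ℝ))) :=
    (Integrable.div_const hb _).const_mul _
  have key := hasDerivAt_integral_of_dominated_loc_of_deriv_le
    (μ := volume.restrict (Set.Ioi (0:ℝ))) (𝕜 := ℂ)
    (F := fun x s => wtau * f (x - s * wtau)) (F' := fun x s => wtau * deriv f (x - s * wtau))
    (x₀ := x0) (s := Metric.ball x0 (ε/2)) (bound := fun s => ‖wtau‖ * (b s / (ε/3)))
    (Metric.ball_mem_nhds _ (by positivity))
    (by
      filter_upwards [wD_open.mem_nhds hx0] with x hx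
      exact wray_meas hf.continuousOn hx)
    (by
      refine Integrable.mono' (Integrable.const_mul hb ‖wtau‖) (wray_meas hf.continuousOn hx0) ?_
      apply hae
      intro s hs
      rw [norm_mul]
      exact mul_le_mul_of_nonneg_left ((hbd x0 (Metric.mem_ball_self hε)).2 s hs) (norm_nonneg _))
    (wray_meas hdc hx0)
    (hae (by
      intro s hs x hx
      rw [norm_mul]
      exact mul_le_mul_of_nonneg_left (hcauchy x hx s hs) (norm_nonneg _)))
    hbi
    (hae (by
      intro s hs x hx
      have hxD : x ∈ wD := (hbd x (Metric.ball_subset_ball (by linarith) hx)).1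
      have h1 := hderiv _ (wD_ray hxD hs)
      have h2 : HasDerivAt (fun x : ℂ => x - s * wtau) 1 x := (hasDerivAt_id x).sub_const _
      have := (h1.comp x h2).const_mul wtau
      simpa using this))
  have hFint : IntegrableOn (fun s : ℝ => f (x0 - s * wtau)) (Set.Ioi 0) := by
    refine Integrable.mono' hb ?_ (hae (fun s hs => (hbd x0 (Metric.mem_ball_self hε)).2 s hs))
    exact ((wray_cont hf.continuousOn hx0).mono
      Set.Ioi_subset_Ici_self).aestronglyMeasurable measurableSet_Ioi
  have hd : ∀ s ∈ Set.Ici (0:ℝ), HasDerivAt (fun s : ℝ => f (x0 - s * wtau))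
      (-(wtau * deriv f (x0 - s * wtau))) s := fun s hs =>
    wray_hasDeriv (hderiv _ (wD_ray hx0 hs))
  have hlim := tendsto_zero_of_hasDerivAt_of_integrableOn_Ioi
    (fun s hs => hd s (Set.Ioi_subset_Ici_self hs)) (key.1.neg) hFint
  have hIntg := integral_Ioi_of_hasDerivAt_of_tendsto' hd (key.1.neg) hlim
  have : ∫ s in Set.Ioi (0:ℝ), wtau * deriv f (x0 - s * wtau) = f x0 := by
    rw [integral_neg] at hIntg
    simp at hIntg
    rw [← hIntg]
  rw [← this]
  exact key.2

lemma hasDerivAt_im {f : ℝ → ℂ} {f' : ℂ} {x : ℝ} (h : HasDerivAt f f' x) :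
    HasDerivAt (fun r => (f r).im) f'.im x :=
  Complex.imCLM.hasFDerivAt.comp_hasDerivAt x h

lemma hasDerivAt_re {f : ℝ → ℂ} {f' : ℂ} {x : ℝ} (h : HasDerivAt f f' x) :
    HasDerivAt (fun r => (f r).re) f'.re x :=
  Complex.reCLM.hasFDerivAt.comp_hasDerivAt x h

lemma wF_ray {y : ℝ} (hy0 : 0 ≤ y) (hy : y ≤ 1/100) {x : ℂ} (hx : x ∈ wD) {s : ℝ} (hs : 0 ≤ s) :
    (wF y x).im + s / 10 ≤ (wF y (x - s * wtau)).im := by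
  have hd : ∀ r ∈ Set.Ici (0:ℝ), HasDerivAt (fun r : ℝ => (wF y (x - r * wtau)).im)
      (-(wtau * wp y (x - r * wtau)).im) r := by
    intro r hr
    have h := wray_hasDeriv (wF_hasDeriv hy0 hy (wD_ray hx hr))
    have := hasDerivAt_im h
    simpa only [neg_im] using this
  have := Convex.mul_sub_le_image_sub_of_le_deriv (convex_Ici (0:ℝ))
    (f := fun r : ℝ => (wF y (x - r * wtau)).im) (C := 1/10)
    (fun r hr => (hd r hr).continuousAt.continuousWithinAt)
    (fun r hr => (hd r (interior_subset hr)).differentiableAt.differentiableWithinAt)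
    (fun r hr => by
      rw [(hd r (interior_subset hr)).deriv]
      have := wp_growth hy0 hy (wD_ray hx (interior_subset hr))
      linarith) 0 (by simp) s hs hs
  simp at this
  linarith

lemma wp_ray_ratio {y : ℝ} (hy0 : 0 ≤ y) (hy : y ≤ 1/100) {x : ℂ} (hx : x ∈ wD) {s : ℝ}
    (hs : 0 ≤ s) : ‖wp y x‖ ≤ 9 * ‖wp y (x - s * wtau)‖ := by
  have h1 := wP_upper hy0 hy x
  have h2 := wP_lower hy0 hy (wD_ray hx hs)
  have h3 := (wray_norm hx hs).1
  rw [← wp_norm_sq] at h1 h2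
  apply le_of_sq_le_sq _ (by positivity)
  nlinarith
  
/-- The integrating factor. -/
noncomputable def wE (y h : ℝ) (t : ℂ) : ℂ := exp (2 * I / h * wF y t) / wp y t

/-- Half the logarithmic derivative of the integrating factor. -/
noncomputable def wL (y h : ℝ) (t : ℂ) : ℂ := I * wp y t / h + I * t / (2 * wP y t)

/-- The WKB remainder. -/
noncomputable def wr (y : ℝ) (t : ℂ) : ℂ := -(5/4) * t ^ 2 / wP y t ^ 2 + I / (2 * wP y t)

lemma wE_ne {y h : ℝ} (hy0 : 0 ≤ y) (hy : y ≤ 1/100) {t : ℂ} (ht : t ∈ wD) :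
    wE y h t ≠ 0 := div_ne_zero (exp_ne_zero _) (wp_ne hy0 hy ht)

lemma wE_hasDeriv {y h : ℝ} (hy0 : 0 ≤ y) (hy : y ≤ 1/100) {t : ℂ} (ht : t ∈ wD) :
    HasDerivAt (wE y h) (2 * wL y h t * wE y h t) t := by
  have h1 := ((wF_hasDeriv hy0 hy ht).const_mul (2 * I / (h:ℂ))).cexp
  have h2 := h1.div (wp_hasDeriv hy0 hy ht) (wp_ne hy0 hy ht)
  refine h2.congr_deriv ?_
  simp only [wE, wL]
  have hp := wp_ne hy0 hy ht
  rw [← wp_sq]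
  generalize exp _ = e
  generalize wp y t = p at *
  have : I * t / (2 * p ^ 2) * 2 = I * t / p ^ 2 := by field_simp
  rw [show 2 * (I * p / (h:ℂ) + I * t / (2 * p ^ 2)) * (e / p)
    = (2 * I * p / (h:ℂ) + I * t / (2 * p ^ 2) * 2) * (e / p) by ring, this]
  generalize hk : (h:ℂ)⁻¹ = k
  simp only [div_eq_mul_inv _ (h:ℂ), hk]
  field_simp
  ring

lemma wE_ray {y h : ℝ} (hy0 : 0 ≤ y) (hy : y ≤ 1/100) (hh : 0 < h) {x : ℂ} (hx : x ∈ wD) {s : ℝ}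
    (hs : 0 ≤ s) : ‖wE y h (x - s * wtau)‖ ≤ 9 * Real.exp (-(1 / (5 * h)) * s) * ‖wE y h x‖ := by
  have h1 := wF_ray hy0 hy hx hs
  have h2 := wp_ray_ratio hy0 hy hx hs
  have h3 : 0 < ‖wp y x‖ := norm_pos_iff.mpr (wp_ne hy0 hy hx)
  have h4 : 0 < ‖wp y (x - s * wtau)‖ := norm_pos_iff.mpr (wp_ne hy0 hy (wD_ray hx hs))
  have hre : ∀ F : ℂ, (2 * I / (h:ℂ) * F).re = -(2 / h) * F.im := by
    intro F
    rw [show 2 * I / (h:ℂ) * F = ((2/h : ℝ) : ℂ) * (I * F) by push_cast; ring, re_ofReal_mul]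
    simp
  unfold wE
  rw [norm_div, norm_div, norm_exp, norm_exp, hre, hre, mul_div_assoc', div_le_div_iff₀ h4 h3]
  have h5 : Real.exp (-(2/h) * (wF y (x - s * wtau)).im) ≤
      Real.exp (-(1 / (5 * h)) * s) * Real.exp (-(2/h) * (wF y x).im) := by
    rw [← Real.exp_add, Real.exp_le_exp]
    have : (1 / (5*h)) * s = (2/h) * (s/10) := by field_simp; ring
    rw [neg_mul (1 / (5*h)), this]
    have h6 : (2/h) * ((wF y x).im + s / 10) ≤ (2/h) * (wF y (x - s * wtau)).im :=
      mul_le_mul_of_nonneg_left h1 (by positivity)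
    linarith
  calc _ ≤ Real.exp (-(1 / (5 * h)) * s) * Real.exp (-(2/h) * (wF y x).im) *
        (9 * ‖wp y (x - s * wtau)‖) := mul_le_mul h5 h2 h3.le (by positivity)
    _ = _ := by ring

lemma wr_bound {y : ℝ} (hy0 : 0 ≤ y) (hy : y ≤ 1/100) {t : ℂ} (ht : t ∈ wD) :
    ‖wr y t‖ ≤ 510 / (1 + normSq t) := by
  have h1 := wP_lower hy0 hy ht
  have hn : 0 ≤ normSq t := normSq_nonneg t
  have hP : 0 < ‖wP y t‖ := norm_pos_iff.mpr (wP_ne hy0 hy ht)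
  have h2 : ‖t‖ ^ 2 = normSq t := (normSq_eq_norm_sq t).symm
  set N := normSq t
  have hinv : ‖wP y t‖⁻¹ ≤ 20 / (1 + N) := by
    rw [inv_eq_one_div, div_le_div_iff₀ hP (by positivity)]; linarith
  have hinv0 : 0 ≤ ‖wP y t‖⁻¹ := by positivity
  have ha : ‖-(5/4 : ℂ) * t ^ 2 / wP y t ^ 2‖ = 5/4 * N * (‖wP y t‖⁻¹) ^ 2 := by
    rw [norm_div, norm_mul, norm_neg, norm_pow, norm_pow, h2]
    norm_num
    ring
  have hb : ‖I / (2 * wP y t)‖ = 1/2 * ‖wP y t‖⁻¹ := by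
    rw [norm_div, norm_mul, norm_I]; norm_num; ring
  unfold wr
  refine (norm_add_le _ _).trans ?_
  rw [ha, hb]
  have h3 : (‖wP y t‖⁻¹) ^ 2 ≤ (20 / (1 + N)) ^ 2 := pow_le_pow_left₀ hinv0 hinv 2
  have h4 : N * (20 / (1 + N)) ^ 2 ≤ 400 / (1 + N) := by
    rw [div_pow, mul_div_assoc', div_le_div_iff₀ (by positivity) (by positivity)]
    nlinarith
  have h5 : N * (‖wP y t‖⁻¹) ^ 2 ≤ 400 / (1 + N) := (mul_le_mul_of_nonneg_left h3 hn).trans h4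
  have h6 : (510:ℝ) / (1 + N) = 5/4 * (400 / (1+N)) + 1/2 * (20/(1+N)) := by field_simp; norm_num
  rw [h6]
  linarith

lemma wr_diff {y : ℝ} (hy0 : 0 ≤ y) (hy : y ≤ 1/100) : DifferentiableOn ℂ (wr y) wD := by
  intro t ht
  have h1 := (wP_hasDeriv y t).differentiableAt
  have h2 := wP_ne hy0 hy ht
  apply DifferentiableAt.differentiableWithinAt
  unfold wr
  fun_prop (disch := simp [h2])

lemma wtau_norm : ‖wtau‖ ≤ 3 := by
  unfold wtau
  calc ‖(2:ℂ) - I‖ ≤ ‖(2:ℂ)‖ + ‖I‖ := norm_sub_le _ _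
    _ = 3 := by norm_num

lemma wstep {y h : ℝ} (hy0 : 0 ≤ y) (hy : y ≤ 1/100) (hh : 0 < h) {w : ℂ → ℂ}
    (hw : DifferentiableOn ℂ w wD) {M : ℝ} (hM : ∀ t ∈ wD, ‖w t‖ ≤ M) :
    ∃ w' g : ℂ → ℂ, (∀ t ∈ wD, HasDerivAt w' (g t) t) ∧
      (∀ t ∈ wD, HasDerivAt g (-2 * wL y h t * g t - wr y t * w t) t) ∧
      (∀ t ∈ wD, ‖g t‖ ≤ 2000000 * h * M) ∧ (∀ t ∈ wD, ‖w' t‖ ≤ 2000000 * h * M) := by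
  have hM0 : 0 ≤ M := (norm_nonneg _).trans (hM (0:ℝ) (wD_real (by norm_num)))
  have hEd : DifferentiableOn ℂ (wE y h) wD := fun t ht =>
    (wE_hasDeriv hy0 hy ht).differentiableAt.differentiableWithinAt
  set f : ℂ → ℂ := fun t => wE y h t * wr y t * w t with hf
  have hfd : DifferentiableOn ℂ f wD := (hEd.mul (wr_diff hy0 hy)).mul hw
  have hk : -(1 / (5 * h)) < 0 := by
    have : 0 < 1 / (5*h) := by positivity
    linarith
  have hexpint : IntegrableOn (fun s : ℝ => Real.exp (-(1 / (5 * h)) * s)) (Set.Ioi 0) :=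
    exp_neg_integrableOn_Ioi 0 (by linarith)
  have hfb : ∀ x ∈ wD, ∀ s : ℝ, 0 ≤ s → ‖f (x - s * wtau)‖ ≤
      (9180 * M * ‖wE y h x‖ / (1 + normSq x)) * Real.exp (-(1 / (5 * h)) * s) := by
    intro x hx s hs
    have h1 := wE_ray hy0 hy hh hx hs
    have h2 := wr_bound hy0 hy (wD_ray hx hs)
    have h3 := hM _ (wD_ray hx hs)
    have h4 := (wray_norm hx hs).1
    have hn : 0 ≤ normSq x := normSq_nonneg x
    have hn' : 0 ≤ normSq (x - s * wtau) := normSq_nonneg _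
    have h5 : 510 / (1 + normSq (x - s * wtau)) ≤ 1020 / (1 + normSq x) := by
      rw [div_le_div_iff₀ (by positivity) (by positivity)]; linarith
    simp only [hf, norm_mul]
    calc _ ≤ 9 * Real.exp (-(1 / (5 * h)) * s) * ‖wE y h x‖ * (1020 / (1 + normSq x)) * M := by
          apply mul_le_mul _ h3 (norm_nonneg _) (by positivity)
          exact mul_le_mul h1 (h2.trans h5) (norm_nonneg _) (by positivity)
      _ = _ := by ring
  have hJ : ∀ x ∈ wD, HasDerivAt (wJ f) (f x) x := by
    intro x hx
    have hc : ContinuousAt (fun t => ‖wE y h t‖) x :=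
      (wE_hasDeriv hy0 hy hx).continuousAt.norm
    have h1 : ∀ᶠ t in nhds x, ‖wE y h t‖ < ‖wE y h x‖ + 1 :=
      hc.eventually_lt_const (by linarith)
    have h2 : ∀ᶠ t in nhds x, t ∈ wD := wD_open.mem_nhds hx
    obtain ⟨ε, hε, hb⟩ := Metric.eventually_nhds_iff_ball.mp (h1.and h2)
    refine wJ_hasDeriv hfd hε (b := fun s => (9180 * M * (‖wE y h x‖ + 1)) *
      Real.exp (-(1 / (5 * h)) * s)) (hexpint.const_mul _) ?_
    intro t ht
    refine ⟨(hb t ht).2, fun s hs => (hfb t (hb t ht).2 s hs).trans ?_⟩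
    apply mul_le_mul_of_nonneg_right _ (Real.exp_pos _).le
    have hn : 0 ≤ normSq t := normSq_nonneg t
    rw [div_le_iff₀ (by positivity)]
    have := (hb t ht).1
    have h6 : 9180 * M * ‖wE y h t‖ ≤ 9180 * M * (‖wE y h x‖ + 1) :=
      mul_le_mul_of_nonneg_left this.le (by positivity)
    have : 0 ≤ 9180 * M * (‖wE y h x‖ + 1) := by positivity
    nlinarith
  have hJb : ∀ x ∈ wD, ‖wJ f x‖ ≤ 137700 * h * M / (1 + normSq x) * ‖wE y h x‖ := by
    intro x hx
    have hn : 0 ≤ normSq x := normSq_nonneg x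
    unfold wJ
    have := norm_integral_le_of_norm_le
      (f := fun s : ℝ => wtau * f (x - s * wtau)) (μ := volume.restrict (Set.Ioi (0:ℝ)))
      (hexpint.const_mul (3 * (9180 * M * ‖wE y h x‖ / (1 + normSq x)))) (by
        filter_upwards [ae_restrict_mem measurableSet_Ioi] with s hs
        rw [norm_mul, mul_assoc]
        exact mul_le_mul wtau_norm (hfb x hx s (le_of_lt hs)) (norm_nonneg _) (by norm_num))
    refine this.trans (le_of_eq ?_)
    rw [integral_const_mul, integral_exp_mul_Ioi hk]
    simp
    field_simp
    ring
  refine ⟨wJ (fun t => -(wE y h t)⁻¹ * wJ f t), fun t => -(wE y h t)⁻¹ * wJ f t, ?_⟩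
  set g : ℂ → ℂ := fun t => -(wE y h t)⁻¹ * wJ f t with hg
  have hgd : ∀ t ∈ wD, HasDerivAt g (-2 * wL y h t * g t - wr y t * w t) t := by
    intro t ht
    have hne := wE_ne (h := h) hy0 hy ht
    have h1 := (((wE_hasDeriv (h := h) hy0 hy ht).inv hne).neg).mul (hJ t ht)
    refine h1.congr_deriv ?_
    simp only [hg, hf, Pi.neg_apply, Pi.inv_apply]
    field_simp
    ring
  have hgb : ∀ t ∈ wD, ‖g t‖ ≤ 137700 * h * M / (1 + normSq t) := by
    intro t ht
    have hne := wE_ne (h := h) hy0 hy ht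
    have h1 := hJb t ht
    simp only [hg, norm_mul, norm_neg, norm_inv]
    have : 0 < ‖wE y h t‖ := norm_pos_iff.mpr hne
    rw [inv_mul_le_iff₀ this]
    linarith
  have hgray : ∀ x ∈ wD, ∀ s : ℝ, 0 ≤ s → ‖g (x - s * wtau)‖ ≤
      275400 * h * M * (1 + s^2)⁻¹ := by
    intro x hx s hs
    refine (hgb _ (wD_ray hx hs)).trans ?_
    have h4 := (wray_norm hx hs).2
    have hn' : 0 ≤ normSq (x - s * wtau) := normSq_nonneg _
    rw [← div_eq_mul_inv, div_le_div_iff₀ (by positivity) (by positivity)]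
    have : 0 ≤ 137700 * h * M := by positivity
    nlinarith
  have hi : IntegrableOn (fun s : ℝ => (1 + s^2)⁻¹) (Set.Ioi 0) :=
    integrable_inv_one_add_sq.integrableOn
  refine ⟨?_, hgd, ?_, ?_⟩
  · intro x hx
    obtain ⟨ε, hε, hb⟩ := Metric.isOpen_iff.mp wD_open x hx
    refine wJ_hasDeriv (fun t ht => (hgd t ht).differentiableAt.differentiableWithinAt) hε
      (b := fun s => 275400 * h * M * (1 + s^2)⁻¹) (hi.const_mul _) ?_
    exact fun t ht => ⟨hb ht, hgray t (hb ht)⟩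
  · intro t ht
    refine (hgb t ht).trans ?_
    have hn : 0 ≤ normSq t := normSq_nonneg t
    rw [div_le_iff₀ (by positivity)]
    have : 0 ≤ h * M := by positivity
    nlinarith
  · intro x hx
    unfold wJ
    have := norm_integral_le_of_norm_le
      (f := fun s : ℝ => wtau * g (x - s * wtau)) (μ := volume.restrict (Set.Ioi (0:ℝ)))
      (hi.const_mul (3 * (275400 * h * M))) (by
        filter_upwards [ae_restrict_mem measurableSet_Ioi] with s hs
        rw [norm_mul, mul_assoc]
        exact mul_le_mul wtau_norm (hgray x hx s (le_of_lt hs)) (norm_nonneg _) (by norm_num))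
    refine this.trans ?_
    rw [integral_const_mul, integral_Ioi_inv_one_add_sq]
    simp
    have := Real.pi_lt_four
    have : 0 ≤ h * M := by positivity
    nlinarith

lemma wL_diff {y h : ℝ} (hy0 : 0 ≤ y) (hy : y ≤ 1/100) {t : ℂ} (ht : t ∈ wD) :
    DifferentiableAt ℂ (wL y h) t := by
  have h1 := (wP_hasDeriv y t).differentiableAt
  have h3 := (wp_hasDeriv hy0 hy ht).differentiableAt
  have h2 := wP_ne hy0 hy ht
  unfold wL
  simp only [div_eq_mul_inv _ (h:ℂ)]
  fun_prop (disch := simp [h2])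

lemma wseq {y h : ℝ} (hy0 : 0 ≤ y) (hy : y ≤ 1/100) (hh : 0 < h) :
    ∃ W G : ℕ → ℂ → ℂ, (∀ t, W 0 t = 1) ∧ (∀ t, G 0 t = 0) ∧
      (∀ n, ∀ t ∈ wD, HasDerivAt (W n) (G n t) t) ∧
      (∀ n, ∀ t ∈ wD, HasDerivAt (G (n+1)) (-2 * wL y h t * G (n+1) t - wr y t * W n t) t) ∧
      (∀ n, ∀ t ∈ wD, ‖W n t‖ ≤ (2000000 * h) ^ n) ∧
      (∀ n, ∀ t ∈ wD, ‖G (n+1) t‖ ≤ (2000000 * h) ^ (n+1)) := by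
  let S := {p : (ℂ → ℂ) × (ℂ → ℂ) × ℝ // (∀ t ∈ wD, HasDerivAt p.1 (p.2.1 t) t) ∧
    ∀ t ∈ wD, ‖p.1 t‖ ≤ p.2.2}
  have step : ∀ p : S, ∃ q : S, q.1.2.2 = 2000000 * h * p.1.2.2 ∧
      (∀ t ∈ wD, HasDerivAt q.1.2.1 (-2 * wL y h t * q.1.2.1 t - wr y t * p.1.1 t) t) ∧
      (∀ t ∈ wD, ‖q.1.2.1 t‖ ≤ q.1.2.2) := by
    intro p
    obtain ⟨w', g, h1, h2, h3, h4⟩ := wstep hy0 hy hh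
      (fun t ht => (p.2.1 t ht).differentiableAt.differentiableWithinAt) p.2.2
    exact ⟨⟨(w', g, 2000000 * h * p.1.2.2), h1, h4⟩, rfl, h2, h3⟩
  choose st hst using step
  let p0 : S := ⟨(fun _ => 1, fun _ => 0, 1), fun t _ => hasDerivAt_const t 1, fun t _ => by simp⟩
  let sq : ℕ → S := fun n => Nat.rec p0 (fun _ p => st p) n
  have hsq : ∀ n, sq (n+1) = st (sq n) := fun n => rfl
  have hM : ∀ n, (sq n).1.2.2 = (2000000 * h) ^ n := by
    intro n
    induction n with
    | zero => rfl
    | succ n ih => rw [hsq, (hst _).1, ih, pow_succ]; ring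
  refine ⟨fun n => (sq n).1.1, fun n => (sq n).1.2.1, fun t => rfl, fun t => rfl,
    fun n => (sq n).2.1, ?_, ?_, ?_⟩
  · intro n t ht
    exact (hst (sq n)).2.1 t ht
  · intro n t ht
    rw [← hM]; exact (sq n).2.2 t ht
  · intro n t ht
    rw [← hM]; exact (hst (sq n)).2.2 t ht

lemma wsolve {y h : ℝ} (hy0 : 0 ≤ y) (hy : y ≤ 1/100) (hh : 0 < h) (hh1 : h ≤ 1/4000000) :
    ∃ w w1 : ℂ → ℂ, (∀ t ∈ wD, HasDerivAt w (w1 t) t) ∧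
      (∀ t ∈ wD, HasDerivAt w1 (-2 * wL y h t * w1 t - wr y t * w t) t) ∧
      (∀ t ∈ wD, ‖w t - 1‖ ≤ 4000000 * h) ∧ (∀ t ∈ wD, ‖w1 t‖ ≤ 4000000 * h) := by
  obtain ⟨W, G, hW0, hG0, hWd, hGd, hWb, hGb⟩ := wseq hy0 hy hh
  set ρ := 2000000 * h with hρ
  have hρ0 : 0 ≤ ρ := by positivity
  have hρ1 : ρ ≤ 1/2 := by rw [hρ]; linarith
  have hgeo : Summable (fun n : ℕ => ρ ^ n) := summable_geometric_of_lt_one hρ0 (by linarith)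
  have hGb' : ∀ n, ∀ t ∈ wD, ‖G n t‖ ≤ ρ ^ n := by
    intro n t ht
    cases n with
    | zero => simp [hG0]
    | succ n => exact hGb n t ht
  have hWs : ∀ t ∈ wD, Summable (fun n => W n t) := fun t ht =>
    Summable.of_norm_bounded hgeo (fun n => hWb n t ht)
  have hGs : ∀ t ∈ wD, Summable (fun n => G n t) := fun t ht =>
    Summable.of_norm_bounded hgeo (fun n => hGb' n t ht)
  have h0 : ((0:ℝ):ℂ) ∈ wD := wD_real (by norm_num)
  have htail : HasSum (fun n : ℕ => ρ ^ (n+1)) (ρ / (1 - ρ)) := by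
    have := (hasSum_geometric_of_lt_one hρ0 (by linarith)).mul_left ρ
    simpa [pow_succ, mul_comm, div_eq_mul_inv] using this
  have htb : ρ / (1 - ρ) ≤ 4000000 * h := by
    rw [div_le_iff₀ (by linarith)]
    have : 4000000 * h = 2 * ρ := by rw [hρ]; ring
    rw [this]; nlinarith
  refine ⟨fun t => ∑' n, W n t, fun t => ∑' n, G n t, ?_, ?_, ?_, ?_⟩
  · intro t ht
    exact hasDerivAt_tsum_of_isPreconnected hgeo wD_open wD_convex.isPreconnected
      hWd hGb' h0 (hWs _ h0) ht
  · intro t ht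
    have hc : ContinuousAt (fun t => ‖wL y h t‖) t := (wL_diff hy0 hy ht).continuousAt.norm
    have h1 : ∀ᶠ s in nhds t, ‖wL y h s‖ < ‖wL y h t‖ + 1 :=
      hc.eventually_lt_const (by linarith)
    have h2 : ∀ᶠ s in nhds t, s ∈ wD := wD_open.mem_nhds ht
    obtain ⟨ε, hε, hb⟩ := Metric.eventually_nhds_iff_ball.mp (h1.and h2)
    set B := ‖wL y h t‖ + 1 with hB
    have hB0 : 0 ≤ B := by positivity
    have hsum : Summable (fun n : ℕ => (2 * B + 510) * ρ ^ n) := hgeo.mul_left _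
    have key := hasDerivAt_tsum_of_isPreconnected (g := fun n => G (n+1))
      (g' := fun n s => -2 * wL y h s * G (n+1) s - wr y s * W n s) hsum
      Metric.isOpen_ball (convex_ball t ε).isPreconnected
      (fun n s hs => hGd n s (hb s hs).2)
      (fun n s hs => by
        have hsD := (hb s hs).2
        have h3 := wr_bound hy0 hy hsD
        have h4 : (510:ℝ) / (1 + normSq s) ≤ 510 := by
          have := normSq_nonneg s
          rw [div_le_iff₀ (by positivity)]; linarith
        have h5 := hGb n s hsD
        have h6 : ρ ^ (n+1) ≤ ρ ^ n := pow_le_pow_of_le_one hρ0 (by linarith) (by omega)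
        have h7 := hWb n s hsD
        calc _ ≤ ‖-2 * wL y h s * G (n+1) s‖ + ‖wr y s * W n s‖ := norm_sub_le _ _
          _ = 2 * ‖wL y h s‖ * ‖G (n+1) s‖ + ‖wr y s‖ * ‖W n s‖ := by simp
          _ ≤ 2 * B * ρ ^ n + 510 * ρ ^ n := by
              gcongr
              · exact (hb s hs).1.le
              · exact h5.trans h6
              · exact h3.trans h4
          _ = _ := by ring)
      (Metric.mem_ball_self hε) ((summable_nat_add_iff 1).mpr (hGs t ht)) (Metric.mem_ball_self hε)
    have e1 : (fun s => ∑' n, G n s) =ᶠ[nhds t] fun s => ∑' n, G (n+1) s := by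
      filter_upwards [h2] with s hs
      rw [(hGs s hs).tsum_eq_zero_add]
      simp [hG0]
    refine (key.congr_of_eventuallyEq e1).congr_deriv ?_
    have e2 := e1.eq_of_nhds
    dsimp only at e2 ⊢
    rw [Summable.tsum_sub, tsum_mul_left, tsum_mul_left, e2]
    · exact ((summable_nat_add_iff 1).mpr (hGs t ht)).mul_left _
    · exact (hWs t ht).mul_left _
  · intro t ht
    dsimp only
    rw [(hWs t ht).tsum_eq_zero_add, hW0, add_sub_cancel_left]
    exact (tsum_of_norm_bounded htail (fun n => hWb (n+1) t ht)).trans htb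
  · intro t ht
    dsimp only
    rw [(hGs t ht).tsum_eq_zero_add, hG0, zero_add]
    exact (tsum_of_norm_bounded htail (fun n => hGb n t ht)).trans htb

lemma wV {y h : ℝ} (hy0 : 0 ≤ y) (hy : y ≤ 1/100) (hh : 0 < h) {δ : ℝ} (hδ : δ ≤ 1/3)
    (hh1 : 4000000 * h ≤ δ) :
    ∃ V V1 : ℂ → ℂ, (∀ t ∈ wD, HasDerivAt V (V1 t) t) ∧
      (∀ t ∈ wD, HasDerivAt V1 (-(wP y t / h ^ 2) * V t) t) ∧
      (∀ t ∈ wD, (1 - δ) ^ 2 * Real.exp (-(2/h) * (wF y t - wF y 0).im) ≤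
        ‖wp y t‖ * ‖V t‖ ^ 2) ∧
      (∀ t ∈ wD, ‖wp y t‖ * ‖V t‖ ^ 2 ≤
        (1 + δ) ^ 2 * Real.exp (-(2/h) * (wF y t - wF y 0).im)) ∧
      (∀ t ∈ wD, ‖V1 t - I * wp y t / h * V t‖ ≤ 6 * ‖V t‖) := by
  obtain ⟨w, w1, hw, hw1, hwb, hw1b⟩ := wsolve hy0 hy hh (by linarith)
  set A : ℂ → ℂ := fun t => exp (-(1/2) * log (wp y t) + I / h * (wF y t - wF y 0)) with hA
  have hAd : ∀ t ∈ wD, HasDerivAt A (wL y h t * A t) t := by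
    intro t ht
    have hp := wp_ne hy0 hy ht
    have hs : wp y t ∈ slitPlane := Or.inl (wp_re_pos hy0 hy ht)
    have h1 := ((wp_hasDeriv hy0 hy ht).clog hs).const_mul (-(1/2) : ℂ)
    have h2 := ((wF_hasDeriv hy0 hy ht).sub_const (wF y 0)).const_mul (I / (h:ℂ))
    refine (h1.add h2).cexp.congr_deriv ?_
    simp only [hA, Pi.add_apply]
    rw [mul_comm]
    congr 1
    rw [wL, ← wp_sq]
    generalize wp y t = p at *
    generalize hk : (h:ℂ)⁻¹ = k
    simp only [div_eq_mul_inv _ (h:ℂ), hk]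
    field_simp
    ring
  have hAn : ∀ t ∈ wD, ‖wp y t‖ * ‖A t‖ ^ 2 = Real.exp (-(2/h) * (wF y t - wF y 0).im) := by
    intro t ht
    have hp : 0 < ‖wp y t‖ := norm_pos_iff.mpr (wp_ne hy0 hy ht)
    simp only [hA]
    rw [norm_exp, ← Real.exp_nat_mul]
    nth_rewrite 1 [← Real.exp_log hp]
    rw [← Real.exp_add]
    congr 1
    rw [show I / (h:ℂ) * (wF y t - wF y 0) = ((1/h : ℝ) : ℂ) * (I * (wF y t - wF y 0)) by
      push_cast; ring]
    rw [add_re, re_ofReal_mul, show (-(1/2) : ℂ) = ((-(1/2) : ℝ) : ℂ) by push_cast; ring,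
      re_ofReal_mul, log_re]
    simp
    ring
  have hLd : ∀ t ∈ wD, HasDerivAt (wL y h) (-(wP y t / h ^ 2) + wr y t - wL y h t ^ 2) t := by
    intro t ht
    have hp := wp_ne hy0 hy ht
    have hP := wP_ne hy0 hy ht
    have h1 := ((wp_hasDeriv hy0 hy ht).const_mul I).div_const (h:ℂ)
    have h2 := ((hasDerivAt_id t).const_mul I).div ((wP_hasDeriv y t).const_mul (2:ℂ))
      (mul_ne_zero two_ne_zero hP)
    refine (h1.add h2).congr_deriv ?_
    simp only [id, wr, wL]
    rw [← wp_sq]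
    generalize wp y t = p at *
    generalize hk : (h:ℂ)⁻¹ = k
    have hk2 : ((h:ℂ)^2)⁻¹ = k^2 := by rw [← hk, inv_pow]
    simp only [div_eq_mul_inv _ (h:ℂ), div_eq_mul_inv _ ((h:ℂ)^2), hk, hk2]
    field_simp
    ring_nf
    simp only [I_sq]
    ring
  refine ⟨fun t => A t * w t, fun t => wL y h t * (A t * w t) + A t * w1 t, ?_, ?_, ?_, ?_, ?_⟩
  · intro t ht
    refine ((hAd t ht).mul (hw t ht)).congr_deriv ?_
    ring
  · intro t ht
    have h1 := ((hLd t ht).mul ((hAd t ht).mul (hw t ht))).add ((hAd t ht).mul (hw1 t ht))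
    refine h1.congr_deriv ?_
    simp only [Pi.mul_apply]
    ring
  · intro t ht
    have h1 := hwb t ht
    have h2 : 1 - δ ≤ ‖w t‖ := by
      have := norm_sub_norm_le (1:ℂ) (1 - w t)
      rw [sub_sub_cancel, norm_one, norm_sub_rev] at this
      linarith
    rw [norm_mul, mul_pow, ← mul_assoc, hAn t ht, mul_comm]
    have h3 : (1-δ)^2 ≤ ‖w t‖^2 := pow_le_pow_left₀ (by linarith) h2 2
    exact mul_le_mul_of_nonneg_left h3 (Real.exp_pos _).le
  · intro t ht
    have h1 := hwb t ht
    have h2 : ‖w t‖ ≤ 1 + δ := by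
      have := norm_add_le (w t - 1) (1:ℂ)
      rw [sub_add_cancel, norm_one] at this
      linarith
    rw [norm_mul, mul_pow, ← mul_assoc, hAn t ht, mul_comm]
    have h3 : ‖w t‖^2 ≤ (1+δ)^2 := pow_le_pow_left₀ (norm_nonneg _) h2 2
    exact mul_le_mul_of_nonneg_right h3 (Real.exp_pos _).le
  · intro t ht
    have h1 := hwb t ht
    have h2 : 2/3 ≤ ‖w t‖ := by
      have := norm_sub_norm_le (1:ℂ) (1 - w t)
      rw [sub_sub_cancel, norm_one, norm_sub_rev] at this
      linarith
    have h3 := hw1b t ht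
    have h4 : wL y h t * (A t * w t) + A t * w1 t - I * wp y t / h * (A t * w t)
        = I * t / (2 * wP y t) * (A t * w t) + A t * w1 t := by
      rw [wL]; ring
    have h5 : ‖I * t / (2 * wP y t)‖ ≤ 5 := by
      have hl := wP_lower hy0 hy ht
      have h2 : ‖t‖ ^ 2 = normSq t := (normSq_eq_norm_sq t).symm
      have hP : 0 < ‖wP y t‖ := norm_pos_iff.mpr (wP_ne hy0 hy ht)
      rw [norm_div, norm_mul, norm_mul, norm_I, div_le_iff₀ (by simpa using hP)]
      simp
      nlinarith [sq_nonneg (‖t‖ - 1)]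
    rw [h4]
    calc _ ≤ ‖I * t / (2 * wP y t) * (A t * w t)‖ + ‖A t * w1 t‖ := norm_add_le _ _
      _ = ‖I * t / (2 * wP y t)‖ * ‖A t * w t‖ + ‖A t‖ * ‖w1 t‖ := by
          rw [norm_mul (I * t / (2 * wP y t)), norm_mul (A t) (w1 t)]
      _ ≤ 5 * ‖A t * w t‖ + ‖A t‖ * ‖w t‖ := by
          gcongr
          linarith
      _ = _ := by rw [norm_mul]; ring

/-- Unscaled momentum on the real line. -/
noncomputable def pp (a b x : ℝ) : ℂ := (Real.sqrt a : ℂ) * wp (b/a) ((x / Real.sqrt a : ℝ) : ℂ)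

/-- Imaginary part of the phase. -/
noncomputable def Phi (a b x : ℝ) : ℝ := ∫ t in (0:ℝ)..x, (pp a b t).im

lemma wscale_mem {a : ℝ} (ha : 0 < a) {x : ℝ} (hx : x < Real.sqrt a / 4) :
    ((x / Real.sqrt a : ℝ) : ℂ) ∈ wD := by
  apply wD_real
  have : 0 < Real.sqrt a := Real.sqrt_pos.mpr ha
  rw [div_lt_iff₀ this]; linarith

lemma wscale_hasDeriv {a : ℝ} {f : ℂ → ℂ} {f' : ℂ} {x : ℝ}
    (h : HasDerivAt f f' ((x / Real.sqrt a : ℝ) : ℂ)) :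
    HasDerivAt (fun x : ℝ => f ((x / Real.sqrt a : ℝ) : ℂ)) (f' / Real.sqrt a) x := by
  have h1 : HasDerivAt (fun x : ℝ => ((x / Real.sqrt a : ℝ) : ℂ)) (1 / Real.sqrt a : ℝ) x :=
    ((hasDerivAt_id x).div_const _).ofReal_comp
  refine (h.comp x h1).congr_deriv ?_
  push_cast; ring

lemma wp_cont_real (y : ℝ) : Continuous (fun x : ℝ => wp y (x:ℂ)) := by
  have h : Continuous (fun x : ℝ => wP y (x:ℂ)) := by unfold wP; fun_prop
  exact h.cpow continuous_const (fun x => Or.inl (by rw [wP_re]; simp))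

lemma pp_cont (a b : ℝ) : Continuous (pp a b) := by
  unfold pp
  exact continuous_const.mul ((wp_cont_real (b/a)).comp (continuous_id.div_const _))

lemma Phi_eq {a b : ℝ} (ha : 0 < a) (hb0 : 0 ≤ b) (hb : b ≤ a/100) {x : ℝ}
    (hx : x < Real.sqrt a / 4) :
    a * (wF (b/a) ((x / Real.sqrt a : ℝ) : ℂ) - wF (b/a) 0).im = Phi a b x := by
  have hy0 : 0 ≤ b/a := by positivity
  have hy : b/a ≤ 1/100 := by rw [div_le_iff₀ ha]; linarith
  have hsa : 0 < Real.sqrt a := Real.sqrt_pos.mpr ha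
  unfold Phi
  have := intervalIntegral.integral_eq_sub_of_hasDerivAt (a := 0) (b := x)
    (f := fun x : ℝ => a * (wF (b/a) ((x / Real.sqrt a : ℝ) : ℂ)).im)
    (f' := fun x => (pp a b x).im) (by
      intro r hr
      have hr2 : r < Real.sqrt a / 4 := by
        have := hr.2
        rcases max_cases 0 x with h | h <;> linarith
      have h1 := hasDerivAt_im (wscale_hasDeriv (wF_hasDeriv hy0 hy (wscale_mem ha hr2)))
      refine (h1.const_mul a).congr_deriv ?_
      rw [pp, im_ofReal_mul, div_ofReal_im]
      field_simp
      rw [Real.sq_sqrt ha.le]) ((continuous_im.comp (pp_cont a b)).intervalIntegrable _ _)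
  rw [this]
  simp
  ring

lemma wkb {η a b : ℝ} (hη : 0 < η) (hη1 : η ≤ 1) (ha : 0 < a) (haη : 12000000 ≤ η * a)
    (hb0 : 0 ≤ b) (hb : b ≤ a/100) :
    ∃ v v1 : ℝ → ℂ, (∀ x < Real.sqrt a / 4, HasDerivAt v (v1 x) x) ∧
      (∀ x < Real.sqrt a / 4, HasDerivAt v1 (-(a + b * I - I * x ^ 2) * v x) x) ∧
      (ContDiffOn ℝ (⊤ : ℕ∞) v (Set.Iio (Real.sqrt a / 4))) ∧
      (∀ x < Real.sqrt a / 4, (1 - η) * Real.exp (-(2 * Phi a b x)) ≤ ‖pp a b x‖ * ‖v x‖ ^ 2) ∧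
      (∀ x < Real.sqrt a / 4, ‖pp a b x‖ * ‖v x‖ ^ 2 ≤ (1 + η) * Real.exp (-(2 * Phi a b x))) ∧
      (∀ x < Real.sqrt a / 4, ‖v1 x - I * pp a b x * v x‖ ≤ η * ‖pp a b x‖ * ‖v x‖) := by
  have hy0 : 0 ≤ b/a := by positivity
  have hy : b/a ≤ 1/100 := by rw [div_le_iff₀ ha]; linarith
  have hsa : 0 < Real.sqrt a := Real.sqrt_pos.mpr ha
  have hsa2 : Real.sqrt a ^ 2 = a := Real.sq_sqrt ha.le
  obtain ⟨V, V1, hV, hV1, hlo, hup, hd⟩ := wV (h := 1/a) (δ := η/3) hy0 hy (by positivity)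
    (by linarith) (by
      rw [mul_one_div, div_le_iff₀ ha]; linarith)
  set c : ℝ := (Real.sqrt (Real.sqrt a))⁻¹ with hc
  have hc0 : 0 < c := by positivity
  have hc2 : Real.sqrt a * c ^ 2 = 1 := by
    rw [hc, inv_pow, Real.sq_sqrt hsa.le]; field_simp
  have hppn : ∀ x, ‖pp a b x‖ = Real.sqrt a * ‖wp (b/a) ((x / Real.sqrt a : ℝ) : ℂ)‖ := by
    intro x
    rw [pp, norm_mul, Complex.norm_of_nonneg hsa.le]
  have hexp : ∀ x < Real.sqrt a / 4,
      -(2 / (1/a)) * (wF (b/a) ((x / Real.sqrt a : ℝ) : ℂ) - wF (b/a) 0).im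
        = -(2 * Phi a b x) := by
    intro x hx
    rw [← Phi_eq ha hb0 hb hx]; field_simp
  have hnorm : ∀ x, ‖pp a b x‖ * ‖(c:ℂ) * V ((x / Real.sqrt a : ℝ) : ℂ)‖ ^ 2 =
      ‖wp (b/a) ((x / Real.sqrt a : ℝ) : ℂ)‖ * ‖V ((x / Real.sqrt a : ℝ) : ℂ)‖ ^ 2 := by
    intro x
    rw [hppn, norm_mul, Complex.norm_of_nonneg hc0.le]
    linear_combination (‖wp (b/a) ((x / Real.sqrt a : ℝ) : ℂ)‖ * ‖V ((x / Real.sqrt a : ℝ) : ℂ)‖ ^ 2) * hc2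
  refine ⟨fun x => c * V ((x / Real.sqrt a : ℝ) : ℂ),
    fun x => c * (V1 ((x / Real.sqrt a : ℝ) : ℂ) / Real.sqrt a), ?_, ?_, ?_, ?_, ?_, ?_⟩
  · intro x hx
    exact (wscale_hasDeriv (hV _ (wscale_mem ha hx))).const_mul _
  · intro x hx
    refine (((wscale_hasDeriv (hV1 _ (wscale_mem ha hx))).div_const _).const_mul _).congr_deriv ?_
    have e : (Real.sqrt a : ℂ) ≠ 0 := by exact_mod_cast hsa.ne'
    have e1 : (a:ℂ) ≠ 0 := by exact_mod_cast ha.ne'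
    have e2 : (Real.sqrt a : ℂ) ^ 2 = a := by exact_mod_cast hsa2
    rw [wP]
    push_cast
    have e4 : (Real.sqrt a : ℂ) ^ 4 = a ^ 2 := by rw [← e2]; ring
    generalize V _ = V0
    field_simp
    ring_nf
    rw [e4, e2]
    ring
  · have h1 : DifferentiableOn ℂ V wD := fun t ht =>
      (hV t ht).differentiableAt.differentiableWithinAt
    have h2 : ContDiffOn ℂ (⊤ : ℕ∞) V wD := h1.contDiffOn wD_open
    have h3 : ContDiffOn ℝ (⊤ : ℕ∞) V wD := h2.restrict_scalars ℝ
    have h4 : ContDiffOn ℝ (⊤ : ℕ∞) (fun x : ℝ => ((x / Real.sqrt a : ℝ) : ℂ))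
        (Set.Iio (Real.sqrt a / 4)) := by
      apply ContDiff.contDiffOn
      exact Complex.ofRealCLM.contDiff.comp (contDiff_id.div_const _)
    exact contDiffOn_const.mul (h3.comp h4 (fun x hx => wscale_mem ha hx))
  · intro x hx
    have h1 := hlo _ (wscale_mem ha hx)
    dsimp only
    rw [hnorm]
    refine le_trans ?_ h1
    rw [hexp x hx]
    apply mul_le_mul_of_nonneg_right _ (Real.exp_pos _).le
    nlinarith
  · intro x hx
    have h1 := hup _ (wscale_mem ha hx)
    dsimp only
    rw [hnorm]
    refine le_trans h1 ?_
    rw [hexp x hx]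
    apply mul_le_mul_of_nonneg_right _ (Real.exp_pos _).le
    nlinarith
  · intro x hx
    have h1 := hd _ (wscale_mem ha hx)
    have h2 := wp_norm_lower hy0 hy (wscale_mem ha hx)
    dsimp only
    have e : (Real.sqrt a : ℂ) ≠ 0 := by exact_mod_cast hsa.ne'
    have e1 : (a:ℂ) ≠ 0 := by exact_mod_cast ha.ne'
    have e2 : (Real.sqrt a : ℂ) ^ 2 = a := by exact_mod_cast hsa2
    have h3 : (c:ℂ) * (V1 ((x / Real.sqrt a : ℝ) : ℂ) / Real.sqrt a)
        - I * pp a b x * (c * V ((x / Real.sqrt a : ℝ) : ℂ))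
        = (c / Real.sqrt a : ℝ) * (V1 ((x / Real.sqrt a : ℝ) : ℂ) -
          I * wp (b/a) ((x / Real.sqrt a : ℝ) : ℂ) / (1/a : ℝ) * V ((x / Real.sqrt a : ℝ) : ℂ)) := by
      rw [pp]
      push_cast
      generalize V _ = V0
      generalize wp _ _ = p
      generalize V1 _ = V2
      field_simp
      rw [e2]
      ring
    rw [h3, norm_mul, Complex.norm_of_nonneg (by positivity), hppn, norm_mul, Complex.norm_of_nonneg hc0.le]
    refine (mul_le_mul_of_nonneg_left h1 (by positivity)).trans ?_
    have hn : 0 ≤ ‖V ((x / Real.sqrt a : ℝ) : ℂ)‖ := norm_nonneg _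
    generalize ‖V ((x / Real.sqrt a : ℝ) : ℂ)‖ = n at *
    generalize ‖wp (b/a) ((x / Real.sqrt a : ℝ) : ℂ)‖ = w at *
    have h6 : 6 ≤ η * a * w := by nlinarith
    calc c / Real.sqrt a * (6 * n) = (c / Real.sqrt a * n) * 6 := by ring
      _ ≤ (c / Real.sqrt a * n) * (η * a * w) := mul_le_mul_of_nonneg_left h6 (by positivity)
      _ = (c / Real.sqrt a * n) * (η * Real.sqrt a ^ 2 * w) := by rw [hsa2]
      _ = _ := by field_simp

lemma pp_sq {a : ℝ} (ha : 0 < a) (b x : ℝ) : pp a b x ^ 2 = a + b * I - I * x ^ 2 := by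
  have hsa2 : (Real.sqrt a : ℂ) ^ 2 = a := by exact_mod_cast Real.sq_sqrt ha.le
  have ha' : (a:ℂ) ≠ 0 := by exact_mod_cast ha.ne'
  rw [pp, mul_pow, wp_sq, wP]
  push_cast
  rw [div_pow, hsa2]
  field_simp

lemma pp_neg (a b x : ℝ) : pp a b (-x) = pp a b x := by
  unfold pp wp wP
  push_cast
  congr 3
  ring

lemma pp_rel {a : ℝ} (ha : 0 < a) (b x : ℝ) :
    (pp a b x).re ^ 2 - (pp a b x).im ^ 2 = a ∧ 2 * (pp a b x).re * (pp a b x).im = b - x ^ 2 ∧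
      0 ≤ (pp a b x).re := by
  have h := pp_sq ha b x
  have h1 := congrArg re h
  have h2 := congrArg im h
  simp [pow_two] at h1 h2
  refine ⟨by nlinarith, by nlinarith, ?_⟩
  rw [pp, re_ofReal_mul]
  exact mul_nonneg (Real.sqrt_nonneg _) (wp_re_nonneg _ _)

lemma pp_re_ge {a : ℝ} (ha : 0 < a) (b x : ℝ) : Real.sqrt a ≤ (pp a b x).re := by
  obtain ⟨h1, h2, h3⟩ := pp_rel ha b x
  apply Real.sqrt_le_iff.mpr ⟨h3, by nlinarith [sq_nonneg (pp a b x).im]⟩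

lemma pp_norm_ge {a : ℝ} (ha : 0 < a) (b x : ℝ) : Real.sqrt a ≤ ‖pp a b x‖ :=
  (pp_re_ge ha b x).trans (re_le_norm _)

lemma pp_norm_sq {a : ℝ} (ha : 0 < a) (b x : ℝ) :
    ‖pp a b x‖ ^ 4 = a ^ 2 + (b - x ^ 2) ^ 2 := by
  have h : ‖pp a b x‖ ^ 2 = (pp a b x).re ^ 2 + (pp a b x).im ^ 2 := by
    rw [← normSq_eq_norm_sq, normSq_apply]; ring
  obtain ⟨h1, h2, h3⟩ := pp_rel ha b x
  rw [show ‖pp a b x‖ ^ 4 = (‖pp a b x‖ ^ 2) ^ 2 by ring, h, ← h2]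
  linear_combination ((pp a b x).re ^ 2 - (pp a b x).im ^ 2 + a) * h1

lemma pp_norm_le {a b κ x : ℝ} (ha : 0 < a) (hb0 : 0 ≤ b) (hκ : 0 ≤ κ)
    (hbκ : 5 * b ^ 2 ≤ κ * a ^ 2) (hx : x ^ 2 ≤ 4 * b) :
    ‖pp a b x‖ ≤ Real.sqrt a * (1 + κ) := by
  have h := pp_norm_sq ha b x
  have hs : Real.sqrt a ^ 4 = a ^ 2 := by
    rw [show Real.sqrt a ^ 4 = (Real.sqrt a ^ 2) ^ 2 by ring, Real.sq_sqrt ha.le]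
  have h1 : (b - x^2)^2 ≤ 9 * b^2 := by nlinarith [sq_nonneg x]
  have h2 : ‖pp a b x‖ ^ 4 ≤ (Real.sqrt a * (1 + κ)) ^ 4 := by
    rw [h, mul_pow, hs]
    have : 1 + 4 * κ ≤ (1 + κ) ^ 4 := by nlinarith [sq_nonneg κ, pow_nonneg hκ 3, pow_nonneg hκ 4]
    nlinarith [sq_nonneg a]
  exact le_of_pow_le_pow_left₀ (by norm_num) (by positivity) h2

lemma pp_re_le_outer {a b x : ℝ} (ha : 0 < a) (hx : b ≤ x ^ 2) :
    (pp a b x).re ^ 2 ≤ a + (x ^ 2 - b) := by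
  obtain ⟨h1, h2, h3⟩ := pp_rel ha b x
  set α := (pp a b x).re
  set q := (pp a b x).im
  have : (α ^ 2) * (α ^ 2 - a) = ((x^2 - b)/2)^2 := by
    have : α^2 - a = q^2 := by linarith
    rw [this, show α^2 * q^2 = (2 * α * q / 2)^2 by ring, h2]; ring
  by_contra hcon
  push Not at hcon
  nlinarith [sq_nonneg α]

lemma pp_norm_growth {a b x : ℝ} (ha : 0 < a) (hb : 0 ≤ b) :
    ‖pp a b x‖ ≤ Real.sqrt (a + b + x ^ 2) := by
  apply Real.le_sqrt_of_sq_le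
  have h := pp_norm_sq ha b x
  have : (‖pp a b x‖ ^ 2) ^ 2 ≤ (a + b + x ^ 2) ^ 2 := by
    rw [show (‖pp a b x‖ ^ 2) ^ 2 = ‖pp a b x‖ ^ 4 by ring, h]
    nlinarith [sq_nonneg x, mul_nonneg ha.le hb, mul_nonneg ha.le (sq_nonneg x),
      mul_nonneg hb (sq_nonneg x)]
  exact le_of_sq_le_sq this (by positivity)

lemma Phi_zero (a b : ℝ) : Phi a b 0 = 0 := by simp [Phi]

lemma Phi_hasDeriv (a b x : ℝ) : HasDerivAt (Phi a b) (pp a b x).im x := by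
  have hc : Continuous (fun t => (pp a b t).im) := continuous_im.comp (pp_cont a b)
  exact intervalIntegral.integral_hasDerivAt_right (hc.intervalIntegrable _ _)
    (hc.stronglyMeasurableAtFilter _ _) hc.continuousAt

lemma Phi_neg (a b x : ℝ) : Phi a b (-x) = -Phi a b x := by
  unfold Phi
  have h := intervalIntegral.integral_comp_neg (a := 0) (b := x) (fun t => (pp a b t).im)
  simp only [pp_neg, neg_zero] at h
  rw [h, intervalIntegral.integral_symm]

/-- Action difference from the left turning point. -/
noncomputable def GG (a b s : ℝ) : ℝ :=
  2 * Phi a b (Real.sqrt b) + 2 * Phi a b (-Real.sqrt b + s)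

lemma GG_zero (a b : ℝ) : GG a b 0 = 0 := by
  rw [GG, add_zero, Phi_neg]; ring

lemma GG_hasDeriv {a b : ℝ} (ha : 0 < a) (hb : 0 ≤ b) (s : ℝ) :
    HasDerivAt (GG a b) ((2 * Real.sqrt b - s) * s / (pp a b (-Real.sqrt b + s)).re) s := by
  have h1 : HasDerivAt (fun s => -Real.sqrt b + s) 1 s := (hasDerivAt_id s).const_add _
  have h2 := (((Phi_hasDeriv a b (-Real.sqrt b + s)).comp s h1).const_mul 2).const_add
    (2 * Phi a b (Real.sqrt b))
  refine h2.congr_deriv ?_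
  obtain ⟨_, h3, _⟩ := pp_rel ha b (-Real.sqrt b + s)
  have hpos : 0 < (pp a b (-Real.sqrt b + s)).re :=
    lt_of_lt_of_le (Real.sqrt_pos.mpr ha) (pp_re_ge ha b _)
  rw [eq_div_iff hpos.ne']
  have := Real.sq_sqrt hb
  nlinarith

lemma Phi_eq_GG (a b x : ℝ) :
    2 * Phi a b x = GG a b (x + Real.sqrt b) - 2 * Phi a b (Real.sqrt b) := by
  rw [GG]; ring_nf

lemma Phi_eq_GG' (a b x : ℝ) :
    2 * Phi a b x = 2 * Phi a b (Real.sqrt b) - GG a b (Real.sqrt b - x) := by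
  rw [GG, show -Real.sqrt b + (Real.sqrt b - x) = -x by ring, Phi_neg]; ring

/-- General principle: a function vanishing at `0` whose derivative has the sign of `s`
is nonnegative. -/
lemma nonneg_of_deriv_sign {f f' : ℝ → ℝ} {l r : ℝ} (hl : l ≤ 0) (hr : 0 ≤ r)
    (hd : ∀ s, HasDerivAt f (f' s) s) (h0 : f 0 = 0)
    (hn : ∀ s, l ≤ s → s ≤ 0 → f' s ≤ 0) (hp : ∀ s, 0 ≤ s → s ≤ r → 0 ≤ f' s) :
    ∀ s, l ≤ s → s ≤ r → 0 ≤ f s := by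
  have hc : Continuous f := continuous_iff_continuousAt.mpr fun s => (hd s).continuousAt
  intro s h1 h2
  rcases le_total 0 s with h | h
  · have := monotoneOn_of_deriv_nonneg (convex_Icc 0 r) hc.continuousOn
      (fun t _ => (hd t).differentiableAt.differentiableWithinAt)
      (fun t ht => by
        rw [(hd t).deriv]; rw [interior_Icc] at ht; exact hp t ht.1.le ht.2.le)
      (Set.left_mem_Icc.mpr hr) ⟨h, h2⟩ h
    rw [h0] at this; exact this
  · have := antitoneOn_of_deriv_nonpos (convex_Icc l 0) hc.continuousOn
      (fun t _ => (hd t).differentiableAt.differentiableWithinAt)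
      (fun t ht => by
        rw [(hd t).deriv]; rw [interior_Icc] at ht; exact hn t ht.1.le ht.2.le)
      ⟨h1, h⟩ (Set.right_mem_Icc.mpr hl) h
    rw [h0] at this; exact this

lemma cubic_hasDeriv (k c s : ℝ) :
    HasDerivAt (fun s : ℝ => k * (c * s ^ 2 - s ^ 3 / 3)) (k * ((2 * c - s) * s)) s := by
  have h := (((hasDerivAt_pow 2 s).const_mul c).sub ((hasDerivAt_pow 3 s).div_const 3)).const_mul k
  refine h.congr_deriv ?_
  norm_num; left; ring

lemma GG_upper {a b : ℝ} (ha : 0 < a) (hb : 0 ≤ b) {s : ℝ}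
    (h2 : s ≤ Real.sqrt b) :
    GG a b s ≤ 1 / Real.sqrt a * (Real.sqrt b * s ^ 2 - s ^ 3 / 3) := by
  have hsa : 0 < Real.sqrt a := Real.sqrt_pos.mpr ha
  have hsb : 0 ≤ Real.sqrt b := Real.sqrt_nonneg b
  have key : ∀ s, 1 / (pp a b (-Real.sqrt b + s)).re ≤ 1 / Real.sqrt a := fun s =>
    one_div_le_one_div_of_le hsa (pp_re_ge ha b _)
  have := nonneg_of_deriv_sign (l := min s 0) (r := Real.sqrt b) (min_le_right _ _) hsb
    (fun s => ((cubic_hasDeriv (1 / Real.sqrt a) (Real.sqrt b) s).sub (GG_hasDeriv ha hb s)))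
    (by simp [GG_zero]) (by
      intro s hs1 hs2
      have := key s
      rw [div_eq_mul_one_div ((2 * Real.sqrt b - s) * s)]
      have h3 : 0 ≤ (2 * Real.sqrt b - s) * (-s) := mul_nonneg (by linarith) (by linarith)
      nlinarith) (by
      intro s hs1 hs2
      have := key s
      rw [div_eq_mul_one_div ((2 * Real.sqrt b - s) * s)]
      have h3 : 0 ≤ (2 * Real.sqrt b - s) * s := mul_nonneg (by linarith) (by linarith)
      nlinarith) s (min_le_left _ _) h2
  simp only [Pi.sub_apply] at this
  linarith

lemma GG_lower {a b κ : ℝ} (ha : 0 < a) (hb : 0 ≤ b) (hκ : 0 ≤ κ)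
    (hbκ : 5 * b ^ 2 ≤ κ * a ^ 2) {s : ℝ} (h1 : -Real.sqrt b ≤ s) (h2 : s ≤ Real.sqrt b) :
    1 / (Real.sqrt a * (1 + κ)) * (Real.sqrt b * s ^ 2 - s ^ 3 / 3) ≤ GG a b s := by
  have hsa : 0 < Real.sqrt a := Real.sqrt_pos.mpr ha
  have hsb : 0 ≤ Real.sqrt b := Real.sqrt_nonneg b
  have hb2 := Real.sq_sqrt hb
  have key : ∀ s, -Real.sqrt b ≤ s → s ≤ Real.sqrt b →
      1 / (Real.sqrt a * (1 + κ)) ≤ 1 / (pp a b (-Real.sqrt b + s)).re := fun s h1 h2 =>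
    one_div_le_one_div_of_le (hsa.trans_le (pp_re_ge ha b _))
      ((re_le_norm _).trans (pp_norm_le ha hb hκ hbκ (by nlinarith)))
  have := nonneg_of_deriv_sign (l := -Real.sqrt b) (r := Real.sqrt b) (by linarith) hsb
    (fun s => ((GG_hasDeriv ha hb s).sub
      (cubic_hasDeriv (1 / (Real.sqrt a * (1 + κ))) (Real.sqrt b) s)))
    (by simp [GG_zero]) (by
      intro s hs1 hs2
      have := key s hs1 (by linarith)
      rw [div_eq_mul_one_div]
      have h3 : 0 ≤ (2 * Real.sqrt b - s) * (-s) := mul_nonneg (by linarith) (by linarith)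
      nlinarith) (by
      intro s hs1 hs2
      have := key s (by linarith) hs2
      rw [div_eq_mul_one_div]
      have h3 : 0 ≤ (2 * Real.sqrt b - s) * s := mul_nonneg (by linarith) (by linarith)
      nlinarith) s h1 h2
  simp only [Pi.sub_apply] at this
  linarith

/-- Gaussian lower bound on the action on the whole left half line. -/
lemma GG_gauss {a b : ℝ} (ha : 0 < a) (hb : 0 < b) (hba : b ≤ a / 100) {s : ℝ}
    (h2 : s ≤ Real.sqrt b) :
    Real.sqrt b / Real.sqrt a * s ^ 2 / 2 ≤ GG a b s := by
  have hsa : 0 < Real.sqrt a := Real.sqrt_pos.mpr ha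
  have hsb : 0 < Real.sqrt b := Real.sqrt_pos.mpr hb
  have hb2 := Real.sq_sqrt hb.le
  have ha2 := Real.sq_sqrt ha.le
  rcases le_total 0 s with h | h
  · have h3 := GG_lower (κ := 1/10) ha hb.le (by norm_num) (by nlinarith) (by linarith) h2
    refine le_trans ?_ h3
    rw [show Real.sqrt b / Real.sqrt a * s ^ 2 / 2 = (Real.sqrt b * s ^ 2 / 2) / Real.sqrt a by ring,
      one_div_mul_eq_div, div_le_div_iff₀ hsa (by positivity)]
    have : s ^ 3 ≤ Real.sqrt b * s ^ 2 := by nlinarith [sq_nonneg s]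
    have h4 : 0 ≤ Real.sqrt b * s^2 := by positivity
    nlinarith
  · have := nonneg_of_deriv_sign (l := s) (r := 0) h le_rfl
      (fun s => ((GG_hasDeriv ha hb.le s).sub
        (((hasDerivAt_pow 2 s).const_mul (Real.sqrt b / Real.sqrt a)).div_const 2)))
      (by simp [GG_zero]) (by
        intro t ht1 ht2
        have hpos := hsa.trans_le (pp_re_ge ha b (-Real.sqrt b + t))
        have hle := pp_re_le_outer (b := b) (x := -Real.sqrt b + t) ha (by nlinarith)
        set α := (pp a b (-Real.sqrt b + t)).re
        have h5 : Real.sqrt b * α ≤ Real.sqrt a * (2 * Real.sqrt b - t) := by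
          apply le_of_sq_le_sq _ (mul_nonneg hsa.le (by linarith))
          rw [mul_pow, mul_pow, hb2, ha2]
          have h6 : b * α ^ 2 ≤ b * (a + ((-Real.sqrt b + t)^2 - b)) :=
            mul_le_mul_of_nonneg_left hle hb.le
          have h7 : (-Real.sqrt b + t)^2 - b = -2 * Real.sqrt b * t + t^2 := by linear_combination hb2
          rw [h7] at h6
          have h8 : 0 ≤ Real.sqrt b * (-t) := mul_nonneg hsb.le (by linarith)
          nlinarith [mul_nonneg ha.le h8, mul_nonneg hb.le h8, mul_nonneg ha.le hb.le, sq_nonneg t,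
            mul_nonneg ha.le (sq_nonneg t), mul_nonneg (sub_nonneg.mpr hba) (sq_nonneg t),
            mul_nonneg (sub_nonneg.mpr hba) h8]
        have h9 : Real.sqrt b / Real.sqrt a ≤ (2 * Real.sqrt b - t) / α := by
          rw [div_le_div_iff₀ hsa hpos]; linarith
        have : (2 * Real.sqrt b - t) * t / α = (2 * Real.sqrt b - t) / α * t := by ring
        rw [this]
        norm_num
        nlinarith) (by
        intro t ht1 ht2
        have : t = 0 := le_antisymm ht2 ht1
        subst this; simp) s le_rfl h
    simp only [Pi.sub_apply] at this
    linarith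

lemma GG_near {a b κ : ℝ} (ha : 0 < a) (hb : 0 < b) (hκ : 0 < κ) (hκ1 : κ ≤ 1)
    (hbκ : 5 * b ^ 2 ≤ κ * a ^ 2) {s : ℝ} (hs : |s| ≤ κ * Real.sqrt b) :
    (1 - 2 * κ) * (Real.sqrt b / Real.sqrt a) * s ^ 2 ≤ GG a b s ∧
      GG a b s ≤ (1 + κ) * (Real.sqrt b / Real.sqrt a) * s ^ 2 := by
  have hsa : 0 < Real.sqrt a := Real.sqrt_pos.mpr ha
  have hsb : 0 < Real.sqrt b := Real.sqrt_pos.mpr hb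
  obtain ⟨hs1, hs2⟩ := abs_le.mp hs
  have hk : κ * Real.sqrt b ≤ Real.sqrt b := by nlinarith
  have h3 : |s ^ 3| ≤ κ * (Real.sqrt b * s ^ 2) := by
    rw [abs_pow, show |s| ^ 3 = |s| * |s| ^ 2 by ring, sq_abs]
    nlinarith [sq_nonneg s]
  obtain ⟨h4, h5⟩ := abs_le.mp h3
  have h6 : 0 ≤ Real.sqrt b * s ^ 2 := by positivity
  constructor
  · refine le_trans ?_ (GG_lower ha hb.le hκ.le hbκ (by linarith) (by linarith))
    rw [show (1 - 2 * κ) * (Real.sqrt b / Real.sqrt a) * s ^ 2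
      = ((1 - 2 * κ) * (Real.sqrt b * s ^ 2)) / Real.sqrt a by ring,
      one_div_mul_eq_div, div_le_div_iff₀ hsa (by positivity)]
    have : (1 - 2*κ) * (Real.sqrt b * s ^ 2) * (1 + κ) ≤ Real.sqrt b * s ^ 2 - s ^ 3 / 3 := by
      nlinarith [mul_nonneg hκ.le h6, mul_nonneg (mul_nonneg hκ.le hκ.le) h6]
    nlinarith
  · refine le_trans (GG_upper ha hb.le (by linarith)) ?_
    rw [show (1 + κ) * (Real.sqrt b / Real.sqrt a) * s ^ 2
      = ((1 + κ) * (Real.sqrt b * s ^ 2)) / Real.sqrt a by ring, one_div_mul_eq_div]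
    apply div_le_div_of_nonneg_right _ hsa.le
    nlinarith

/-- The total action. -/
noncomputable def SS (a b : ℝ) : ℝ := 2 * Phi a b (Real.sqrt b)

lemma SS_lower {a b : ℝ} (ha : 0 < a) (hb : 0 < b) (hba : b ≤ a / 100) :
    Real.sqrt b / Real.sqrt a * b / 2 ≤ SS a b := by
  have h := GG_gauss ha hb hba (le_refl (Real.sqrt b))
  rw [GG, neg_add_cancel, Phi_zero, Real.sq_sqrt hb.le] at h
  rw [SS]; linarith

lemma Phi_nonneg {a b : ℝ} (ha : 0 < a) (hb : 0 < b) (hba : b ≤ a / 100) {x : ℝ} (hx : 0 ≤ x)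
    (hx2 : x ≤ 3/2 * Real.sqrt b) : 0 ≤ Phi a b x := by
  have hsa : 0 < Real.sqrt a := Real.sqrt_pos.mpr ha
  have hsb : 0 < Real.sqrt b := Real.sqrt_pos.mpr hb
  have hb2 := Real.sq_sqrt hb.le
  rcases le_total x (Real.sqrt b) with h | h
  · unfold Phi
    apply intervalIntegral.integral_nonneg hx
    intro t ht
    obtain ⟨_, h3, h4⟩ := pp_rel ha b t
    have hpos : 0 < (pp a b t).re := hsa.trans_le (pp_re_ge ha b _)
    by_contra hcon
    push Not at hcon
    have : 0 ≤ b - t^2 := by nlinarith [ht.1, ht.2]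
    nlinarith
  · have h1 := Phi_eq_GG' a b x
    have h2 := GG_upper ha hb.le (s := Real.sqrt b - x) (by linarith)
    have h3 := SS_lower ha hb hba
    rw [SS] at h3
    set c := Real.sqrt b
    have h4 : c * (c - x)^2 - (c-x)^3/3 ≤ c^3 / 2 := by
      have : 0 ≤ x - c := by linarith
      have h5 : (x-c)^2 ≤ c^2/4 := by nlinarith
      have h6 : (x-c)^3 ≤ c^3/8 := by
        have := pow_le_pow_left₀ this (show x - c ≤ c/2 by linarith) 3
        linarith [show (c/2)^3 = c^3/8 by ring]
      nlinarith [pow_pos hsb 3]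
    have h5 : 1 / Real.sqrt a * (c * (c - x)^2 - (c-x)^3/3) ≤ 1 / Real.sqrt a * (c^3/2) :=
      mul_le_mul_of_nonneg_left h4 (by positivity)
    have h6 : c / Real.sqrt a * b / 2 = 1 / Real.sqrt a * (c^3/2) := by rw [← hb2]; ring
    linarith

/-- The frequency of the Gaussian profile. -/
noncomputable def lam (a b : ℝ) : ℝ := Real.sqrt b / Real.sqrt a

/-- Twice the leading resolvent norm. -/
noncomputable def KK (a b : ℝ) : ℝ :=
  1 / Real.sqrt a * Real.exp (SS a b) * Real.sqrt (Real.pi / lam a b)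

/-- A WKB solution. -/
structure IsWKB (η a b : ℝ) (v v1 : ℝ → ℂ) : Prop where
  eta_pos : 0 < η
  eta_le : η ≤ 1/2
  a_pos : 0 < a
  b_pos : 0 < b
  hba : b ≤ a / 100
  d0 : ∀ x < Real.sqrt a / 4, HasDerivAt v (v1 x) x
  d1 : ∀ x < Real.sqrt a / 4, HasDerivAt v1 (-(a + b * I - I * x ^ 2) * v x) x
  smooth : ContDiffOn ℝ (⊤ : ℕ∞) v (Set.Iio (Real.sqrt a / 4))
  lo : ∀ x < Real.sqrt a / 4, (1 - η) * Real.exp (-(2 * Phi a b x)) ≤ ‖pp a b x‖ * ‖v x‖ ^ 2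
  up : ∀ x < Real.sqrt a / 4, ‖pp a b x‖ * ‖v x‖ ^ 2 ≤ (1 + η) * Real.exp (-(2 * Phi a b x))
  v1b : ∀ x < Real.sqrt a / 4, ‖v1 x - I * pp a b x * v x‖ ≤ η * ‖pp a b x‖ * ‖v x‖

namespace IsWKB

variable {η a b : ℝ} {v v1 : ℝ → ℂ}

lemma sa (w : IsWKB η a b v v1) : 0 < Real.sqrt a := Real.sqrt_pos.mpr w.a_pos
lemma sb (w : IsWKB η a b v v1) : 0 < Real.sqrt b := Real.sqrt_pos.mpr w.b_pos
lemma lam_pos (w : IsWKB η a b v v1) : 0 < lam a b := div_pos w.sb w.sa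
lemma KK_pos (w : IsWKB η a b v v1) : 0 < KK a b := by
  have h1 := w.sa
  have h2 := w.lam_pos
  have := Real.pi_pos
  unfold KK
  positivity

lemma sb_le (w : IsWKB η a b v v1) : Real.sqrt b ≤ Real.sqrt a / 10 := by
  have h1 := Real.sq_sqrt w.b_pos.le
  have h2 := Real.sq_sqrt w.a_pos.le
  have h3 := w.hba
  have := w.sa
  apply le_of_sq_le_sq _ (by positivity)
  rw [h1, div_pow, h2]; linarith

lemma dom (w : IsWKB η a b v v1) {x : ℝ} (hx : x ≤ 3/2 * Real.sqrt b) : x < Real.sqrt a / 4 := by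
  have := w.sb_le
  have := w.sa
  linarith

lemma sq_le (w : IsWKB η a b v v1) {x : ℝ} (hx : x ≤ 3/2 * Real.sqrt b) :
    ‖v x‖ ^ 2 ≤ (1 + η) / Real.sqrt a * Real.exp (-(2 * Phi a b x)) := by
  have h1 := w.up x (w.dom hx)
  have h2 := pp_norm_ge w.a_pos b x
  rw [div_mul_eq_mul_div, le_div_iff₀ w.sa]
  refine le_trans ?_ h1
  rw [mul_comm]
  exact mul_le_mul_of_nonneg_right h2 (by positivity)

lemma sq_le_left (w : IsWKB η a b v v1) {x : ℝ} (hx : x ≤ 0) :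
    ‖v x‖ ^ 2 ≤ (1 + η) / Real.sqrt a * Real.exp (SS a b) *
      Real.exp (-GG a b (x + Real.sqrt b)) := by
  have hs := w.sb
  have h1 := w.sq_le (x := x) (by linarith)
  rw [mul_assoc, ← Real.exp_add]
  refine h1.trans (le_of_eq ?_)
  rw [Phi_eq_GG a b x, SS]
  congr 2
  ring

lemma sq_le_left' (w : IsWKB η a b v v1) {x : ℝ} (hx : x ≤ 0) :
    ‖v x‖ ^ 2 ≤ (1 + η) / Real.sqrt a * Real.exp (SS a b) *
      Real.exp (-(lam a b * (x + Real.sqrt b) ^ 2 / 2)) := by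
  have h1 := w.sq_le_left hx
  refine h1.trans ?_
  have := GG_gauss w.a_pos w.b_pos w.hba (s := x + Real.sqrt b) (by linarith)
  have h2 := w.sa
  have h3 := w.eta_pos
  apply mul_le_mul_of_nonneg_left _ (by positivity)
  apply Real.exp_le_exp.mpr
  rw [lam]; linarith

lemma sq_le_S (w : IsWKB η a b v v1) {x : ℝ} (hx : x ≤ 0) :
    ‖v x‖ ^ 2 ≤ (1 + η) / Real.sqrt a * Real.exp (SS a b) := by
  refine (w.sq_le_left' hx).trans ?_
  have h2 := w.sa
  have h3 := w.eta_pos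
  have h4 := w.lam_pos
  apply mul_le_of_le_one_right (by positivity)
  rw [Real.exp_le_one_iff]
  have : 0 ≤ lam a b * (x + Real.sqrt b)^2 / 2 := by positivity
  linarith

lemma sq_le_right (w : IsWKB η a b v v1) {x : ℝ} (hx0 : 0 ≤ x) (hx : x ≤ 3/2 * Real.sqrt b) :
    ‖v x‖ ^ 2 ≤ (1 + η) / Real.sqrt a := by
  refine (w.sq_le hx).trans ?_
  have h1 := Phi_nonneg w.a_pos w.b_pos w.hba hx0 hx
  have h2 := w.sa
  have h3 := w.eta_pos
  apply mul_le_of_le_one_right (by positivity)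
  rw [Real.exp_le_one_iff]
  linarith

lemma SS_pos (w : IsWKB η a b v v1) : 0 < SS a b := by
  have h1 := SS_lower w.a_pos w.b_pos w.hba
  have := w.sa
  have := w.sb
  have := w.b_pos
  have : 0 < Real.sqrt b / Real.sqrt a * b / 2 := by positivity
  linarith

lemma sq_le_all (w : IsWKB η a b v v1) {x : ℝ} (hx : x ≤ 3/2 * Real.sqrt b) :
    ‖v x‖ ^ 2 ≤ (1 + η) / Real.sqrt a * Real.exp (SS a b) := by
  rcases le_total x 0 with h | h
  · exact w.sq_le_S h
  · refine (w.sq_le_right h hx).trans ?_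
    have h2 := w.sa
    have h3 := w.eta_pos
    exact le_mul_of_one_le_right (by positivity) (Real.one_le_exp w.SS_pos.le)

lemma v1_le (w : IsWKB η a b v v1) {x : ℝ} (hx : x < Real.sqrt a / 4) :
    ‖v1 x‖ ≤ (1 + η) * ‖pp a b x‖ * ‖v x‖ := by
  have h1 := w.v1b x hx
  have h2 := norm_add_le (v1 x - I * pp a b x * v x) (I * pp a b x * v x)
  rw [sub_add_cancel] at h2
  have h3 : ‖I * pp a b x * v x‖ = ‖pp a b x‖ * ‖v x‖ := by simp
  rw [h3] at h2
  linarith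

lemma cont (w : IsWKB η a b v v1) : ContinuousOn v (Set.Iic (3/2 * Real.sqrt b)) := fun x hx =>
  (w.d0 x (w.dom hx)).continuousAt.continuousWithinAt

lemma cont1 (w : IsWKB η a b v v1) : ContinuousOn v1 (Set.Iic (3/2 * Real.sqrt b)) := fun x hx =>
  (w.d1 x (w.dom hx)).continuousAt.continuousWithinAt

lemma cont_l (w : IsWKB η a b v v1) : ContinuousOn v (Set.Iic 0) :=
  w.cont.mono (Set.Iic_subset_Iic.mpr (by have := w.sb; linarith))

lemma exp_GG_le (w : IsWKB η a b v v1) {κ : ℝ} (hκ : 0 < κ) (hκ1 : κ ≤ 1/4)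
    (hbκ : 5 * b ^ 2 ≤ κ * a ^ 2) {s : ℝ} (hs : s ≤ Real.sqrt b) :
    Real.exp (-GG a b s) ≤ Real.exp (-((1 - 2 * κ) * lam a b) * s ^ 2) +
      Real.exp (-(κ ^ 2 * (lam a b * b) / 4)) * Real.exp (-(lam a b / 4) * s ^ 2) := by
  rcases le_total |s| (κ * Real.sqrt b) with h | h
  · have h1 := (GG_near w.a_pos w.b_pos hκ (by linarith) hbκ h).1
    have : Real.exp (-GG a b s) ≤ Real.exp (-((1 - 2 * κ) * lam a b) * s ^ 2) := by
      apply Real.exp_le_exp.mpr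
      rw [lam]; linarith
    have h2 := mul_pos (Real.exp_pos (-(κ ^ 2 * (lam a b * b) / 4)))
      (Real.exp_pos (-(lam a b / 4) * s ^ 2))
    linarith
  · have h1 := GG_gauss w.a_pos w.b_pos w.hba hs
    have h3 : κ ^ 2 * b ≤ s ^ 2 := by
      have := pow_le_pow_left₀ (by have := w.sb; positivity) h 2
      rwa [mul_pow, Real.sq_sqrt w.b_pos.le, sq_abs] at this
    have : Real.exp (-GG a b s) ≤
        Real.exp (-(κ ^ 2 * (lam a b * b) / 4)) * Real.exp (-(lam a b / 4) * s ^ 2) := by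
      rw [← Real.exp_add]
      apply Real.exp_le_exp.mpr
      have := mul_le_mul_of_nonneg_left h3 w.lam_pos.le
      rw [← lam] at h1
      nlinarith
    have h2 := Real.exp_pos (-((1 - 2 * κ) * lam a b) * s ^ 2)
    linarith

lemma N_bound (w : IsWKB η a b v v1) {κ : ℝ} (hκ : 0 < κ) (hκ1 : κ ≤ 1/4)
    (hbκ : 5 * b ^ 2 ≤ κ * a ^ 2) :
    IntegrableOn (fun x => ‖v x‖ ^ 2) (Set.Iic 0) ∧
    ∫ x in Set.Iic 0, ‖v x‖ ^ 2 ≤ KK a b * ((1 + η) *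
      (Real.sqrt (1 / (1 - 2 * κ)) + 2 * Real.exp (-(κ ^ 2 * (lam a b * b) / 4)))) := by
  have hl := w.lam_pos
  have hsa := w.sa
  have he := w.eta_pos
  set c := Real.sqrt b with hc
  set e := Real.exp (-(κ ^ 2 * (lam a b * b) / 4)) with hedef
  have hk1 : 0 < (1 - 2 * κ) * lam a b := mul_pos (by linarith) hl
  have hk2 : 0 < lam a b / 4 := by positivity
  set k1 := (1 - 2 * κ) * lam a b
  set k2 := lam a b / 4
  have i1 : Integrable (fun x : ℝ => Real.exp (-k1 * (x + c) ^ 2)) :=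
    (integrable_exp_neg_mul_sq hk1).comp_add_right c
  have i2 : Integrable (fun x : ℝ => Real.exp (-k2 * (x + c) ^ 2)) :=
    (integrable_exp_neg_mul_sq hk2).comp_add_right c
  set A := (1 + η) / Real.sqrt a * Real.exp (SS a b) with hA
  have hA0 : 0 < A := by positivity
  have i3 : Integrable (fun x : ℝ => A * (Real.exp (-k1 * (x + c) ^ 2) +
    e * Real.exp (-k2 * (x + c) ^ 2))) := (i1.add (i2.const_mul e)).const_mul A
  have hpt : ∀ x ∈ Set.Iic (0:ℝ), ‖v x‖ ^ 2 ≤ A * (Real.exp (-k1 * (x + c) ^ 2) +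
    e * Real.exp (-k2 * (x + c) ^ 2)) := by
    intro x hx
    refine (w.sq_le_left hx).trans ?_
    apply mul_le_mul_of_nonneg_left _ hA0.le
    have hx' : x ≤ 0 := hx
    exact w.exp_GG_le hκ hκ1 hbκ (by linarith)
  have hIntg : IntegrableOn (fun x => ‖v x‖ ^ 2) (Set.Iic 0) := by
    refine Integrable.mono' i3.integrableOn
      ((w.cont_l.norm.pow 2).aestronglyMeasurable measurableSet_Iic) ?_
    filter_upwards [ae_restrict_mem measurableSet_Iic] with x hx
    rw [Real.norm_of_nonneg (by positivity)]
    exact hpt x hx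
  refine ⟨hIntg, ?_⟩
  calc ∫ x in Set.Iic 0, ‖v x‖ ^ 2 ≤ ∫ x in Set.Iic (0:ℝ), A * (Real.exp (-k1 * (x + c) ^ 2) +
        e * Real.exp (-k2 * (x + c) ^ 2)) :=
        setIntegral_mono_on hIntg i3.integrableOn measurableSet_Iic hpt
    _ ≤ ∫ x : ℝ, A * (Real.exp (-k1 * (x + c) ^ 2) + e * Real.exp (-k2 * (x + c) ^ 2)) := by
        apply setIntegral_le_integral i3
        filter_upwards with x
        simp only [Pi.zero_apply]
        positivity
    _ = A * (Real.sqrt (Real.pi / k1) + e * Real.sqrt (Real.pi / k2)) := by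
        rw [integral_const_mul, integral_add i1 (i2.const_mul e), integral_const_mul,
          integral_add_right_eq_self (fun x : ℝ => Real.exp (-k1 * x ^ 2)) c,
          integral_add_right_eq_self (fun x : ℝ => Real.exp (-k2 * x ^ 2)) c,
          integral_gaussian, integral_gaussian]
    _ = _ := by
        have e1 : Real.sqrt (Real.pi / k1) = Real.sqrt (1 / (1 - 2*κ)) *
            Real.sqrt (Real.pi / lam a b) := by
          rw [← Real.sqrt_mul (by apply one_div_nonneg.mpr; linarith)]
          congr 1
          have : (1 - 2*κ) ≠ 0 := by linarith
          simp only [k1]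
          field_simp
        have e2 : Real.sqrt (Real.pi / k2) = 2 * Real.sqrt (Real.pi / lam a b) := by
          rw [show Real.pi / k2 = 2 ^ 2 * (Real.pi / lam a b) by simp only [k2]; field_simp; norm_num,
            Real.sqrt_mul (by norm_num), Real.sqrt_sq (by norm_num)]
        rw [e1, e2, hA, KK]
        ring

lemma int_left (w : IsWKB η a b v v1) : IntegrableOn (fun x => ‖v x‖ ^ 2) (Set.Iic 0) := by
  refine (w.N_bound (κ := 1/4) (by norm_num) le_rfl ?_).1
  have := w.hba
  have := w.b_pos
  nlinarith

end IsWKB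

lemma cauchy_schwarz {μ : Measure ℝ} {f g : ℝ → ℂ} (hf : AEStronglyMeasurable f μ)
    (hg : AEStronglyMeasurable g μ) (hf2 : Integrable (fun x => ‖f x‖ ^ 2) μ)
    (hg2 : Integrable (fun x => ‖g x‖ ^ 2) μ) :
    Integrable (fun x => f x * g x) μ ∧
    ‖∫ x, f x * g x ∂μ‖ ^ 2 ≤ (∫ x, ‖f x‖ ^ 2 ∂μ) * ∫ x, ‖g x‖ ^ 2 ∂μ := by
  have hIntg : Integrable (fun x => f x * g x) μ := by
    refine Integrable.mono' (hf2.add hg2) (hf.mul hg) ?_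
    filter_upwards with x
    simp only [norm_mul, Pi.add_apply]
    nlinarith [sq_nonneg (‖f x‖ - ‖g x‖), sq_nonneg (‖f x‖), sq_nonneg (‖g x‖)]
  refine ⟨hIntg, ?_⟩
  have hm1 : MemLp f (ENNReal.ofReal 2) μ := by
    simpa using (memLp_two_iff_integrable_sq_norm hf).mpr hf2
  have hm2 : MemLp g (ENNReal.ofReal 2) μ := by
    simpa using (memLp_two_iff_integrable_sq_norm hg).mpr hg2
  have h := integral_mul_norm_le_Lp_mul_Lq (Real.HolderConjugate.two_two) hm1 hm2
  have h1 : ‖∫ x, f x * g x ∂μ‖ ≤ ∫ x, ‖f x‖ * ‖g x‖ ∂μ := by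
    refine (norm_integral_le_integral_norm _).trans (le_of_eq ?_)
    simp
  have e1 : 0 ≤ ∫ x, ‖f x‖ ^ 2 ∂μ := integral_nonneg fun x => by positivity
  have e2 : 0 ≤ ∫ x, ‖g x‖ ^ 2 ∂μ := integral_nonneg fun x => by positivity
  have h2 := h1.trans h
  simp only [Real.rpow_two, ← Real.sqrt_eq_rpow] at h2
  calc _ ≤ (Real.sqrt (∫ x, ‖f x‖ ^ 2 ∂μ) * Real.sqrt (∫ x, ‖g x‖ ^ 2 ∂μ)) ^ 2 :=
        pow_le_pow_left₀ (norm_nonneg _) h2 2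
    _ = _ := by rw [mul_pow, Real.sq_sqrt e1, Real.sq_sqrt e2]

/-- A rapidly decaying solution of the inhomogeneous equation. -/
structure Sol (a b : ℝ) (u u1 f : ℝ → ℂ) : Prop where
  d0 : ∀ x, HasDerivAt u (u1 x) x
  d1 : ∀ x : ℝ, HasDerivAt u1 (-(a + b * I - I * x ^ 2) * u x - f x) x
  fc : Continuous f
  bd : ∃ M, ∀ x : ℝ, (1 + x ^ 2) * ‖u x‖ ≤ M ∧ (1 + x ^ 2) * ‖u1 x‖ ≤ M ∧ (1 + x ^ 2) * ‖f x‖ ≤ M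

namespace Sol
variable {a b : ℝ} {u u1 f : ℝ → ℂ}

lemma reflect (s : Sol a b u u1 f) :
    Sol a b (fun x => u (-x)) (fun x => -u1 (-x)) (fun x => f (-x)) := by
  obtain ⟨M, hM⟩ := s.bd
  refine ⟨?_, ?_, s.fc.comp continuous_neg, M, ?_⟩
  · intro x
    have := (s.d0 (-x)).scomp x (hasDerivAt_neg x)
    simpa [Function.comp_def] using this
  · intro x
    refine (HasDerivAt.neg ((s.d1 (-x)).scomp x (hasDerivAt_neg x))).congr_deriv ?_
    simp
  · intro x
    have := hM (-x)
    simpa using this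

lemma uc (s : Sol a b u u1 f) : Continuous u :=
  continuous_iff_continuousAt.mpr fun x => (s.d0 x).continuousAt

lemma u1c (s : Sol a b u u1 f) : Continuous u1 :=
  continuous_iff_continuousAt.mpr fun x => (s.d1 x).continuousAt

lemma sq_int {g : ℝ → ℂ} (hg : Continuous g) {M : ℝ} (hM : ∀ x : ℝ, (1 + x ^ 2) * ‖g x‖ ≤ M) :
    Integrable (fun x => (1 + x ^ 2) * ‖g x‖ ^ 2) := by
  refine Integrable.mono' (integrable_inv_one_add_sq.const_mul (M ^ 2))
    (by fun_prop) ?_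
  filter_upwards with x
  rw [Real.norm_of_nonneg (by positivity), ← div_eq_mul_inv, le_div_iff₀ (by positivity)]
  have := pow_le_pow_left₀ (by positivity) (hM x) 2
  nlinarith

lemma sq_int' {g : ℝ → ℂ} (hg : Continuous g) {M : ℝ} (hM : ∀ x : ℝ, (1 + x ^ 2) * ‖g x‖ ≤ M) :
    Integrable (fun x => ‖g x‖ ^ 2) := by
  refine Integrable.mono' (sq_int hg hM) (by fun_prop) ?_
  filter_upwards with x
  rw [Real.norm_of_nonneg (by positivity)]
  nlinarith [sq_nonneg x, sq_nonneg (‖g x‖), mul_nonneg (sq_nonneg x) (sq_nonneg (‖g x‖))]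

lemma f_int (s : Sol a b u u1 f) : Integrable (fun x => ‖f x‖ ^ 2) := by
  obtain ⟨M, hM⟩ := s.bd
  exact sq_int' s.fc (fun x => (hM x).2.2)

lemma u_int (s : Sol a b u u1 f) : Integrable (fun x => ‖u x‖ ^ 2) := by
  obtain ⟨M, hM⟩ := s.bd
  exact sq_int' s.uc (fun x => (hM x).1)

end Sol

namespace IsWKB
variable {η a b : ℝ} {v v1 : ℝ → ℂ}

lemma int_right (w : IsWKB η a b v v1) :
    IntegrableOn (fun x => ‖v x‖ ^ 2) (Set.Ioc 0 (3/2 * Real.sqrt b)) ∧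
    ∫ x in Set.Ioc 0 (3/2 * Real.sqrt b), ‖v x‖ ^ 2 ≤
      3/2 * Real.sqrt b * ((1 + η) / Real.sqrt a) := by
  have hb := w.sb
  have hi : IntegrableOn (fun x => ‖v x‖ ^ 2) (Set.Ioc 0 (3/2 * Real.sqrt b)) := by
    have : ContinuousOn (fun x => ‖v x‖ ^ 2) (Set.Icc 0 (3/2 * Real.sqrt b)) :=
      (w.cont.mono Set.Icc_subset_Iic_self).norm.pow 2
    exact (this.integrableOn_Icc).mono_set Set.Ioc_subset_Icc_self
  refine ⟨hi, ?_⟩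
  have h1 := setIntegral_mono_on hi (integrableOn_const (C := (1 + η) / Real.sqrt a) (by simp))
    measurableSet_Ioc (fun x hx => w.sq_le_right hx.1.le hx.2)
  refine h1.trans (le_of_eq ?_)
  rw [setIntegral_const]
  simp [hb.le]

lemma int_all (w : IsWKB η a b v v1) :
    IntegrableOn (fun x => ‖v x‖ ^ 2) (Set.Iic (3/2 * Real.sqrt b)) := by
  have hb := w.sb
  rw [← Set.Iic_union_Ioc_eq_Iic (show 0 ≤ 3/2 * Real.sqrt b by positivity)]
  exact w.int_left.union w.int_right.1

lemma fv_int (w : IsWKB η a b v v1) {f : ℝ → ℂ} (fc : Continuous f)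
    (hf : Integrable (fun x => ‖f x‖ ^ 2)) {E : Set ℝ} (hE : MeasurableSet E)
    (hsub : E ⊆ Set.Iic (3/2 * Real.sqrt b)) :
    IntegrableOn (fun x => f x * v x) E ∧
    ‖∫ x in E, f x * v x‖ ^ 2 ≤ (∫ x in E, ‖f x‖ ^ 2) * ∫ x in E, ‖v x‖ ^ 2 :=
  cauchy_schwarz fc.aestronglyMeasurable.restrict
    ((w.cont.mono hsub).aestronglyMeasurable hE) hf.integrableOn (w.int_all.mono_set hsub)

lemma wronsk_left (w : IsWKB η a b v v1) {u u1 f : ℝ → ℂ} (s : Sol a b u u1 f) {x : ℝ}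
    (hx : x ≤ 3/2 * Real.sqrt b) :
    u1 x * v x - u x * v1 x = -∫ t in Set.Iic x, f t * v t := by
  have hsub : Set.Iic x ⊆ Set.Iic (3/2 * Real.sqrt b) := Set.Iic_subset_Iic.mpr hx
  have hIntg := (w.fv_int s.fc s.f_int measurableSet_Iic hsub).1
  have hd : ∀ t ∈ Set.Iic x, HasDerivAt (fun t => u1 t * v t - u t * v1 t) (-(f t * v t)) t := by
    intro t ht
    have hdom := w.dom (hsub ht)
    refine (((s.d1 t).mul (w.d0 t hdom)).sub ((s.d0 t).mul (w.d1 t hdom))).congr_deriv ?_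
    ring
  obtain ⟨M, hM⟩ := s.bd
  set B := Real.sqrt ((1 + η) / Real.sqrt a * Real.exp (SS a b)) with hB
  have hB0 : 0 ≤ B := Real.sqrt_nonneg _
  have hvB : ∀ t ≤ x, ‖v t‖ ≤ B := fun t ht => Real.le_sqrt_of_sq_le (w.sq_le_all (ht.trans hx))
  have hM0 : 0 ≤ M := (by positivity : 0 ≤ (1 + (0:ℝ)^2) * ‖u 0‖).trans (hM 0).1
  have hlim : Filter.Tendsto (fun t => u1 t * v t - u t * v1 t) Filter.atBot (nhds 0) := by
    have hz : Filter.Tendsto (fun t : ℝ => (M * B + M * (2 * Real.sqrt (a + b + 1) * B)) * |t|⁻¹)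
        Filter.atBot (nhds 0) := by
      have := (tendsto_inv_atTop_zero.comp Filter.tendsto_abs_atBot_atTop).const_mul
        (M * B + M * (2 * Real.sqrt (a + b + 1) * B))
      simpa using this
    refine squeeze_zero_norm' ?_ hz
    filter_upwards [Filter.eventually_le_atBot (min x (-1))] with t ht
    have htx : t ≤ x := ht.trans (min_le_left _ _)
    have ht1 : t ≤ -1 := ht.trans (min_le_right _ _)
    have h1 := hvB t htx
    have h2 := w.v1_le (w.dom (htx.trans hx))
    have h3 := pp_norm_growth (a := a) (b := b) (x := t) w.a_pos w.b_pos.le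
    have hab : |t| = -t := abs_of_neg (by linarith)
    have htpos : 0 < |t| := by rw [hab]; linarith
    have ha := w.a_pos
    have hb := w.b_pos
    have h4 : Real.sqrt (a + b + t^2) ≤ Real.sqrt (a + b + 1) * |t| := by
      rw [← Real.sqrt_sq_eq_abs, ← Real.sqrt_mul (by positivity)]
      apply Real.sqrt_le_sqrt
      have ht2 : 1 ≤ t ^ 2 := by nlinarith
      nlinarith [mul_le_mul_of_nonneg_left ht2 (show 0 ≤ a + b by linarith)]
    have h5 : ‖u1 t‖ ≤ M * |t|⁻¹ := by
      rw [← div_eq_mul_inv, le_div_iff₀ htpos]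
      have := (hM t).2.1
      rw [hab]
      have : -t ≤ 1 + t^2 := by nlinarith
      nlinarith [norm_nonneg (u1 t)]
    have h6 : ‖u t‖ * |t| ≤ M * |t|⁻¹ := by
      rw [← div_eq_mul_inv, le_div_iff₀ htpos]
      have := (hM t).1
      have : |t| * |t| = t^2 := by rw [hab]; ring
      nlinarith [norm_nonneg (u t)]
    have he := w.eta_le
    have he0 := w.eta_pos
    have h7 : ‖v1 t‖ ≤ 2 * Real.sqrt (a + b + 1) * B * |t| := by
      calc ‖v1 t‖ ≤ (1 + η) * ‖pp a b t‖ * ‖v t‖ := h2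
        _ ≤ 2 * (Real.sqrt (a + b + 1) * |t|) * B := by
            gcongr
            · linarith
            · exact h3.trans h4
        _ = _ := by ring
    calc ‖u1 t * v t - u t * v1 t‖ ≤ ‖u1 t‖ * ‖v t‖ + ‖u t‖ * ‖v1 t‖ := by
          refine (norm_sub_le _ _).trans (le_of_eq ?_)
          rw [norm_mul, norm_mul]
      _ ≤ (M * |t|⁻¹) * B + ‖u t‖ * (2 * Real.sqrt (a + b + 1) * B * |t|) := by gcongr
      _ = (M * |t|⁻¹) * B + (‖u t‖ * |t|) * (2 * Real.sqrt (a + b + 1) * B) := by ring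
      _ ≤ (M * |t|⁻¹) * B + (M * |t|⁻¹) * (2 * Real.sqrt (a + b + 1) * B) := by gcongr
      _ = _ := by ring
  have := integral_Iic_of_hasDerivAt_of_tendsto' hd hIntg.neg hlim
  rw [sub_zero] at this
  rw [← this, integral_neg]

lemma wronsk_right (w : IsWKB η a b v v1) {u u1 f : ℝ → ℂ} (s : Sol a b u u1 f) {x : ℝ}
    (hx : -(3/2 * Real.sqrt b) ≤ x) :
    u1 x * v (-x) + u x * v1 (-x) = ∫ t in Set.Iic (-x), f (-t) * v t := by
  have h := w.wronsk_left s.reflect (x := -x) (by linarith)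
  simp only [neg_neg] at h
  linear_combination -h

lemma wr_const (w : IsWKB η a b v v1) {x : ℝ} (hx : -(3/2 * Real.sqrt b) ≤ x)
    (hx2 : x ≤ 3/2 * Real.sqrt b) :
    v1 x * v (-x) + v x * v1 (-x) = 2 * v 0 * v1 0 := by
  have hsb := w.sb
  have hd : ∀ t ∈ Set.Icc (-(3/2 * Real.sqrt b)) (3/2 * Real.sqrt b),
      HasDerivAt (fun t => v1 t * v (-t) + v t * v1 (-t)) 0 t := by
    intro t ht
    have h1 := w.dom ht.2
    have h2 : -t < Real.sqrt a / 4 := w.dom (by linarith [ht.1])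
    have h3 : HasDerivAt (fun t => v (-t)) (-v1 (-t)) t := by
      simpa [Function.comp_def] using (w.d0 (-t) h2).scomp t (hasDerivAt_neg t)
    have h4 : HasDerivAt (fun t => v1 (-t)) ((a + b * I - I * t ^ 2) * v (-t)) t := by
      refine ((w.d1 (-t) h2).scomp t (hasDerivAt_neg t)).congr_deriv ?_
      simp; ring
    refine (((w.d1 t h1).mul h3).add ((w.d0 t h1).mul h4)).congr_deriv ?_
    ring
  have hc := constant_of_has_deriv_right_zero
    (fun t ht => (hd t ht).continuousAt.continuousWithinAt)
    (fun t ht => (hd t (Set.Ico_subset_Icc_self ht)).hasDerivWithinAt)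
  have e1 := hc x ⟨hx, hx2⟩
  have e2 := hc 0 ⟨by linarith, by linarith⟩
  rw [e1, ← e2]
  simp; ring

lemma cramer (w : IsWKB η a b v v1) {u u1 f : ℝ → ℂ} (s : Sol a b u u1 f) {x : ℝ}
    (hx : -(3/2 * Real.sqrt b) ≤ x) (hx2 : x ≤ 3/2 * Real.sqrt b) :
    2 * v 0 * v1 0 * u x = v x * (∫ t in Set.Iic (-x), f (-t) * v t) +
        v (-x) * ∫ t in Set.Iic x, f t * v t ∧
    2 * v 0 * v1 0 * u1 x = v1 x * (∫ t in Set.Iic (-x), f (-t) * v t) -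
        v1 (-x) * ∫ t in Set.Iic x, f t * v t := by
  have h1 := w.wronsk_left s hx2
  have h2 := w.wronsk_right s hx
  have h3 := w.wr_const hx hx2
  have h4 : ∫ t in Set.Iic x, f t * v t = -(u1 x * v x - u x * v1 x) := by rw [h1, neg_neg]
  rw [← h3, ← h2, h4]
  constructor <;> ring

lemma wr_lower (w : IsWKB η a b v v1) : 2 * (1 - η) ^ 2 ≤ ‖2 * v 0 * v1 0‖ := by
  have h0 : (0:ℝ) < Real.sqrt a / 4 := by have := w.sa; positivity
  have h1 := w.lo 0 h0
  have h2 := w.v1b 0 h0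
  rw [Phi_zero] at h1
  simp at h1
  have h3 : ‖I * pp a b 0 * v 0‖ = ‖pp a b 0‖ * ‖v 0‖ := by simp
  have h4 := norm_sub_norm_le (I * pp a b 0 * v 0) (I * pp a b 0 * v 0 - v1 0)
  rw [sub_sub_cancel, norm_sub_rev, h3] at h4
  have h5 : (1 - η) * (‖pp a b 0‖ * ‖v 0‖) ≤ ‖v1 0‖ := by linarith
  have h6 : ‖2 * v 0 * v1 0‖ = 2 * ‖v 0‖ * ‖v1 0‖ := by simp
  rw [h6]
  have he := w.eta_le
  have h7 := mul_le_mul_of_nonneg_left h5 (norm_nonneg (v 0))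
  have h8 := mul_le_mul_of_nonneg_left h1 (show 0 ≤ 1 - η by linarith)
  nlinarith

end IsWKB

lemma sq_add_le' {p q κ : ℝ} (hκ : 0 < κ) : (p + q) ^ 2 ≤ (1 + κ) * p ^ 2 + (1 + 1 / κ) * q ^ 2 := by
  have : (1 + κ) * p ^ 2 + (1 + 1 / κ) * q ^ 2 - (p + q) ^ 2 = (κ * p - q) ^ 2 / κ := by
    field_simp; ring
  have h2 : 0 ≤ (κ * p - q) ^ 2 / κ := by positivity
  linarith

lemma norm_add_sq_le' {p q : ℂ} {κ : ℝ} (hκ : 0 < κ) :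
    ‖p + q‖ ^ 2 ≤ (1 + κ) * ‖p‖ ^ 2 + (1 + 1 / κ) * ‖q‖ ^ 2 :=
  (pow_le_pow_left₀ (norm_nonneg _) (norm_add_le p q) 2).trans (sq_add_le' hκ)

lemma norm_add_sq_le2 {p q : ℂ} : ‖p + q‖ ^ 2 ≤ 2 * ‖p‖ ^ 2 + 2 * ‖q‖ ^ 2 := by
  have := norm_add_sq_le' (p := p) (q := q) (κ := 1) one_pos
  norm_num at this
  exact this

namespace IsWKB
variable {η a b : ℝ} {v v1 : ℝ → ℂ}

lemma inner_bound (w : IsWKB η a b v v1) {u u1 f : ℝ → ℂ} (s : Sol a b u u1 f) {N κ : ℝ} (hκ : 0 < κ)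
    (hN : ∫ x in Set.Iic 0, ‖v x‖ ^ 2 ≤ N) :
    ‖2 * v 0 * v1 0‖ ^ 2 * ∫ x in Set.Ioc (-(3/2 * Real.sqrt b)) 0, ‖u x‖ ^ 2 ≤
      (1 + κ) * N ^ 2 * (∫ x in Set.Ioi 0, ‖f x‖ ^ 2) +
      (1 + 1 / κ) * (4 * N * (3/2 * Real.sqrt b * ((1 + η) / Real.sqrt a))) *
        ∫ x in Set.Iic 0, ‖f x‖ ^ 2 := by
  have hsb := w.sb
  have hsa := w.sa
  have he := w.eta_pos
  set X := 3/2 * Real.sqrt b with hX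
  set q := (1 + η) / Real.sqrt a with hq
  set W := 2 * v 0 * v1 0 with hW
  set Fp := ∫ x in Set.Ioi 0, ‖f x‖ ^ 2 with hFp
  set Fm := ∫ x in Set.Iic 0, ‖f x‖ ^ 2 with hFm
  have hX0 : 0 < X := by positivity
  have hq0 : 0 < q := by positivity
  have hFp0 : 0 ≤ Fp := setIntegral_nonneg measurableSet_Ioi fun x _ => by positivity
  have hFm0 : 0 ≤ Fm := setIntegral_nonneg measurableSet_Iic fun x _ => by positivity
  have hN0 : 0 ≤ N := (setIntegral_nonneg measurableSet_Iic fun x _ => by positivity).trans hN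
  have sr := s.reflect
  have eFp : ∫ t in Set.Iic 0, ‖f (-t)‖ ^ 2 = Fp := by
    have := integral_comp_neg_Iic 0 (fun t => ‖f t‖ ^ 2)
    simpa using this
  have eFm : ∫ t in Set.Ioi 0, ‖f (-t)‖ ^ 2 = Fm := by
    have := integral_comp_neg_Ioi 0 (fun t => ‖f t‖ ^ 2)
    simpa using this
  have key : ∀ x ∈ Set.Ioc (-X) 0, ‖W‖ ^ 2 * ‖u x‖ ^ 2 ≤
      ((1 + κ) * (N * Fp) + (1 + 1 / κ) * (2 * (X * q * Fm))) * ‖v x‖ ^ 2 +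
        (1 + 1 / κ) * (2 * (q * (N * Fm))) := by
    intro x hx
    have hxX : -x ≤ X := by linarith [hx.1]
    have hc := (w.cramer s (x := x) (by rw [← hX]; exact hx.1.le) (by rw [← hX]; linarith [hx.2])).1
    have hB1 := w.fv_int sr.fc sr.f_int (E := Set.Iic 0) measurableSet_Iic
      (Set.Iic_subset_Iic.mpr hX0.le)
    have hB2 := w.fv_int sr.fc sr.f_int (E := Set.Ioc 0 (-x)) measurableSet_Ioc
      (fun t ht => Set.mem_Iic.mpr (by rw [← hX]; linarith [ht.2]))
    have hA := w.fv_int s.fc s.f_int (E := Set.Iic x) measurableSet_Iic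
      (fun t ht => Set.mem_Iic.mpr (by rw [← hX]; linarith [hx.2, Set.mem_Iic.mp ht]))
    have hsplit : ∫ t in Set.Iic (-x), f (-t) * v t =
        (∫ t in Set.Iic 0, f (-t) * v t) + ∫ t in Set.Ioc 0 (-x), f (-t) * v t := by
      rw [← setIntegral_union (Set.Iic_disjoint_Ioc le_rfl) measurableSet_Ioc hB1.1 hB2.1,
        Set.Iic_union_Ioc_eq_Iic (by linarith [hx.2])]
    have b1 : ‖∫ t in Set.Iic 0, f (-t) * v t‖ ^ 2 ≤ N * Fp := by
      refine hB1.2.trans ?_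
      rw [eFp, mul_comm]
      exact mul_le_mul_of_nonneg_right hN hFp0
    have b2 : ‖∫ t in Set.Ioc 0 (-x), f (-t) * v t‖ ^ 2 ≤ X * q * Fm := by
      refine hB2.2.trans ?_
      rw [mul_comm]
      have i1 : ∫ t in Set.Ioc 0 (-x), ‖v t‖ ^ 2 ≤ X * q :=
        (setIntegral_mono_set w.int_right.1 (ae_of_all _ fun t => by simp)
          (Set.Ioc_subset_Ioc_right hxX).eventuallyLE).trans w.int_right.2
      have i2 : ∫ t in Set.Ioc 0 (-x), ‖f (-t)‖ ^ 2 ≤ Fm := by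
        rw [← eFm]
        exact setIntegral_mono_set sr.f_int.integrableOn (ae_of_all _ fun t => by simp)
          Set.Ioc_subset_Ioi_self.eventuallyLE
      exact mul_le_mul i1 i2 (setIntegral_nonneg measurableSet_Ioc fun x _ => by positivity)
        (by positivity)
    have bA : ‖∫ t in Set.Iic x, f t * v t‖ ^ 2 ≤ N * Fm := by
      refine hA.2.trans ?_
      rw [mul_comm]
      have i1 : ∫ t in Set.Iic x, ‖v t‖ ^ 2 ≤ N :=
        (setIntegral_mono_set w.int_left (ae_of_all _ fun t => by simp)
          (Set.Iic_subset_Iic.mpr hx.2).eventuallyLE).trans hN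
      have i2 : ∫ t in Set.Iic x, ‖f t‖ ^ 2 ≤ Fm :=
        setIntegral_mono_set s.f_int.integrableOn (ae_of_all _ fun t => by simp)
          (Set.Iic_subset_Iic.mpr hx.2).eventuallyLE
      exact mul_le_mul i1 i2 (setIntegral_nonneg measurableSet_Iic fun x _ => by positivity)
        (by positivity)
    have bv : ‖v (-x)‖ ^ 2 ≤ q := w.sq_le_right (by linarith [hx.2]) (by rw [← hX]; exact hxX)
    rw [← mul_pow, ← norm_mul, hc, hsplit, mul_add, add_assoc]
    generalize (∫ t in Set.Iic 0, f (-t) * v t) = B1 at *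
    generalize (∫ t in Set.Ioc 0 (-x), f (-t) * v t) = B2 at *
    generalize (∫ t in Set.Iic x, f t * v t) = A at *
    refine (norm_add_sq_le' hκ).trans ?_
    have h2 := norm_add_sq_le2 (p := v x * B2) (q := v (-x) * A)
    simp only [norm_mul, mul_pow] at h2 ⊢
    have m1 := mul_le_mul_of_nonneg_left b1 (sq_nonneg ‖v x‖)
    have m2 := mul_le_mul_of_nonneg_left b2 (sq_nonneg ‖v x‖)
    have m3 : ‖v (-x)‖ ^ 2 * ‖A‖ ^ 2 ≤ q * (N * Fm) :=
      mul_le_mul bv bA (by positivity) hq0.le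
    have hk : 0 < 1 + 1 / κ := by positivity
    calc _ ≤ (1 + κ) * (‖v x‖ ^ 2 * (N * Fp)) + (1 + 1 / κ) *
          (2 * (‖v x‖ ^ 2 * (X * q * Fm)) + 2 * (q * (N * Fm))) := by
          gcongr
          linarith
      _ = _ := by ring
  have hvint : IntegrableOn (fun x => ‖v x‖ ^ 2) (Set.Ioc (-X) 0) :=
    w.int_left.mono_set Set.Ioc_subset_Iic_self
  have hcint : IntegrableOn (fun _ : ℝ => (1 + 1 / κ) * (2 * (q * (N * Fm)))) (Set.Ioc (-X) 0) :=
    integrableOn_const (by simp)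
  have h1 := setIntegral_mono_on (s.u_int.integrableOn.const_mul (‖W‖ ^ 2))
    ((hvint.const_mul ((1 + κ) * (N * Fp) + (1 + 1 / κ) * (2 * (X * q * Fm)))).add hcint)
    measurableSet_Ioc key
  rw [integral_const_mul] at h1
  refine h1.trans ?_
  simp only [Pi.add_apply]
  rw [integral_add (hvint.const_mul _) hcint, integral_const_mul, setIntegral_const]
  have i1 : ∫ t in Set.Ioc (-X) 0, ‖v t‖ ^ 2 ≤ N :=
    (setIntegral_mono_set w.int_left (ae_of_all _ fun t => by simp)
      Set.Ioc_subset_Iic_self.eventuallyLE).trans hN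
  have i2 : volume.real (Set.Ioc (-X) 0) = X := by simp [hX0.le]
  rw [i2, smul_eq_mul]
  have hk : 0 < 1 + 1 / κ := by positivity
  calc _ ≤ ((1 + κ) * (N * Fp) + (1 + 1 / κ) * (2 * (X * q * Fm))) * N +
        X * ((1 + 1 / κ) * (2 * (q * (N * Fm)))) := by gcongr
    _ = _ := by ring

end IsWKB

lemma Sol.outer (a b : ℝ) (hb : 0 < b) {u u1 f : ℝ → ℂ} (s : Sol a b u u1 f) :
    b * ∫ x in Set.Iic (-(3/2 * Real.sqrt b)), ‖u x‖ ^ 2 ≤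
      ‖u1 (-(3/2 * Real.sqrt b))‖ * ‖u (-(3/2 * Real.sqrt b))‖ +
      (∫ x in Set.Iic (-(3/2 * Real.sqrt b)), ‖f x‖ ^ 2) / b := by
  set X := 3/2 * Real.sqrt b with hX
  obtain ⟨M, hM⟩ := s.bd
  have hsb : 0 < Real.sqrt b := Real.sqrt_pos.mpr hb
  have hsq := Real.sq_sqrt hb.le
  have hu2 := Sol.sq_int s.uc (fun x => (hM x).1)
  have hmain : Integrable (fun x : ℝ => (x ^ 2 - b) * ‖u x‖ ^ 2) := by
    have := hu2.sub (s.u_int.const_mul (1 + b))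
    refine this.congr (ae_of_all _ fun x => ?_)
    simp only [Pi.sub_apply]; ring
  have hfu : Integrable (fun x : ℝ => f x * (starRingEnd ℂ) (u x)) := by
    refine (cauchy_schwarz (s.fc.aestronglyMeasurable)
      (Complex.continuous_conj.comp s.uc).aestronglyMeasurable s.f_int ?_).1
    simpa using s.u_int
  have hd : ∀ x ∈ Set.Iic (-X), HasDerivAt (fun x => (u1 x * (starRingEnd ℂ) (u x)).im)
      ((x ^ 2 - b) * ‖u x‖ ^ 2 - (f x * (starRingEnd ℂ) (u x)).im) x := by
    intro x _
    have hc : HasDerivAt (fun x => (starRingEnd ℂ) (u x)) ((starRingEnd ℂ) (u1 x)) x :=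
      (Complex.conjCLE.toContinuousLinearMap.hasFDerivAt.comp_hasDerivAt x (s.d0 x))
    have h1 := hasDerivAt_im ((s.d1 x).mul hc)
    refine h1.congr_deriv ?_
    have e1 : ‖u x‖ ^ 2 = (u x).re ^ 2 + (u x).im ^ 2 := by
      rw [← Complex.normSq_eq_norm_sq, Complex.normSq_apply]; ring
    rw [e1]
    simp [pow_two]
    ring
  have hlim : Filter.Tendsto (fun x => (u1 x * (starRingEnd ℂ) (u x)).im) Filter.atBot (nhds 0) := by
    have hM0 : 0 ≤ M := (by positivity : 0 ≤ (1 + (0:ℝ)^2) * ‖u 0‖).trans (hM 0).1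
    have hz : Filter.Tendsto (fun t : ℝ => (M * M) * |t|⁻¹) Filter.atBot (nhds 0) := by
      simpa using (tendsto_inv_atTop_zero.comp Filter.tendsto_abs_atBot_atTop).const_mul (M * M)
    refine squeeze_zero_norm' ?_ hz
    filter_upwards [Filter.eventually_le_atBot (-1)] with t ht
    have hab : |t| = -t := abs_of_neg (by linarith)
    have htpos : 0 < |t| := by rw [hab]; linarith
    have h0 : ‖u t‖ ≤ M := by
      have := (hM t).1
      have := mul_nonneg (sq_nonneg t) (norm_nonneg (u t))
      linarith
    have h5 : ‖u1 t‖ ≤ M * |t|⁻¹ := by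
      rw [← div_eq_mul_inv, le_div_iff₀ htpos]
      have := (hM t).2.1
      rw [hab]
      have : -t ≤ 1 + t^2 := by nlinarith
      nlinarith [norm_nonneg (u1 t)]
    calc _ ≤ ‖u1 t * (starRingEnd ℂ) (u t)‖ := by
          rw [Real.norm_eq_abs]; exact Complex.abs_im_le_norm _
      _ = ‖u1 t‖ * ‖u t‖ := by simp
      _ ≤ M * |t|⁻¹ * M := by gcongr
      _ = _ := by ring
  have hfi : Integrable (fun x : ℝ => (f x * (starRingEnd ℂ) (u x)).im) := hfu.im
  have hI := integral_Iic_of_hasDerivAt_of_tendsto' hd (hmain.sub hfi).integrableOn hlim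
  rw [sub_zero] at hI
  have hpt : ∀ x ∈ Set.Iic (-X), b * ‖u x‖ ^ 2 - ‖f x‖ ^ 2 / b ≤
      (x ^ 2 - b) * ‖u x‖ ^ 2 - (f x * (starRingEnd ℂ) (u x)).im := by
    intro x hx
    have hx' : x ≤ -X := hx
    have h1 : 9/4 * b ≤ x ^ 2 := by nlinarith
    have h2 : (f x * (starRingEnd ℂ) (u x)).im ≤ ‖f x‖ * ‖u x‖ := by
      refine (le_abs_self _).trans ((Complex.abs_im_le_norm _).trans (le_of_eq ?_))
      simp
    have h3 : ‖f x‖ * ‖u x‖ ≤ ‖f x‖ ^ 2 / b + b / 4 * ‖u x‖ ^ 2 := by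
      have : ‖f x‖ ^ 2 / b + b / 4 * ‖u x‖ ^ 2 - ‖f x‖ * ‖u x‖ =
          (‖f x‖ - b / 2 * ‖u x‖) ^ 2 / b := by field_simp; ring
      have h4 : 0 ≤ (‖f x‖ - b / 2 * ‖u x‖) ^ 2 / b := by positivity
      linarith
    have h5 := mul_le_mul_of_nonneg_right h1 (sq_nonneg ‖u x‖)
    linarith
  have hm := setIntegral_mono_on
    ((s.u_int.const_mul b).sub (s.f_int.div_const b)).integrableOn
    (hmain.sub hfi).integrableOn measurableSet_Iic hpt
  simp only [Pi.sub_apply] at hm hI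
  rw [hI, integral_sub (s.u_int.const_mul b).integrableOn (s.f_int.div_const b).integrableOn,
    integral_const_mul, integral_div] at hm
  have hT : (u1 (-X) * (starRingEnd ℂ) (u (-X))).im ≤ ‖u1 (-X)‖ * ‖u (-X)‖ := by
    refine (le_abs_self _).trans ((Complex.abs_im_le_norm _).trans (le_of_eq ?_))
    simp
  linarith

namespace IsWKB
variable {η a b : ℝ} {v v1 : ℝ → ℂ}

lemma T_bound (w : IsWKB η a b v v1) {u u1 f : ℝ → ℂ} (s : Sol a b u u1 f) {N : ℝ}
    (hN : ∫ x in Set.Iic 0, ‖v x‖ ^ 2 ≤ N)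
    (hXq : 3/2 * Real.sqrt b * ((1 + η) / Real.sqrt a) ≤ N) :
    ‖2 * v 0 * v1 0‖ ^ 2 * (‖u1 (-(3/2 * Real.sqrt b))‖ * ‖u (-(3/2 * Real.sqrt b))‖) ≤
      9 * N * (2 * (Real.exp (SS a b) * Real.exp (-(lam a b * b / 8))) + 1) * ∫ x, ‖f x‖ ^ 2 := by
  have hsb := w.sb
  have hsa := w.sa
  have he := w.eta_pos
  have he1 := w.eta_le
  set X := 3/2 * Real.sqrt b with hX
  set q := (1 + η) / Real.sqrt a with hq
  set W := 2 * v 0 * v1 0 with hW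
  set F := ∫ x, ‖f x‖ ^ 2 with hF
  have hX0 : 0 < X := by positivity
  have hq0 : 0 < q := by positivity
  have hF0 : 0 ≤ F := integral_nonneg fun x => by positivity
  have hN0 : 0 ≤ N := (setIntegral_nonneg measurableSet_Iic fun x _ => by positivity).trans hN
  have sr := s.reflect
  have hsq := Real.sq_sqrt w.b_pos.le
  obtain ⟨hc, hc1⟩ := w.cramer s (x := -X) (by rw [← hX]) (by rw [← hX]; linarith)
  rw [neg_neg] at hc hc1
  have hB := w.fv_int sr.fc sr.f_int (E := Set.Iic X) measurableSet_Iic subset_rfl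
  have hA := w.fv_int s.fc s.f_int (E := Set.Iic (-X)) measurableSet_Iic
      (Set.Iic_subset_Iic.mpr (by rw [← hX]; linarith))
  have eF : ∫ t, ‖f (-t)‖ ^ 2 = F := by
    rw [hF]
    exact integral_neg_eq_self (fun t => ‖f t‖ ^ 2) volume
  have bB : ‖∫ t in Set.Iic X, f (-t) * v t‖ ^ 2 ≤ F * (2 * N) := by
    refine hB.2.trans ?_
    have i1 : ∫ t in Set.Iic X, ‖v t‖ ^ 2 ≤ 2 * N := by
      rw [← Set.Iic_union_Ioc_eq_Iic hX0.le,
        setIntegral_union (Set.Iic_disjoint_Ioc le_rfl) measurableSet_Ioc w.int_left w.int_right.1]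
      have := w.int_right.2
      rw [← hX, ← hq] at this
      linarith
    have i2 : ∫ t in Set.Iic X, ‖f (-t)‖ ^ 2 ≤ F := by
      rw [← eF]
      exact setIntegral_le_integral sr.f_int (ae_of_all _ fun t => by positivity)
    exact mul_le_mul i2 i1 (setIntegral_nonneg measurableSet_Iic fun x _ => by positivity) hF0
  have bA : ‖∫ t in Set.Iic (-X), f t * v t‖ ^ 2 ≤ F * N := by
    refine hA.2.trans ?_
    have i1 : ∫ t in Set.Iic (-X), ‖v t‖ ^ 2 ≤ N :=
      (setIntegral_mono_set w.int_left (ae_of_all _ fun t => by simp)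
          (Set.Iic_subset_Iic.mpr (by linarith)).eventuallyLE).trans hN
    have i2 : ∫ t in Set.Iic (-X), ‖f t‖ ^ 2 ≤ F :=
      setIntegral_le_integral s.f_int (ae_of_all _ fun t => by positivity)
    exact mul_le_mul i2 i1 (setIntegral_nonneg measurableSet_Iic fun x _ => by positivity) hF0
  have hb2 : 5 * b ^ 2 ≤ 1 * a ^ 2 := by
    have := w.hba; have := w.b_pos; nlinarith
  have pX : ‖pp a b X‖ ≤ 2 * Real.sqrt a := by
    have := pp_norm_le w.a_pos w.b_pos.le (x := X) (κ := 1) (by norm_num) hb2 (by rw [hX]; nlinarith)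
    linarith
  have pX' : ‖pp a b (-X)‖ ≤ 2 * Real.sqrt a := by rw [pp_neg]; exact pX
  have v1X := w.v1_le (x := X) (w.dom le_rfl)
  have v1X' := w.v1_le (x := -X) (w.dom (by rw [← hX]; linarith))
  have l1 : ‖v1 X‖ ≤ 3 * Real.sqrt a * ‖v X‖ := by
    refine v1X.trans (mul_le_mul_of_nonneg_right ?_ (norm_nonneg _))
    nlinarith [norm_nonneg (pp a b X)]
  have l1' : ‖v1 (-X)‖ ≤ 3 * Real.sqrt a * ‖v (-X)‖ := by
    refine v1X'.trans (mul_le_mul_of_nonneg_right ?_ (norm_nonneg _))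
    nlinarith [norm_nonneg (pp a b (-X))]
  have q1 : ‖v X‖ ^ 2 ≤ q := w.sq_le_right hX0.le le_rfl
  have q2 : ‖v (-X)‖ ^ 2 ≤ q * (Real.exp (SS a b) * Real.exp (-(lam a b * b / 8))) := by
    refine (w.sq_le_left' (x := -X) (by linarith)).trans (le_of_eq ?_)
    rw [mul_assoc, ← hq]
    have : (-X + Real.sqrt b) ^ 2 = b / 4 := by rw [hX]; linear_combination 1 / 4 * hsq
    rw [this]
    congr 3
    ring
  set Q := Real.exp (SS a b) * Real.exp (-(lam a b * b / 8)) with hQ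
  have hQ0 : 0 < Q := by positivity
  generalize (∫ t in Set.Iic X, f (-t) * v t) = B at *
  generalize (∫ t in Set.Iic (-X), f t * v t) = A at *
  have t1 : ‖W‖ * ‖u (-X)‖ ≤ ‖v (-X)‖ * ‖B‖ + ‖v X‖ * ‖A‖ := by
    rw [← norm_mul, hc]
    refine (norm_add_le _ _).trans (le_of_eq ?_)
    simp
  have t2 : ‖W‖ * ‖u1 (-X)‖ ≤ 3 * Real.sqrt a * (‖v (-X)‖ * ‖B‖ + ‖v X‖ * ‖A‖) := by
    rw [← norm_mul, hc1]
    refine (norm_sub_le _ _).trans ?_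
    rw [norm_mul, norm_mul]
    calc _ ≤ (3 * Real.sqrt a * ‖v (-X)‖) * ‖B‖ + (3 * Real.sqrt a * ‖v X‖) * ‖A‖ := by gcongr
      _ = _ := by ring
  have t3 : (‖v (-X)‖ * ‖B‖ + ‖v X‖ * ‖A‖) ^ 2 ≤ 2 * (q * Q * (F * (2 * N))) + 2 * (q * (F * N)) := by
    have h1 : ‖v (-X)‖ ^ 2 * ‖B‖ ^ 2 ≤ q * Q * (F * (2 * N)) :=
      mul_le_mul q2 bB (by positivity) (by positivity)
    have h2 : ‖v X‖ ^ 2 * ‖A‖ ^ 2 ≤ q * (F * N) :=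
      mul_le_mul q1 bA (by positivity) (by positivity)
    have h3 := sq_nonneg (‖v (-X)‖ * ‖B‖ - ‖v X‖ * ‖A‖)
    have h4 : (‖v (-X)‖ * ‖B‖ + ‖v X‖ * ‖A‖) ^ 2 + (‖v (-X)‖ * ‖B‖ - ‖v X‖ * ‖A‖) ^ 2 =
      2 * (‖v (-X)‖ ^ 2 * ‖B‖ ^ 2) + 2 * (‖v X‖ ^ 2 * ‖A‖ ^ 2) := by ring
    linarith
  have hqa : Real.sqrt a * q ≤ 3/2 := by
    rw [hq, mul_div_cancel₀ _ hsa.ne']; linarith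
  calc ‖W‖ ^ 2 * (‖u1 (-X)‖ * ‖u (-X)‖) = (‖W‖ * ‖u1 (-X)‖) * (‖W‖ * ‖u (-X)‖) := by ring
    _ ≤ (3 * Real.sqrt a * (‖v (-X)‖ * ‖B‖ + ‖v X‖ * ‖A‖)) * (‖v (-X)‖ * ‖B‖ + ‖v X‖ * ‖A‖) := by
        gcongr
    _ = 3 * Real.sqrt a * (‖v (-X)‖ * ‖B‖ + ‖v X‖ * ‖A‖) ^ 2 := by ring
    _ ≤ 3 * Real.sqrt a * (2 * (q * Q * (F * (2 * N))) + 2 * (q * (F * N))) := by gcongr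
    _ = (Real.sqrt a * q) * (6 * (F * N * (2 * Q + 1))) := by ring
    _ ≤ 3/2 * (6 * (F * N * (2 * Q + 1))) := by gcongr
    _ = _ := by ring

lemma half_bound (w : IsWKB η a b v v1) {u u1 f : ℝ → ℂ} (s : Sol a b u u1 f) {N κ : ℝ} (hκ : 0 < κ)
    (hN : ∫ x in Set.Iic 0, ‖v x‖ ^ 2 ≤ N)
    (hXq : 3/2 * Real.sqrt b * ((1 + η) / Real.sqrt a) ≤ N) :
    ∫ x in Set.Iic 0, ‖u x‖ ^ 2 ≤
      ((1 + κ) * N ^ 2 * (∫ x in Set.Ioi 0, ‖f x‖ ^ 2) +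
      (1 + 1 / κ) * (4 * N * (3/2 * Real.sqrt b * ((1 + η) / Real.sqrt a))) *
        ∫ x in Set.Iic 0, ‖f x‖ ^ 2) / ‖2 * v 0 * v1 0‖ ^ 2 +
      9 * N * (2 * (Real.exp (SS a b) * Real.exp (-(lam a b * b / 8))) + 1) / b *
        (∫ x, ‖f x‖ ^ 2) / ‖2 * v 0 * v1 0‖ ^ 2 + (∫ x in Set.Iic 0, ‖f x‖ ^ 2) / b ^ 2 := by
  have hX0 : 0 < 3/2 * Real.sqrt b := by have := w.sb; positivity
  have hb := w.b_pos
  have h1 := w.inner_bound s hκ hN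
  have h2 := s.outer a b hb
  have h3 := w.T_bound s hN hXq
  have hW : 0 < ‖2 * v 0 * v1 0‖ := by
    have := w.wr_lower
    have := w.eta_le
    have : 0 < 2 * (1 - η) ^ 2 := by have : 0 < 1 - η := by linarith
                                     positivity
    linarith
  have h4 : ∫ x in Set.Iic (-(3/2 * Real.sqrt b)), ‖f x‖ ^ 2 ≤ ∫ x in Set.Iic 0, ‖f x‖ ^ 2 :=
    setIntegral_mono_set s.f_int.integrableOn (ae_of_all _ fun t => by simp)
          (Set.Iic_subset_Iic.mpr (by linarith)).eventuallyLE
  rw [← Set.Iic_union_Ioc_eq_Iic (show -(3/2 * Real.sqrt b) ≤ 0 by linarith),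
    setIntegral_union (Set.Iic_disjoint_Ioc le_rfl) measurableSet_Ioc s.u_int.integrableOn
      s.u_int.integrableOn, Set.Iic_union_Ioc_eq_Iic (show -(3/2 * Real.sqrt b) ≤ 0 by linarith)]
  generalize ‖2 * v 0 * v1 0‖ = W at *
  generalize (∫ x in Set.Iic (-(3/2 * Real.sqrt b)), ‖u x‖ ^ 2) = U1 at *
  generalize (∫ x in Set.Ioc (-(3/2 * Real.sqrt b)) 0, ‖u x‖ ^ 2) = U2 at *
  generalize (∫ x in Set.Iic (-(3/2 * Real.sqrt b)), ‖f x‖ ^ 2) = F1 at *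
  generalize (∫ x in Set.Iic 0, ‖f x‖ ^ 2) = F2 at *
  rw [mul_comm, ← le_div_iff₀ (by positivity)] at h1
  rw [mul_comm, ← le_div_iff₀ (by positivity)] at h3
  rw [mul_comm, ← le_div_iff₀ hb] at h2
  have h5 : (‖u1 (-(3/2 * Real.sqrt b))‖ * ‖u (-(3/2 * Real.sqrt b))‖ + F1 / b) / b ≤
     (9 * N * (2 * (Real.exp (SS a b) * Real.exp (-(lam a b * b / 8))) + 1) * (∫ x, ‖f x‖ ^ 2) / W ^ 2
        + F2 / b) / b := by gcongr
  have h6 : (9 * N * (2 * (Real.exp (SS a b) * Real.exp (-(lam a b * b / 8))) + 1) * (∫ x, ‖f x‖ ^ 2) / W ^ 2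
        + F2 / b) / b = 9 * N * (2 * (Real.exp (SS a b) * Real.exp (-(lam a b * b / 8))) + 1) / b *
        (∫ x, ‖f x‖ ^ 2) / W ^ 2 + F2 / b ^ 2 := by
    generalize (∫ x, ‖f x‖ ^ 2) = F
    field_simp
  linarith

lemma full_bound (w : IsWKB η a b v v1) {u u1 f : ℝ → ℂ} (s : Sol a b u u1 f) {N κ : ℝ} (hκ : 0 < κ)
    (hN : ∫ x in Set.Iic 0, ‖v x‖ ^ 2 ≤ N)
    (hXq : 3/2 * Real.sqrt b * ((1 + η) / Real.sqrt a) ≤ N) :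
    ∫ x, ‖u x‖ ^ 2 ≤ (((1 + κ) * N ^ 2 +
      (1 + 1 / κ) * (4 * N * (3/2 * Real.sqrt b * ((1 + η) / Real.sqrt a))) +
      18 * N * (2 * (Real.exp (SS a b) * Real.exp (-(lam a b * b / 8))) + 1) / b)
        / (4 * (1 - η) ^ 4) + 1 / b ^ 2) * ∫ x, ‖f x‖ ^ 2 := by
  have h1 := w.half_bound s hκ hN hXq
  have h2 := w.half_bound s.reflect hκ hN hXq
  have e1 : ∫ x in Set.Iic 0, ‖u (-x)‖ ^ 2 = ∫ x in Set.Ioi 0, ‖u x‖ ^ 2 := by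
    have := integral_comp_neg_Iic 0 (fun t => ‖u t‖ ^ 2)
    simpa using this
  have e2 : ∫ t in Set.Iic 0, ‖f (-t)‖ ^ 2 = ∫ x in Set.Ioi 0, ‖f x‖ ^ 2 := by
    have := integral_comp_neg_Iic 0 (fun t => ‖f t‖ ^ 2)
    simpa using this
  have e3 : ∫ t in Set.Ioi 0, ‖f (-t)‖ ^ 2 = ∫ x in Set.Iic 0, ‖f x‖ ^ 2 := by
    have := integral_comp_neg_Ioi 0 (fun t => ‖f t‖ ^ 2)
    simpa using this
  have e4 : ∫ t, ‖f (-t)‖ ^ 2 = ∫ x, ‖f x‖ ^ 2 :=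
    integral_neg_eq_self (fun t => ‖f t‖ ^ 2) volume
  have e5 : (∫ x in Set.Iic 0, ‖u x‖ ^ 2) + ∫ x in Set.Ioi 0, ‖u x‖ ^ 2 = ∫ x, ‖u x‖ ^ 2 :=
    intervalIntegral.integral_Iic_add_Ioi s.u_int.integrableOn s.u_int.integrableOn
  have e6 : (∫ x in Set.Iic 0, ‖f x‖ ^ 2) + ∫ x in Set.Ioi 0, ‖f x‖ ^ 2 = ∫ x, ‖f x‖ ^ 2 :=
    intervalIntegral.integral_Iic_add_Ioi s.f_int.integrableOn s.f_int.integrableOn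
  rw [e1, e2, e3, e4] at h2
  have hF0 : 0 ≤ ∫ x, ‖f x‖ ^ 2 := integral_nonneg fun x => by positivity
  have hWl := w.wr_lower
  have he := w.eta_le
  have he0 := w.eta_pos
  have hb := w.b_pos
  have hsb := w.sb
  have hsa := w.sa
  have hη : 0 < 1 - η := by linarith
  have hW4 : 4 * (1 - η) ^ 4 ≤ ‖2 * v 0 * v1 0‖ ^ 2 := by
    have := pow_le_pow_left₀ (by positivity) hWl 2
    calc _ = (2 * (1 - η) ^ 2) ^ 2 := by ring
      _ ≤ _ := this
  have hN0 : 0 ≤ N := le_trans (by positivity) hXq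
  set D1 := (1 + κ) * N ^ 2
  set D2 := (1 + 1 / κ) * (4 * N * (3/2 * Real.sqrt b * ((1 + η) / Real.sqrt a))) with hD2
  set D3 := 9 * N * (2 * (Real.exp (SS a b) * Real.exp (-(lam a b * b / 8))) + 1) / b with hD3
  have hD20 : 0 ≤ D2 := by positivity
  have hD30 : 0 ≤ D3 := by positivity
  have e7 : 18 * N * (2 * (Real.exp (SS a b) * Real.exp (-(lam a b * b / 8))) + 1) / b = 2 * D3 := by
    rw [hD3]; ring
  rw [e7]
  generalize ‖2 * v 0 * v1 0‖ ^ 2 = W at *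
  set F := ∫ x, ‖f x‖ ^ 2
  have h8 : ∫ x, ‖u x‖ ^ 2 ≤ ((D1 + D2 + 2 * D3) / W + 1 / b ^ 2) * F := by
    rw [← e5]
    refine (add_le_add h1 h2).trans (le_of_eq ?_)
    rw [← e6]; ring
  refine h8.trans ?_
  gcongr

end IsWKB

namespace IsWKB
variable {η a b : ℝ} {v v1 : ℝ → ℂ}

lemma small_errs (w : IsWKB η a b v v1) (hΛ : 1 ≤ lam a b * b) :
    3/2 * Real.sqrt b * ((1 + η) / Real.sqrt a) ≤ 4 * Real.exp (-(lam a b * b / 8)) * KK a b ∧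
    Real.exp (SS a b) * Real.exp (-(lam a b * b / 8)) / b ≤ Real.exp (-(lam a b * b / 8)) * KK a b ∧
    1 / b ≤ Real.exp (-(lam a b * b / 8)) * KK a b := by
  have hsa := w.sa
  have hsb := w.sb
  have ha := w.a_pos
  have hb := w.b_pos
  have hl := w.lam_pos
  have he := w.eta_le
  have he0 := w.eta_pos
  have hS := SS_lower w.a_pos w.b_pos w.hba
  have hqa := Real.sq_sqrt ha.le
  have hqb := Real.sq_sqrt hb.le
  have hpi := Real.pi_gt_three
  have hlam : lam a b * Real.sqrt a = Real.sqrt b := by rw [lam]; field_simp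
  set E := Real.exp (SS a b) with hE
  set d := Real.exp (-(lam a b * b / 8)) with hd
  set L := lam a b * b with hL
  set r := Real.sqrt (Real.pi / lam a b) with hr
  have hr0 : 0 < r := Real.sqrt_pos.mpr (by positivity)
  have hr2 : r ^ 2 * L = Real.pi * b := by
    rw [hr, Real.sq_sqrt (by positivity), hL]; field_simp
  have hd0 : 0 < d := Real.exp_pos _
  have hE0 : 0 < E := Real.exp_pos _
  have hdE : 1 + 3 / 8 * L ≤ d * E := by
    rw [hd, hE, ← Real.exp_add]
    have h1 := Real.add_one_le_exp (3 / 8 * L)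
    have h2 : Real.exp (3 / 8 * L) ≤ Real.exp (-(L / 8) + SS a b) := by
      apply Real.exp_le_exp.mpr
      have : Real.sqrt b / Real.sqrt a * b / 2 = L / 2 := by rw [hL, lam]
      linarith
    linarith
  have hKK : KK a b = E * r / Real.sqrt a := by rw [KK]; ring
  rw [hKK]
  have hL2 : L ^ 2 * a = b ^ 3 := by
    have : (lam a b * Real.sqrt a) ^ 2 = b := by rw [hlam, hqb]
    rw [mul_pow, hqa] at this
    rw [hL]; linear_combination b ^ 2 * this
  have hrb : Real.sqrt a ≤ r * b := by
    apply le_of_sq_le_sq _ (by positivity)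
    rw [hqa, mul_pow]
    have h1 : (r ^ 2 * b ^ 2) * L = Real.pi * b ^ 3 := by linear_combination b ^ 2 * hr2
    have h2 : a * L ≤ (r ^ 2 * b ^ 2) * L := by
      rw [h1, ← hL2]
      have h3 : 0 < L * a := by positivity
      have h4 : L * a ≤ L * (L * a) := le_mul_of_one_le_left h3.le hΛ
      have h5 : L * (L * a) ≤ Real.pi * (L * (L * a)) :=
        le_mul_of_one_le_left (by positivity) (by linarith)
      calc a * L = L * a := by ring
        _ ≤ Real.pi * (L * (L * a)) := h4.trans h5
        _ = _ := by ring
    exact le_of_mul_le_mul_right h2 (by linarith)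
  have hdE1 : 1 ≤ d * E := by linarith
  refine ⟨?_, ?_, ?_⟩
  · rw [mul_div_assoc', mul_div_assoc']
    apply div_le_div_of_nonneg_right _ hsa.le
    have h1 : Real.sqrt b * (3/2) ≤ 2 * (d * E) * r := by
      apply le_of_sq_le_sq _ (by positivity)
      rw [mul_pow, hqb, mul_pow, mul_pow]
      have h2 : L ≤ (d * E) ^ 2 := by nlinarith
      have h3 : b * Real.pi ≤ (d * E) ^ 2 * r ^ 2 := by
        calc b * Real.pi = L * r ^ 2 := by linear_combination -hr2
          _ ≤ _ := by gcongr
      nlinarith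
    have h2 : 0 < Real.sqrt b * (3/2) := by positivity
    nlinarith
  · have : E * d / b = d * (E / b) := by ring
    rw [this]
    apply mul_le_mul_of_nonneg_left _ hd0.le
    rw [div_le_div_iff₀ hb hsa]
    nlinarith
  · rw [mul_div_assoc', div_le_div_iff₀ hb hsa, one_mul]
    calc Real.sqrt a ≤ 1 * (r * b) := by linarith
      _ ≤ (d * E) * (r * b) := by gcongr
      _ = _ := by ring

/-- The relative error factor in the resolvent upper bound. -/
noncomputable def _root_.HH (η L : ℝ) : ℝ :=
  ((1 + η) * ((1 + η) * (Real.sqrt (1 / (1 - 2 * η)) + 2 * Real.exp (-(η ^ 2 * L / 4)))) ^ 2 +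
    (1 + 1 / η) * (4 * ((1 + η) * (Real.sqrt (1 / (1 - 2 * η)) + 2 * Real.exp (-(η ^ 2 * L / 4)))) *
      (4 * Real.exp (-(L / 8)))) +
    18 * ((1 + η) * (Real.sqrt (1 / (1 - 2 * η)) + 2 * Real.exp (-(η ^ 2 * L / 4)))) *
      (3 * Real.exp (-(L / 8)))) / (4 * (1 - η) ^ 4) + Real.exp (-(L / 8)) ^ 2

lemma resolvent_bound (w : IsWKB η a b v v1) {u u1 f : ℝ → ℂ} (s : Sol a b u u1 f)
    (hη : η ≤ 1/4) (hbη : 5 * b ^ 2 ≤ η * a ^ 2) (hΛ : 16 ≤ lam a b * b) :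
    ∫ x, ‖u x‖ ^ 2 ≤ HH η (lam a b * b) * KK a b ^ 2 * ∫ x, ‖f x‖ ^ 2 := by
  obtain ⟨e1, e2, e3⟩ := w.small_errs (by linarith)
  have hN := (w.N_bound w.eta_pos hη hbη).2
  have hK := w.KK_pos
  have he := w.eta_pos
  have hb := w.b_pos
  set n := (1 + η) * (Real.sqrt (1 / (1 - 2 * η)) + 2 * Real.exp (-(η ^ 2 * (lam a b * b) / 4))) with hn
  set d := Real.exp (-(lam a b * b / 8)) with hd
  have hd0 : 0 < d := Real.exp_pos _
  have hd4 : 4 * d ≤ 1 := by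
    have h1 : d * Real.exp (lam a b * b / 8) = 1 := by
      rw [hd, ← Real.exp_add]; simp
    have h2 : (4:ℝ) ≤ Real.exp (lam a b * b / 8) := by
      have h3 : Real.exp 2 ≤ Real.exp (lam a b * b / 8) := Real.exp_le_exp.mpr (by linarith)
      have h4 : Real.exp 2 = Real.exp 1 * Real.exp 1 := by rw [← Real.exp_add]; norm_num
      have := Real.exp_one_gt_d9
      nlinarith
    nlinarith
  have hn1 : 1 ≤ n := by
    have h1 : 1 ≤ Real.sqrt (1 / (1 - 2 * η)) := by
      rw [Real.one_le_sqrt, le_div_iff₀ (by linarith)]; linarith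
    have h2 := Real.exp_pos (-(η ^ 2 * (lam a b * b) / 4))
    rw [hn]; nlinarith
  have hXq : 3/2 * Real.sqrt b * ((1 + η) / Real.sqrt a) ≤ KK a b * n := by
    refine e1.trans ?_
    nlinarith
  have h := w.full_bound s he hN hXq
  have hF0 : 0 ≤ ∫ x, ‖f x‖ ^ 2 := integral_nonneg fun x => by positivity
  refine h.trans (mul_le_mul_of_nonneg_right ?_ hF0)
  have hη : 0 < 1 - η := by linarith
  have hW : 0 < 4 * (1 - η) ^ 4 := by positivity
  have e4 : 1 / b ^ 2 ≤ d ^ 2 * KK a b ^ 2 := by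
    calc 1 / b ^ 2 = (1 / b) ^ 2 := by rw [div_pow, one_pow]
      _ ≤ (d * KK a b) ^ 2 := by gcongr
      _ = _ := by ring
  have e5 : 18 * (KK a b * n) * (2 * (Real.exp (SS a b) * d) + 1) / b ≤
      18 * n * (3 * d) * KK a b ^ 2 := by
    calc _ = 18 * (KK a b * n) * (2 * (Real.exp (SS a b) * d / b) + 1 / b) := by ring
      _ ≤ 18 * (KK a b * n) * (2 * (d * KK a b) + d * KK a b) := by gcongr
      _ = _ := by ring
  have e6 : (1 + 1 / η) * (4 * (KK a b * n) * (3/2 * Real.sqrt b * ((1 + η) / Real.sqrt a))) ≤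
      (1 + 1 / η) * (4 * n * (4 * d)) * KK a b ^ 2 := by
    calc _ ≤ (1 + 1 / η) * (4 * (KK a b * n) * (4 * d * KK a b)) := by gcongr
      _ = _ := by ring
  calc _ ≤ ((1 + η) * (KK a b * n) ^ 2 + (1 + 1 / η) * (4 * n * (4 * d)) * KK a b ^ 2 +
        18 * n * (3 * d) * KK a b ^ 2) / (4 * (1 - η) ^ 4) + d ^ 2 * KK a b ^ 2 := by gcongr
    _ = HH η (lam a b * b) * KK a b ^ 2 := by
      rw [HH, ← hn, ← hd]; ring

end IsWKB

lemma HH_lim (ε : ℝ) (hε : 0 < ε) : ∃ η : ℝ, 0 < η ∧ η ≤ 1/4 ∧ ∃ L0 : ℝ, ∀ L ≥ L0,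
    HH η L ≤ (1 + ε) / 4 := by
  have h1 : Filter.Tendsto (fun η : ℝ => ((1 + η) * ((1 + η) * (Real.sqrt (1 / (1 - 2 * η)))) ^ 2)
      / (4 * (1 - η) ^ 4)) (nhdsWithin 0 (Set.Ioi 0)) (nhds (1 / 4)) := by
    have : ContinuousAt (fun η : ℝ => ((1 + η) * ((1 + η) * (Real.sqrt (1 / (1 - 2 * η)))) ^ 2)
      / (4 * (1 - η) ^ 4)) 0 := by
      fun_prop (disch := norm_num)
    have h2 := this.tendsto.mono_left (nhdsWithin_le_nhds (s := Set.Ioi (0:ℝ)))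
    have e : ((1 + (0:ℝ)) * ((1 + 0) * (Real.sqrt (1 / (1 - 2 * 0)))) ^ 2) / (4 * (1 - 0) ^ 4) = 1 / 4 := by
      norm_num
    rw [e] at h2
    exact h2
  have h3 := h1.eventually_lt_const (show (1:ℝ) / 4 < (1 + ε) / 4 by linarith)
  have h4 : ∀ᶠ η : ℝ in nhdsWithin 0 (Set.Ioi 0), η ≤ 1/4 ∧ 0 < η := by
    filter_upwards [Ioo_mem_nhdsGT (show (0:ℝ) < 1/4 by norm_num)] with x hx
    exact ⟨hx.2.le, hx.1⟩
  obtain ⟨η, hη1, hη2, hη3⟩ := (h3.and h4).exists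
  refine ⟨η, hη3, hη2, ?_⟩
  have ex : ∀ c : ℝ, 0 < c → Filter.Tendsto (fun L : ℝ => Real.exp (-(c * L))) Filter.atTop (nhds 0) := by
    intro c hc
    exact Real.tendsto_exp_neg_atTop_nhds_zero.comp (Filter.tendsto_id.const_mul_atTop hc)
  have ea : Filter.Tendsto (fun L : ℝ => Real.exp (-(L / 8))) Filter.atTop (nhds 0) := by
    refine (ex (1/8) (by norm_num)).congr fun L => ?_
    congr 1; ring
  have eb : Filter.Tendsto (fun L : ℝ => Real.exp (-(η ^ 2 * L / 4))) Filter.atTop (nhds 0) := by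
    refine (ex (η ^ 2 / 4) (by positivity)).congr fun L => ?_
    congr 1; ring
  have en : Filter.Tendsto (fun L : ℝ => (1 + η) * (Real.sqrt (1 / (1 - 2 * η)) +
      2 * Real.exp (-(η ^ 2 * L / 4)))) Filter.atTop (nhds ((1 + η) * (Real.sqrt (1 / (1 - 2 * η)) +
      2 * 0))) := ((eb.const_mul 2).const_add _).const_mul _
  have hlim : Filter.Tendsto (fun L => HH η L) Filter.atTop (nhds
    (((1 + η) * ((1 + η) * (Real.sqrt (1 / (1 - 2 * η)) + 2 * 0)) ^ 2 +
    (1 + 1 / η) * (4 * ((1 + η) * (Real.sqrt (1 / (1 - 2 * η)) + 2 * 0)) *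
      (4 * 0)) +
    18 * ((1 + η) * (Real.sqrt (1 / (1 - 2 * η)) + 2 * 0)) *
      (3 * 0)) / (4 * (1 - η) ^ 4) + 0 ^ 2)) := by
    unfold HH
    exact ((((en.pow 2).const_mul _).add (((en.const_mul 4).mul (ea.const_mul 4)).const_mul _)).add
      ((en.const_mul 18).mul (ea.const_mul 3))).div_const _ |>.add (ea.pow 2)
  have h5 := hlim.eventually_lt_const (u := (1 + ε) / 4) (by
    simpa using hη1)
  obtain ⟨L0, hL0⟩ := Filter.eventually_atTop.mp h5
  exact ⟨L0, fun L hL => (hL0 L hL).le⟩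

/-- The left cutoff: values and derivatives. -/
lemma cut_left : ∃ T T1 T2 : ℝ → ℝ, ∃ M : ℝ, 0 < M ∧ ContDiff ℝ (⊤ : ℕ∞) T ∧
    (∀ x, HasDerivAt T (T1 x) x) ∧ (∀ x, HasDerivAt T1 (T2 x) x) ∧
    (∀ x, |T1 x| ≤ M) ∧ (∀ x, |T2 x| ≤ M) ∧ (∀ x ≤ 0, T x = 0) ∧ (∀ x, 1 ≤ x → T x = 1) ∧
    (∀ x < 0, T1 x = 0 ∧ T2 x = 0) ∧ (∀ x, 1 < x → T1 x = 0 ∧ T2 x = 0) := by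
  set T := Real.smoothTransition with hT
  have h0 : ContDiff ℝ (⊤ : ℕ∞) T := Real.smoothTransition.contDiff
  have h1 : ContDiff ℝ (⊤ : ℕ∞) (deriv T) := (contDiff_infty_iff_deriv.mp h0).2
  have h2 : ContDiff ℝ (⊤ : ℕ∞) (deriv (deriv T)) := (contDiff_infty_iff_deriv.mp h1).2
  have d0 : ∀ x, HasDerivAt T (deriv T x) x := fun x =>
    ((contDiff_infty_iff_deriv.mp h0).1 x).hasDerivAt
  have d1 : ∀ x, HasDerivAt (deriv T) (deriv (deriv T) x) x := fun x =>
    ((contDiff_infty_iff_deriv.mp h1).1 x).hasDerivAt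
  have z0 : ∀ x < 0, deriv T x = 0 := fun x hx => by
    have : T =ᶠ[nhds x] fun _ => 0 := by
      filter_upwards [Iio_mem_nhds hx] with t ht
      exact Real.smoothTransition.zero_of_nonpos (le_of_lt ht)
    rw [this.deriv_eq]; simp
  have z1 : ∀ x, 1 < x → deriv T x = 0 := fun x hx => by
    have : T =ᶠ[nhds x] fun _ => 1 := by
      filter_upwards [Ioi_mem_nhds hx] with t ht
      exact Real.smoothTransition.one_of_one_le (le_of_lt ht)
    rw [this.deriv_eq]; simp
  have y0 : ∀ x < 0, deriv (deriv T) x = 0 := fun x hx => by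
    have : deriv T =ᶠ[nhds x] fun _ => 0 := by
      filter_upwards [Iio_mem_nhds hx] with t ht
      exact z0 t ht
    rw [this.deriv_eq]; simp
  have y1 : ∀ x, 1 < x → deriv (deriv T) x = 0 := fun x hx => by
    have : deriv T =ᶠ[nhds x] fun _ => 0 := by
      filter_upwards [Ioi_mem_nhds hx] with t ht
      exact z1 t ht
    rw [this.deriv_eq]; simp
  have bdd : ∀ g : ℝ → ℝ, Continuous g → (∀ x < 0, g x = 0) → (∀ x, 1 < x → g x = 0) →
      ∃ M, ∀ x, ‖g x‖ ≤ M := by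
    intro g hg g0 g1
    refine hg.bounded_above_of_compact_support
      (HasCompactSupport.of_support_subset_isCompact (isCompact_Icc (a := (0:ℝ)) (b := 1)) ?_)
    intro x hx
    by_contra hc
    apply hx
    rcases lt_or_ge x 0 with h | h
    · exact g0 x h
    · exact g1 x (by by_contra h'; exact hc ⟨h, not_lt.mp h'⟩)
  obtain ⟨M1, hM1⟩ := bdd _ h1.continuous z0 z1
  obtain ⟨M2, hM2⟩ := bdd _ h2.continuous y0 y1
  refine ⟨T, deriv T, deriv (deriv T), |M1| + |M2| + 1, by positivity, h0, d0, d1, ?_, ?_, ?_, ?_, ?_, ?_⟩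
  · intro x
    have := hM1 x
    rw [Real.norm_eq_abs] at this
    linarith [le_abs_self M1, abs_nonneg M2]
  · intro x
    have := hM2 x
    rw [Real.norm_eq_abs] at this
    linarith [le_abs_self M2, abs_nonneg M1]
  · exact fun x hx => Real.smoothTransition.zero_of_nonpos hx
  · exact fun x hx => Real.smoothTransition.one_of_one_le hx
  · exact fun x hx => ⟨z0 x hx, y0 x hx⟩
  · exact fun x hx => ⟨z1 x hx, y1 x hx⟩

/-- A fixed bump function. -/
lemma bump_ex : ∃ χ χ1 : ℝ → ℝ, ∃ M : ℝ, 0 < M ∧ ContDiff ℝ (⊤ : ℕ∞) χ ∧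
    (∀ x, HasDerivAt χ (χ1 x) x) ∧ (∀ x, 0 ≤ χ x) ∧ (∀ x, χ x ≤ 1) ∧ (∀ x, |χ1 x| ≤ M) ∧
    (∀ x, |x| ≤ 1/2 → χ x = 1) ∧ (∀ x, 1 ≤ |x| → χ x = 0 ∧ χ1 x = 0) := by
  let B : ContDiffBump (0:ℝ) := ⟨1/2, 1, by norm_num, by norm_num⟩
  have h0 : ContDiff ℝ (⊤ : ℕ∞) B := B.contDiff
  have d0 : ∀ x, HasDerivAt B (deriv B x) x := fun x =>
    ((contDiff_infty_iff_deriv.mp h0).1 x).hasDerivAt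
  have hz : ∀ x, 1 ≤ |x| → B x = 0 := fun x hx =>
    B.zero_of_le_dist (by simpa [B] using hx)
  obtain ⟨M, hM⟩ := (contDiff_infty_iff_deriv.mp h0).2.continuous.bounded_above_of_compact_support
    B.hasCompactSupport.deriv
  refine ⟨B, deriv B, |M| + 1, by positivity, h0, d0, fun x => B.nonneg, fun x => B.le_one, ?_, ?_, ?_⟩
  · intro x
    have := hM x
    rw [Real.norm_eq_abs] at this
    linarith [le_abs_self M]
  · intro x hx
    exact B.one_of_mem_closedBall (by simpa [B] using hx)
  · intro x hx
    refine ⟨hz x hx, ?_⟩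
    apply IsLocalMin.deriv_eq_zero
    filter_upwards with y
    rw [hz x hx]
    exact B.nonneg

lemma gauss_lower {k l r : ℝ} (hl : 0 < l) (hk : l ≤ k) (hr : 0 < r) (c : ℝ) :
    Real.sqrt (Real.pi / k) - Real.sqrt 2 * Real.exp (-(l * r ^ 2 / 2)) * Real.sqrt (Real.pi / l) ≤
      ∫ x in Set.Icc (c - r) (c + r), Real.exp (-k * (x - c) ^ 2) := by
  have hk0 : 0 < k := lt_of_lt_of_le hl hk
  have i1 : Integrable (fun x : ℝ => Real.exp (-k * (x - c) ^ 2)) :=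
    (integrable_exp_neg_mul_sq hk0).comp_sub_right c
  have i2 : Integrable (fun x : ℝ => Real.exp (-(l / 2) * (x - c) ^ 2)) :=
    (integrable_exp_neg_mul_sq (by positivity : 0 < l / 2)).comp_sub_right c
  have e1 : ∫ x : ℝ, Real.exp (-k * (x - c) ^ 2) = Real.sqrt (Real.pi / k) := by
    rw [integral_sub_right_eq_self (fun x : ℝ => Real.exp (-k * x ^ 2)) c, integral_gaussian]
  have e2 : ∫ x : ℝ, Real.exp (-(l / 2) * (x - c) ^ 2) = Real.sqrt 2 * Real.sqrt (Real.pi / l) := by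
    rw [integral_sub_right_eq_self (fun x : ℝ => Real.exp (-(l / 2) * x ^ 2)) c, integral_gaussian,
      ← Real.sqrt_mul (by norm_num)]
    congr 1; field_simp
  have h3 := integral_add_compl (measurableSet_Icc (a := c - r) (b := c + r)) i1
  have h4 : ∫ x in (Set.Icc (c - r) (c + r))ᶜ, Real.exp (-k * (x - c) ^ 2) ≤
      ∫ x in (Set.Icc (c - r) (c + r))ᶜ,
        Real.exp (-(l * r ^ 2 / 2)) * Real.exp (-(l / 2) * (x - c) ^ 2) := by
    refine setIntegral_mono_on i1.integrableOn (i2.const_mul _).integrableOn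
      measurableSet_Icc.compl ?_
    intro x hx
    rw [← Real.exp_add]
    apply Real.exp_le_exp.mpr
    have h5 : r ^ 2 ≤ (x - c) ^ 2 := by
      by_contra hc
      apply hx
      have := abs_lt_of_sq_lt_sq (not_le.mp hc) hr.le
      rw [abs_lt] at this
      constructor <;> linarith
    have h6 := mul_le_mul_of_nonneg_left h5 hl.le
    have h7 := mul_le_mul_of_nonneg_right hk (sq_nonneg (x - c))
    linarith
  have h5 : ∫ x in (Set.Icc (c - r) (c + r))ᶜ,
        Real.exp (-(l * r ^ 2 / 2)) * Real.exp (-(l / 2) * (x - c) ^ 2) ≤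
      Real.exp (-(l * r ^ 2 / 2)) * (Real.sqrt 2 * Real.sqrt (Real.pi / l)) := by
    rw [← e2, ← integral_const_mul]
    exact setIntegral_le_integral (i2.const_mul _) (ae_of_all _ fun x => by positivity)
  rw [e1] at h3
  linarith

/-- The right cutoff. -/
lemma cut_right : ∃ M : ℝ, 0 < M ∧ ∀ c r l : ℝ, 0 < r → 0 < l →
    1 - Real.sqrt 2 * Real.exp (-(l * r ^ 2 / 8)) > 0 →
    ∃ P P1 P2 : ℝ → ℝ, ∃ G : ℝ, 0 < G ∧
    (1 - Real.sqrt 2 * Real.exp (-(l * r ^ 2 / 8))) * Real.sqrt (Real.pi / l) ≤ G ∧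
    ContDiff ℝ (⊤ : ℕ∞) P ∧ (∀ x, HasDerivAt P (P1 x) x) ∧ (∀ x, HasDerivAt P1 (P2 x) x) ∧
    (∀ x ≤ c - r, P x = 0) ∧ (∀ x, c + r ≤ x → P x = 1) ∧
    (∀ x, r ≤ |x - c| → P1 x = 0 ∧ P2 x = 0) ∧
    (∀ x, |P1 x| ≤ Real.exp (-l * (x - c) ^ 2) / G) ∧
    (∀ x, |P2 x| ≤ (2 * l * r + M / r) * Real.exp (-l * (x - c) ^ 2) / G) := by
  obtain ⟨χ, χ1, M, hM, hχ, dχ, χ0, χle, bχ, χone, χz⟩ := bump_ex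
  refine ⟨M, hM, ?_⟩
  intro c r l hr hl hpos
  set g : ℝ → ℝ := fun x => Real.exp (-l * (x - c) ^ 2) * χ ((x - c) / r) with hg
  set g1 : ℝ → ℝ := fun x => (-l * (2 * (x - c))) * Real.exp (-l * (x - c) ^ 2) * χ ((x - c) / r) +
    Real.exp (-l * (x - c) ^ 2) * (χ1 ((x - c) / r) / r) with hg1
  have gs : ContDiff ℝ (⊤ : ℕ∞) g := by
    apply ContDiff.mul (by fun_prop)
    exact hχ.comp (by fun_prop)
  have gc : Continuous g := gs.continuous
  have dg : ∀ x, HasDerivAt g (g1 x) x := by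
    intro x
    have a1 : HasDerivAt (fun x : ℝ => (x - c) / r) (1 / r) x :=
      ((hasDerivAt_id x).sub_const c).div_const r
    have a2 : HasDerivAt (fun x : ℝ => -l * (x - c) ^ 2) (-l * (2 * (x - c))) x := by
      refine ((((hasDerivAt_id x).sub_const c).pow 2).const_mul (-l)).congr_deriv ?_
      simp
    refine ((a2.exp).mul ((dχ ((x - c) / r)).comp x a1)).congr_deriv ?_
    simp only [hg1, Function.comp_apply]
    ring
  have gz : ∀ x, r ≤ |x - c| → g x = 0 ∧ g1 x = 0 := by
    intro x hx
    have := χz ((x - c) / r) (by rw [abs_div, abs_of_pos hr, le_div_iff₀ hr]; linarith)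
    simp [hg, hg1, this.1, this.2]
  have g0 : ∀ x, 0 ≤ g x := fun x => mul_nonneg (Real.exp_pos _).le (χ0 _)
  set G := ∫ x in (c - r)..(c + r), g x with hG
  have hGlow : (1 - Real.sqrt 2 * Real.exp (-(l * r ^ 2 / 8))) * Real.sqrt (Real.pi / l) ≤ G := by
    have h1 := gauss_lower hl le_rfl (half_pos hr) c
    have h2 : ∫ x in Set.Icc (c - r/2) (c + r/2), Real.exp (-l * (x - c) ^ 2) ≤ G := by
      rw [hG, intervalIntegral.integral_of_le (by linarith), ← integral_Icc_eq_integral_Ioc]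
      have h3 : ∫ x in Set.Icc (c - r/2) (c + r/2), Real.exp (-l * (x - c) ^ 2) =
          ∫ x in Set.Icc (c - r/2) (c + r/2), g x := by
        apply setIntegral_congr_fun measurableSet_Icc
        intro x hx
        have : χ ((x - c) / r) = 1 := by
          apply χone
          rw [abs_div, abs_of_pos hr, div_le_iff₀ hr, abs_le]
          constructor <;> linarith [hx.1, hx.2]
        simp [hg, this]
      rw [h3]
      refine setIntegral_mono_set gc.integrableOn_Icc (ae_of_all _ g0)
        (Set.Icc_subset_Icc (by linarith) (by linarith)).eventuallyLE
    have h3 : l * (r / 2) ^ 2 / 2 = l * r ^ 2 / 8 := by ring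
    rw [h3] at h1
    linarith
  have hG0 : 0 < G := by
    refine lt_of_lt_of_le (mul_pos hpos ?_) hGlow
    exact Real.sqrt_pos.mpr (by have := Real.pi_pos; positivity)
  have dP : ∀ x, HasDerivAt (fun x => (∫ t in (c - r)..x, g t) / G) (g x / G) x := by
    intro x
    exact (intervalIntegral.integral_hasDerivAt_right (gc.intervalIntegrable _ _)
      (gc.stronglyMeasurableAtFilter _ _) gc.continuousAt).div_const G
  refine ⟨fun x => (∫ t in (c - r)..x, g t) / G, fun x => g x / G, fun x => g1 x / G, G, hG0, hGlow,
    ?_, dP, fun x => (dg x).div_const G, ?_, ?_, ?_, ?_, ?_⟩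
  · rw [contDiff_infty_iff_deriv]
    refine ⟨fun x => (dP x).differentiableAt, ?_⟩
    have : deriv (fun x => (∫ t in (c - r)..x, g t) / G) = fun x => g x / G := by
      ext x; exact (dP x).deriv
    rw [this]
    exact gs.div_const G
  · intro x hx
    have : ∫ t in (c - r)..x, g t = ∫ t in (c - r)..x, (0:ℝ) := by
      apply intervalIntegral.integral_congr
      intro t ht
      rw [Set.uIcc_of_ge hx] at ht
      exact (gz t (by rw [abs_of_nonpos (by linarith [ht.2])]; linarith [ht.2])).1
    simp [this]
  · intro x hx
    have : ∫ t in (c + r)..x, g t = ∫ t in (c + r)..x, (0:ℝ) := by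
      apply intervalIntegral.integral_congr
      intro t ht
      rw [Set.uIcc_of_le hx] at ht
      exact (gz t (by rw [abs_of_nonneg (by linarith [ht.1])]; linarith [ht.1])).1
    have h2 := intervalIntegral.integral_add_adjacent_intervals
      (gc.intervalIntegrable (μ := volume) (c - r) (c + r)) (gc.intervalIntegrable (c + r) x)
    simp only
    rw [← h2, this, ← hG]
    simp [hG0.ne']
  · intro x hx
    simp [(gz x hx).1, (gz x hx).2]
  · intro x
    simp only
    rw [abs_of_nonneg (div_nonneg (g0 x) hG0.le)]
    apply div_le_div_of_nonneg_right _ hG0.le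
    exact mul_le_of_le_one_right (Real.exp_pos _).le (χle _)
  · intro x
    simp only
    rcases le_or_gt r |x - c| with h | h
    · rw [(gz x h).2]
      simp
      positivity
    rw [abs_div, abs_of_pos hG0]
    apply div_le_div_of_nonneg_right _ hG0.le
    simp only [hg1]
    refine (abs_add_le _ _).trans ?_
    rw [abs_mul, abs_mul, abs_mul, abs_mul, abs_mul, abs_neg, abs_of_pos hl, Real.abs_exp, abs_div,
      abs_of_pos hr, abs_of_nonneg (χ0 _)]
    have h3 := bχ ((x - c) / r)
    have h4 := χle ((x - c) / r)
    have h5 := χ0 ((x - c) / r)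
    have h6 : |(2:ℝ)| = 2 := abs_two
    rw [h6]
    calc _ ≤ l * (2 * r) * Real.exp (-l * (x - c) ^ 2) * 1 +
          Real.exp (-l * (x - c) ^ 2) * (M / r) := by gcongr
      _ = _ := by ring

namespace IsWKB
variable {η a b : ℝ} {v v1 : ℝ → ℂ}

lemma left_tail (w : IsWKB η a b v v1) {M γ : ℝ} (hM : 0 < M) (hγ : 0 < γ) :
    ∃ R : ℝ, 1 ≤ R ∧ 2 * Real.sqrt b ≤ R ∧ ∀ x ≤ -R, (M * (‖v x‖ + 2 * ‖v1 x‖)) ^ 2 ≤ γ := by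
  have hsa := w.sa
  have hsb := w.sb
  have ha := w.a_pos
  have hb := w.b_pos
  have hl := w.lam_pos
  have he := w.eta_pos
  have he1 := w.eta_le
  set D := (1 + η) / Real.sqrt a * Real.exp (SS a b) with hD
  have hD0 : 0 < D := by positivity
  set C0 := M ^ 2 * (D * (128 / lam a b ^ 2)) * (34 + 32 * (a + b)) with hC0
  have hC : 0 < C0 := by positivity
  refine ⟨1 + 2 * Real.sqrt b + C0 / γ, ?_, ?_, ?_⟩
  · have : 0 < C0 / γ := by positivity
    linarith
  · have : 0 < C0 / γ := by positivity
    linarith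
  intro x hx
  have hq : 0 < C0 / γ := by positivity
  have hx1 : x ≤ -1 := by linarith
  have hx2 : x ≤ -(2 * Real.sqrt b) := by linarith
  have hxs : 1 ≤ x ^ 2 := by nlinarith
  have hv := w.sq_le_left' (x := x) (by linarith)
  rw [← hD] at hv
  have hex : Real.exp (-(lam a b * (x + Real.sqrt b) ^ 2 / 2)) ≤ 128 / lam a b ^ 2 / x ^ 4 := by
    set y := lam a b * (x + Real.sqrt b) ^ 2 / 2 with hy
    have h1 : lam a b * x ^ 2 / 8 ≤ y := by
      have : x ^ 2 / 4 ≤ (x + Real.sqrt b) ^ 2 := by nlinarith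
      rw [hy]; nlinarith
    have h0 : 0 < lam a b * x ^ 2 / 8 := by positivity
    have h2 : y ^ 2 / 2 ≤ Real.exp y := by
      have := Real.quadratic_le_exp_of_nonneg (x := y) (by linarith)
      linarith
    have h3 : (lam a b * x ^ 2 / 8) ^ 2 / 2 ≤ Real.exp y := by
      refine le_trans ?_ h2
      gcongr
    rw [Real.exp_neg]
    calc (Real.exp y)⁻¹ ≤ ((lam a b * x ^ 2 / 8) ^ 2 / 2)⁻¹ := by gcongr
      _ = _ := by
        have : x ≠ 0 := by linarith
        field_simp; norm_num
  have hp := pp_norm_growth (a := a) (b := b) (x := x) ha hb.le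
  have hp2 : ‖pp a b x‖ ^ 2 ≤ a + b + x ^ 2 := by
    have := pow_le_pow_left₀ (norm_nonneg _) hp 2
    rwa [Real.sq_sqrt (by positivity)] at this
  have h1 := w.v1_le (w.dom (x := x) (by linarith))
  have h2 : ‖v x‖ + 2 * ‖v1 x‖ ≤ ‖v x‖ * (1 + 4 * ‖pp a b x‖) := by
    have h3 : (1 + η) * ‖pp a b x‖ * ‖v x‖ ≤ 2 * ‖pp a b x‖ * ‖v x‖ := by gcongr; linarith
    linarith
  have h3 : (1 + 4 * ‖pp a b x‖) ^ 2 ≤ (34 + 32 * (a + b)) * x ^ 2 := by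
    have h4 : (1 + 4 * ‖pp a b x‖) ^ 2 ≤ 2 + 32 * ‖pp a b x‖ ^ 2 := by
      nlinarith [sq_nonneg (1 - 4 * ‖pp a b x‖)]
    have h5 : (a + b) * 1 ≤ (a + b) * x ^ 2 := by gcongr
    linarith
  have hx0 : x ≠ 0 := by linarith
  calc (M * (‖v x‖ + 2 * ‖v1 x‖)) ^ 2 ≤ (M * (‖v x‖ * (1 + 4 * ‖pp a b x‖))) ^ 2 := by gcongr
    _ = M ^ 2 * (‖v x‖ ^ 2) * (1 + 4 * ‖pp a b x‖) ^ 2 := by ring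
    _ ≤ M ^ 2 * (D * (128 / lam a b ^ 2 / x ^ 4)) * ((34 + 32 * (a + b)) * x ^ 2) := by
        gcongr
        exact hv.trans (by gcongr)
    _ = C0 / x ^ 2 := by
        rw [hC0]; field_simp
    _ ≤ γ := by
        rw [div_le_iff₀ (by positivity)]
        have h6 : C0 / γ ≤ x ^ 2 := by nlinarith
        rw [div_le_iff₀ hγ] at h6
        linarith

lemma v_lower (w : IsWKB η a b v v1) (hbη : 5 * b ^ 2 ≤ η * a ^ 2) {x : ℝ}
    (hx : |x + Real.sqrt b| ≤ η * Real.sqrt b) :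
    (1 - η) / (Real.sqrt a * (1 + η)) * Real.exp (SS a b) *
      Real.exp (-((1 + η) * lam a b) * (x + Real.sqrt b) ^ 2) ≤ ‖v x‖ ^ 2 := by
  have hsa := w.sa
  have hsb := w.sb
  have he := w.eta_pos
  have he1 := w.eta_le
  have hsq := Real.sq_sqrt w.b_pos.le
  have hx' := abs_le.mp hx
  have hxd : x ≤ 3/2 * Real.sqrt b := by nlinarith [hx'.2]
  have h1 := w.lo x (w.dom hxd)
  have h2 := (GG_near w.a_pos w.b_pos he (by linarith) hbη hx).2
  have hp := pp_norm_le w.a_pos w.b_pos.le (x := x) he.le hbη (by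
    have e1 : -(2 * Real.sqrt b) ≤ x := by nlinarith [hx'.1]
    have e2 : x ≤ 2 * Real.sqrt b := by nlinarith [hx'.2]
    nlinarith)
  have h3 : Real.exp (SS a b) * Real.exp (-((1 + η) * lam a b) * (x + Real.sqrt b) ^ 2) ≤
      Real.exp (-(2 * Phi a b x)) := by
    rw [← Real.exp_add]
    apply Real.exp_le_exp.mpr
    rw [Phi_eq_GG a b x, SS, lam]
    linarith
  have h4 : (1 - η) * (Real.exp (SS a b) * Real.exp (-((1 + η) * lam a b) * (x + Real.sqrt b) ^ 2)) ≤
      (Real.sqrt a * (1 + η)) * ‖v x‖ ^ 2 := by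
    calc _ ≤ (1 - η) * Real.exp (-(2 * Phi a b x)) := by
          apply mul_le_mul_of_nonneg_left h3; linarith
      _ ≤ _ := h1
      _ ≤ _ := by gcongr
  rw [mul_assoc, div_mul_eq_mul_div, div_le_iff₀ (by positivity)]
  linarith

lemma v_right (w : IsWKB η a b v v1) (hbη : 5 * b ^ 2 ≤ η * a ^ 2) {x : ℝ}
    (hx : |x - Real.sqrt b| ≤ η * Real.sqrt b) {t1 t2 g : ℝ}
    (h1 : |t1| ≤ Real.exp (-lam a b * (x - Real.sqrt b) ^ 2) * g)
    (h2 : |t2| ≤ 2 * η ^ 2 * Real.sqrt a * Real.exp (-lam a b * (x - Real.sqrt b) ^ 2) * g)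
    (hg : 0 ≤ g) :
    (|t2| * ‖v x‖ + 2 * |t1| * ‖v1 x‖) ^ 2 ≤ (1 + η) * (2 * (1 + η) ^ 2 + 2 * η ^ 2) ^ 2 *
      (Real.sqrt a * Real.exp (-SS a b) * g ^ 2) *
      Real.exp (-((1 - η) * lam a b) * (x - Real.sqrt b) ^ 2) := by
  have hsa := w.sa
  have hsb := w.sb
  have he := w.eta_pos
  have he1 := w.eta_le
  have hsq := Real.sq_sqrt w.b_pos.le
  have hx' := abs_le.mp hx
  have hxd : x ≤ 3/2 * Real.sqrt b := by nlinarith [hx'.2]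
  have h3 := w.sq_le hxd
  have h4 := w.v1_le (w.dom hxd)
  have hp := pp_norm_le w.a_pos w.b_pos.le (x := x) he.le hbη (by
    have e1 : -(2 * Real.sqrt b) ≤ x := by nlinarith [hx'.1]
    have e2 : x ≤ 2 * Real.sqrt b := by nlinarith [hx'.2]
    nlinarith)
  have hG := (GG_near w.a_pos w.b_pos he (by linarith) hbη
    (s := Real.sqrt b - x) (by rw [abs_sub_comm]; exact hx)).2
  set e := Real.exp (-lam a b * (x - Real.sqrt b) ^ 2) with hedef
  have he0 : 0 < e := Real.exp_pos _
  have h5 : ‖v1 x‖ ≤ (1 + η) * (Real.sqrt a * (1 + η)) * ‖v x‖ := by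
    refine h4.trans ?_
    gcongr
  have h6 : |t2| * ‖v x‖ + 2 * |t1| * ‖v1 x‖ ≤
      (2 * (1 + η) ^ 2 + 2 * η ^ 2) * (Real.sqrt a * e * g * ‖v x‖) := by
    calc _ ≤ (2 * η ^ 2 * Real.sqrt a * e * g) * ‖v x‖ +
          2 * (e * g) * ((1 + η) * (Real.sqrt a * (1 + η)) * ‖v x‖) := by gcongr
      _ = _ := by ring
  have h7 : Real.exp (-(2 * Phi a b x)) * e ^ 2 ≤
      Real.exp (-SS a b) * Real.exp (-((1 - η) * lam a b) * (x - Real.sqrt b) ^ 2) := by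
    rw [hedef, ← Real.exp_nat_mul, ← Real.exp_add, ← Real.exp_add]
    apply Real.exp_le_exp.mpr
    rw [Phi_eq_GG' a b x, SS, lam]
    have : (Real.sqrt b - x) ^ 2 = (x - Real.sqrt b) ^ 2 := by ring
    rw [this] at hG
    push_cast
    linarith
  have ht1 := abs_nonneg t1
  have ht2 := abs_nonneg t2
  calc _ ≤ ((2 * (1 + η) ^ 2 + 2 * η ^ 2) * (Real.sqrt a * e * g * ‖v x‖)) ^ 2 := by gcongr
    _ = (2 * (1 + η) ^ 2 + 2 * η ^ 2) ^ 2 * (Real.sqrt a ^ 2 * g ^ 2) * (e ^ 2 * ‖v x‖ ^ 2) := by ring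
    _ ≤ (2 * (1 + η) ^ 2 + 2 * η ^ 2) ^ 2 * (Real.sqrt a ^ 2 * g ^ 2) *
        (e ^ 2 * ((1 + η) / Real.sqrt a * Real.exp (-(2 * Phi a b x)))) := by gcongr
    _ = (1 + η) * (2 * (1 + η) ^ 2 + 2 * η ^ 2) ^ 2 * (Real.sqrt a * g ^ 2) *
        (Real.exp (-(2 * Phi a b x)) * e ^ 2) := by
        field_simp
    _ ≤ (1 + η) * (2 * (1 + η) ^ 2 + 2 * η ^ 2) ^ 2 * (Real.sqrt a * g ^ 2) *
        (Real.exp (-SS a b) * Real.exp (-((1 - η) * lam a b) * (x - Real.sqrt b) ^ 2)) := by gcongr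
    _ = _ := by ring

end IsWKB

namespace IsWKB
variable {η a b : ℝ} {v v1 : ℝ → ℂ}

lemma cut_fun (w : IsWKB η a b v v1) {θ θ1 θ2 : ℝ → ℝ} {d R : ℝ} (hd : d < Real.sqrt a / 4)
    (hs : ContDiff ℝ (⊤ : ℕ∞) θ) (h1 : ∀ x, HasDerivAt θ (θ1 x) x)
    (h2 : ∀ x, HasDerivAt θ1 (θ2 x) x) (hr : ∀ x, d ≤ x → θ x = 0) (hl : ∀ x ≤ -R, θ x = 0) :
    ∃ u : SchwartzMap ℝ ℂ, (∀ x, u x = (θ x : ℂ) * v x) ∧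
      (∀ x < Real.sqrt a / 4, -(deriv (deriv ⇑u) x) + I * (x:ℂ) ^ 2 * u x - (a + b * I) * u x =
        -((θ2 x : ℂ) * v x) - 2 * (θ1 x : ℂ) * v1 x) ∧
      (∀ x, Real.sqrt a / 4 ≤ x →
        -(deriv (deriv ⇑u) x) + I * (x:ℂ) ^ 2 * u x - (a + b * I) * u x = 0) := by
  set F : ℝ → ℂ := fun x => (θ x : ℂ) * v x with hF
  have hc : HasCompactSupport F := by
    apply HasCompactSupport.intro (K := Set.Icc (-R) d) isCompact_Icc
    intro x hx
    rw [Set.mem_Icc, not_and_or] at hx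
    have : θ x = 0 := by
      rcases hx with hx | hx
      · exact hl x (by linarith)
      · exact hr x (by linarith)
    simp [hF, this]
  have hsm : ContDiff ℝ (⊤ : ℕ∞) F := by
    rw [contDiff_iff_contDiffAt]
    intro x
    by_cases hx : x < Real.sqrt a / 4
    · have hv : ContDiffAt ℝ (⊤ : ℕ∞) v x := w.smooth.contDiffAt (Iio_mem_nhds hx)
      have ht : ContDiffAt ℝ (⊤ : ℕ∞) (fun x => (θ x : ℂ)) x :=
        Complex.ofRealCLM.contDiff.contDiffAt.comp x hs.contDiffAt
      exact ht.mul hv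
    · have : F =ᶠ[nhds x] fun _ => 0 := by
        filter_upwards [Ioi_mem_nhds (show d < x by linarith)] with t ht
        have : θ t = 0 := hr t (le_of_lt ht)
        simp [hF, this]
      exact contDiffAt_const.congr_of_eventuallyEq this
  refine ⟨hc.toSchwartzMap hsm, fun x => rfl, ?_, ?_⟩
  · intro x hx
    have hfun : ⇑(hc.toSchwartzMap hsm) = F := rfl
    rw [hfun]
    have e1 : deriv F =ᶠ[nhds x] fun t => (θ1 t : ℂ) * v t + (θ t : ℂ) * v1 t := by
      filter_upwards [Iio_mem_nhds hx] with t ht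
      exact ((h1 t).ofReal_comp.mul (w.d0 t ht)).deriv
    rw [e1.deriv_eq]
    have := (((h2 x).ofReal_comp.mul (w.d0 x hx)).add
      ((h1 x).ofReal_comp.mul (w.d1 x hx))).deriv
    have e2 : deriv (fun t => (θ1 t : ℂ) * v t + (θ t : ℂ) * v1 t) x = _ := this
    rw [e2]
    simp only [hF]
    ring
  · intro x hx
    have hfun : ⇑(hc.toSchwartzMap hsm) = F := rfl
    rw [hfun]
    have e0 : F =ᶠ[nhds x] fun _ => 0 := by
      filter_upwards [Ioi_mem_nhds (show d < x by linarith)] with t ht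
      have : θ t = 0 := hr t (le_of_lt ht)
      simp [hF, this]
    have e1 := e0.deriv
    have e2 := e1.deriv_eq
    rw [e2, e0.eq_of_nhds]
    simp

/-- lower bound of the truncated solution -/
noncomputable def _root_.AA (η L : ℝ) : ℝ :=
  (1 - η) / (1 + η) * (Real.sqrt (1 / (1 + η)) - Real.sqrt 2 * Real.exp (-(η ^ 2 * L / 2)))

/-- upper bound of the error -/
noncomputable def _root_.BB (η L : ℝ) : ℝ :=
  (1 + η) * (2 * (1 + η) ^ 2 + 2 * η ^ 2) ^ 2 * Real.sqrt (1 / (1 - η)) /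
    (1 - Real.sqrt 2 * Real.exp (-(η ^ 2 * L / 8))) ^ 2

lemma lam_r (w : IsWKB η a b v v1) : lam a b * (η * Real.sqrt b) ^ 2 = η ^ 2 * (lam a b * b) := by
  have := Real.sq_sqrt w.b_pos.le
  rw [mul_pow, this]; ring

lemma u_int_lower (w : IsWKB η a b v v1) (hbη : 5 * b ^ 2 ≤ η * a ^ 2) {u : ℝ → ℂ}
    (hi : Integrable (fun x => ‖u x‖ ^ 2))
    (hu : ∀ x, |x + Real.sqrt b| ≤ η * Real.sqrt b → u x = v x) :
    KK a b * AA η (lam a b * b) ≤ ∫ x, ‖u x‖ ^ 2 := by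
  have hsa := w.sa
  have hsb := w.sb
  have hl := w.lam_pos
  have he := w.eta_pos
  have he1 := w.eta_le
  have hpi := Real.pi_pos
  set r := η * Real.sqrt b with hr
  set D := (1 - η) / (Real.sqrt a * (1 + η)) * Real.exp (SS a b) with hD
  have hD0 : 0 ≤ D := by
    have : 0 ≤ 1 - η := by linarith
    positivity
  have g := gauss_lower hl (show lam a b ≤ (1 + η) * lam a b by nlinarith)
    (show 0 < r by positivity) (-Real.sqrt b)
  have h1 : ∫ x in Set.Icc (-Real.sqrt b - r) (-Real.sqrt b + r),
      D * Real.exp (-((1 + η) * lam a b) * (x - -Real.sqrt b) ^ 2) ≤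
      ∫ x in Set.Icc (-Real.sqrt b - r) (-Real.sqrt b + r), ‖u x‖ ^ 2 := by
    apply setIntegral_mono_on
    · apply Continuous.integrableOn_Icc
      fun_prop
    · exact hi.integrableOn
    · exact measurableSet_Icc
    · intro x hx
      have hx' : |x + Real.sqrt b| ≤ η * Real.sqrt b := by
        rw [abs_le]; constructor <;> linarith [hx.1, hx.2]
      rw [hu x hx', sub_neg_eq_add]
      exact w.v_lower hbη hx'
  have h2 : ∫ x in Set.Icc (-Real.sqrt b - r) (-Real.sqrt b + r), ‖u x‖ ^ 2 ≤ ∫ x, ‖u x‖ ^ 2 :=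
    setIntegral_le_integral hi (Filter.Eventually.of_forall fun x => by positivity)
  rw [integral_const_mul] at h1
  refine le_trans ?_ (h1.trans h2)
  refine le_trans (le_of_eq ?_) (mul_le_mul_of_nonneg_left g hD0)
  rw [hr, w.lam_r]
  have e1 : Real.sqrt (Real.pi / ((1 + η) * lam a b)) =
      Real.sqrt (1 / (1 + η)) * Real.sqrt (Real.pi / lam a b) := by
    rw [← Real.sqrt_mul (by positivity)]
    congr 1
    field_simp
  rw [e1, hD, KK, AA]
  have : 0 < 1 + η := by linarith
  field_simp

end IsWKB

namespace IsWKB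

lemma test_fun : ∃ M : ℝ, 0 < M ∧ ∀ (η a b : ℝ) (v v1 : ℝ → ℂ), IsWKB η a b v v1 →
    5 * b ^ 2 ≤ η * a ^ 2 → 2 * b ≤ η * a → M / (η * Real.sqrt b) ≤ η ^ 2 * Real.sqrt a →
    Real.sqrt 2 * Real.exp (-(η ^ 2 * (lam a b * b) / 8)) < 1 → ∀ γ : ℝ, 0 < γ →
    ∃ u : SchwartzMap ℝ ℂ, KK a b * AA η (lam a b * b) ≤ ∫ x, ‖u x‖ ^ 2 ∧
      ∫ x : ℝ, ‖-(deriv (deriv ⇑u) x) + I * (x:ℂ) ^ 2 * u x - (a + b * I) * u x‖ ^ 2 ≤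
        BB η (lam a b * b) / KK a b + γ := by
  obtain ⟨M, hM, hcut⟩ := cut_right
  obtain ⟨T, T1, T2, MT, hMT, Ts, Td1, Td2, Tb1, Tb2, Tz, Tone, Tz0, Tz1⟩ := cut_left
  refine ⟨M, hM, ?_⟩
  intro η a b v v1 w hbη h2b hMη hτ γ hγ
  have hsa := w.sa
  have hsb := w.sb
  have hl := w.lam_pos
  have he := w.eta_pos
  have he1 := w.eta_le
  have hpi := Real.pi_pos
  have hsq := Real.sq_sqrt w.b_pos.le
  have hsqa := Real.sq_sqrt w.a_pos.le
  set c := Real.sqrt b with hc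
  set r := η * c with hr
  have hr0 : 0 < r := by positivity
  have hrc : r ≤ c / 2 := by rw [hr]; nlinarith
  have hlr := w.lam_r
  rw [← hc, ← hr] at hlr
  have hτ' : 1 - Real.sqrt 2 * Real.exp (-(lam a b * r ^ 2 / 8)) > 0 := by
    rw [hlr]; linarith
  obtain ⟨P, P1, P2, G, hG, hGl, Ps, Pd1, Pd2, Pz, Pone, Pz', Pb1, Pb2⟩ :=
    hcut c r (lam a b) hr0 hl hτ'
  obtain ⟨R, hR1, hR2, hR⟩ := w.left_tail hMT hγ
  rw [← hc] at hR2
  have hdd : c + r < Real.sqrt a / 4 := w.dom (by rw [← hc]; linarith)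
  obtain ⟨u, hu, huf, huz⟩ := w.cut_fun (θ := fun x => T (x + (R + 1)) - P x)
    (θ1 := fun x => T1 (x + (R + 1)) - P1 x) (θ2 := fun x => T2 (x + (R + 1)) - P2 x)
    (d := c + r) (R := R + 1) hdd
    ((Ts.comp (contDiff_id.add contDiff_const)).sub Ps)
    (fun x => ((Td1 (x + (R + 1))).comp_add_const x (R + 1)).sub (Pd1 x))
    (fun x => ((Td2 (x + (R + 1))).comp_add_const x (R + 1)).sub (Pd2 x))
    (fun x hx => by
      rw [Pone x hx, Tone _ (by linarith), sub_self])
    (fun x hx => by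
      rw [Pz x (by linarith), Tz _ (by linarith), sub_self])
  refine ⟨u, ?_, ?_⟩
  · apply w.u_int_lower hbη
    · exact (memLp_two_iff_integrable_sq_norm (u.continuous.aestronglyMeasurable)).1 (u.memLp 2)
    · intro x hx
      rw [← hc, ← hr, abs_le] at hx
      rw [hu, Pz x (by linarith), Tone _ (by linarith)]
      simp
  · set C1 := (1 + η) * (2 * (1 + η) ^ 2 + 2 * η ^ 2) ^ 2 *
      (Real.sqrt a * Real.exp (-SS a b) * G⁻¹ ^ 2) with hC1
    have hC10 : 0 ≤ C1 := by positivity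
    have hk : 0 < (1 - η) * lam a b := mul_pos (by linarith) hl
    have hpt : ∀ x : ℝ, ‖-(deriv (deriv ⇑u) x) + I * (x:ℂ) ^ 2 * u x - (a + b * I) * u x‖ ^ 2 ≤
        (Set.Icc (-R - 1) (-R)).indicator (fun _ => γ) x +
          C1 * Real.exp (-((1 - η) * lam a b) * (x - c) ^ 2) := by
      intro x
      have hi0 : 0 ≤ (Set.Icc (-R - 1) (-R)).indicator (fun _ => γ) x :=
        Set.indicator_nonneg (fun _ _ => hγ.le) x
      have he0 : 0 ≤ C1 * Real.exp (-((1 - η) * lam a b) * (x - c) ^ 2) := by positivity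
      by_cases hx : x < Real.sqrt a / 4
      swap
      · rw [huz x (by linarith)]
        simp only [norm_zero]
        linarith
      rw [huf x hx]
      have hn : ∀ t2 t1 : ℝ, ‖-((t2 : ℂ) * v x) - 2 * (t1 : ℂ) * v1 x‖ ≤
          |t2| * ‖v x‖ + 2 * |t1| * ‖v1 x‖ := by
        intro t2 t1
        refine (norm_sub_le _ _).trans (le_of_eq ?_)
        simp
      by_cases hxc : r ≤ |x - c|
      · obtain ⟨p1, p2⟩ := Pz' x hxc
        by_cases h0 : x < -R - 1
        · obtain ⟨t1, t2⟩ := Tz0 (x + (R + 1)) (by linarith)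
          rw [p1, p2, t1, t2]
          exact le_trans (le_of_eq (by simp)) (add_nonneg hi0 he0)
        by_cases h1 : -R < x
        · obtain ⟨t1, t2⟩ := Tz1 (x + (R + 1)) (by linarith)
          rw [p1, p2, t1, t2]
          exact le_trans (le_of_eq (by simp)) (add_nonneg hi0 he0)
        have hm : x ∈ Set.Icc (-R - 1) (-R) := ⟨by linarith, by linarith⟩
        rw [Set.indicator_of_mem hm, p1, p2, sub_zero, sub_zero]
        have := hR x hm.2
        have h3 : ‖-((T2 (x + (R + 1)) : ℂ) * v x) - 2 * (T1 (x + (R + 1)) : ℂ) * v1 x‖ ≤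
            MT * (‖v x‖ + 2 * ‖v1 x‖) := by
          refine (hn _ _).trans ?_
          have h4 := mul_le_mul_of_nonneg_right (Tb1 (x + (R + 1))) (norm_nonneg (v1 x))
          have h5 := mul_le_mul_of_nonneg_right (Tb2 (x + (R + 1))) (norm_nonneg (v x))
          linarith
        have := pow_le_pow_left₀ (norm_nonneg _) h3 2
        linarith
      · push Not at hxc
        have hxc' := abs_lt.1 hxc
        obtain ⟨t1, t2⟩ := Tz1 (x + (R + 1)) (by linarith)
        rw [t1, t2]
        have hg : 0 ≤ G⁻¹ := by positivity
        have b1 : |0 - P1 x| ≤ Real.exp (-lam a b * (x - c) ^ 2) * G⁻¹ := by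
          have := Pb1 x
          rw [div_eq_mul_inv] at this
          simpa using this
        have b2 : |0 - P2 x| ≤ 2 * η ^ 2 * Real.sqrt a * Real.exp (-lam a b * (x - c) ^ 2) * G⁻¹ := by
          have := Pb2 x
          rw [div_eq_mul_inv] at this
          rw [zero_sub, abs_neg]
          refine this.trans ?_
          gcongr
          have : 2 * lam a b * r ≤ η ^ 2 * Real.sqrt a := by
            have : 2 * lam a b * r = η * (2 * b) / Real.sqrt a := by
              rw [lam, ← hc, hr]
              field_simp
              linarith
            rw [this, div_le_iff₀ hsa]
            calc η * (2 * b) ≤ η * (η * a) := by gcongr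
              _ = _ := by rw [mul_assoc, ← sq, hsqa]; ring
          linarith
        have := w.v_right hbη (x := x) (by rw [← hc, ← hr]; exact hxc.le) b1 b2 hg
        have h3 := pow_le_pow_left₀ (norm_nonneg _) (hn (0 - P2 x) (0 - P1 x)) 2
        rw [← hc, ← hC1] at this
        linarith
    have i1 : Integrable (fun x : ℝ => Real.exp (-((1 - η) * lam a b) * (x - c) ^ 2)) :=
      (integrable_exp_neg_mul_sq hk).comp_sub_right c
    have i2 : Integrable ((Set.Icc (-R - 1) (-R)).indicator (fun _ : ℝ => γ)) :=
      (integrableOn_const (by simp)).integrable_indicator measurableSet_Icc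
    have h1 := integral_mono_of_nonneg (Filter.Eventually.of_forall fun x => by positivity)
      (i2.add (i1.const_mul C1)) (Filter.Eventually.of_forall hpt)
    refine h1.trans ?_
    have e1 : ∫ x : ℝ, Real.exp (-((1 - η) * lam a b) * (x - c) ^ 2) =
        Real.sqrt (Real.pi / ((1 - η) * lam a b)) := by
      rw [integral_sub_right_eq_self (fun x : ℝ => Real.exp (-((1 - η) * lam a b) * x ^ 2)) c]
      exact integral_gaussian _
    have e2 := integral_add i2 (i1.const_mul C1)
    rw [integral_const_mul, e1, integral_indicator measurableSet_Icc] at e2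
    rw [show (∫ x : ℝ, ((Set.Icc (-R - 1) (-R)).indicator (fun _ : ℝ => γ) +
      fun x => C1 * Real.exp (-((1 - η) * lam a b) * (x - c) ^ 2)) x) = _ from e2]
    have e3 : ∫ x in Set.Icc (-R - 1) (-R), γ = γ := by
      simp
    rw [e3, add_comm]
    gcongr
    have e4 : Real.sqrt (Real.pi / ((1 - η) * lam a b)) =
        Real.sqrt (1 / (1 - η)) * Real.sqrt (Real.pi / lam a b) := by
      have : 0 < 1 - η := by linarith
      rw [← Real.sqrt_mul (by positivity)]
      congr 1
      field_simp
    rw [hlr] at hGl hτ'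
    rw [e4, hC1, BB, KK]
    set τ := Real.sqrt 2 * Real.exp (-(η ^ 2 * (lam a b * b) / 8)) with hτd
    have hs0 : 0 < Real.sqrt (Real.pi / lam a b) := by positivity
    generalize Real.sqrt (Real.pi / lam a b) = s at *
    have hq00 := Real.sqrt_nonneg (1 / (1 - η))
    generalize Real.sqrt (1 / (1 - η)) = q at *
    have hq : G⁻¹ ^ 2 ≤ 1 / ((1 - τ) * s) ^ 2 := by
      have hp : 0 < (1 - τ) * s := mul_pos hτ' hs0
      rw [inv_pow, one_div]
      gcongr
    have hq0 : 0 ≤ q := hq00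
    calc _ ≤ (1 + η) * (2 * (1 + η) ^ 2 + 2 * η ^ 2) ^ 2 *
          (Real.sqrt a * Real.exp (-SS a b) * (1 / ((1 - τ) * s) ^ 2)) * (q * s) := by gcongr
      _ = _ := by
        rw [Real.exp_neg]
        have h1 : 1 - τ ≠ 0 := hτ'.ne'
        have h2 := Real.exp_pos (SS a b)
        generalize Real.exp (SS a b) = E at *
        generalize 1 - τ = t at *
        field_simp

end IsWKB

lemma AB_lim (ε : ℝ) (hε : 0 < ε) (hε1 : ε < 1) : ∃ η : ℝ, 0 < η ∧ η ≤ 1/4 ∧ ∃ L0 : ℝ, ∀ L ≥ L0,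
    Real.sqrt 2 * Real.exp (-(η ^ 2 * L / 8)) < 1 ∧ 0 < AA η L ∧
      (1 - ε) * (BB η L + ε) ≤ 4 * AA η L := by
  set A0 : ℝ → ℝ := fun η => (1 - η) / (1 + η) * Real.sqrt (1 / (1 + η)) with hA0
  set B0 : ℝ → ℝ := fun η => (1 + η) * (2 * (1 + η) ^ 2 + 2 * η ^ 2) ^ 2 * Real.sqrt (1 / (1 - η))
    with hB0
  have hA : Filter.Tendsto A0 (nhdsWithin 0 (Set.Ioi 0)) (nhds 1) := by
    have : ContinuousAt A0 0 := by
      rw [hA0]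
      fun_prop (disch := norm_num)
    have h2 := this.tendsto.mono_left (nhdsWithin_le_nhds (s := Set.Ioi (0:ℝ)))
    have e : A0 0 = 1 := by simp [hA0]
    rwa [e] at h2
  have hD : Filter.Tendsto (fun η => 4 * A0 η - (1 - ε) * (B0 η + ε))
      (nhdsWithin 0 (Set.Ioi 0)) (nhds (4 * 1 - (1 - ε) * (4 + ε))) := by
    have : ContinuousAt B0 0 := by
      rw [hB0]
      fun_prop (disch := norm_num)
    have h2 := this.tendsto.mono_left (nhdsWithin_le_nhds (s := Set.Ioi (0:ℝ)))
    have e : B0 0 = 4 := by norm_num [hB0]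
    rw [e] at h2
    exact (hA.const_mul 4).sub ((h2.add_const ε).const_mul (1 - ε))
  have hA' := hA.eventually_const_lt (show (0:ℝ) < 1 by norm_num)
  have hD' := hD.eventually_const_lt (show (0:ℝ) < 4 * 1 - (1 - ε) * (4 + ε) by nlinarith)
  have h4 : ∀ᶠ η : ℝ in nhdsWithin 0 (Set.Ioi 0), η ≤ 1/4 ∧ 0 < η := by
    filter_upwards [Ioo_mem_nhdsGT (show (0:ℝ) < 1/4 by norm_num)] with x hx
    exact ⟨hx.2.le, hx.1⟩
  obtain ⟨η, ⟨h1, h2⟩, h3, h5⟩ := ((hA'.and hD').and h4).exists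
  refine ⟨η, h5, h3, ?_⟩
  have ex : ∀ c : ℝ, 0 < c → Filter.Tendsto (fun L : ℝ => Real.exp (-(c * L))) Filter.atTop (nhds 0) := by
    intro c hc
    exact Real.tendsto_exp_neg_atTop_nhds_zero.comp (Filter.tendsto_id.const_mul_atTop hc)
  have e8 : Filter.Tendsto (fun L : ℝ => Real.sqrt 2 * Real.exp (-(η ^ 2 * L / 8))) Filter.atTop
      (nhds (Real.sqrt 2 * 0)) := by
    refine ((ex (η ^ 2 / 8) (by positivity)).congr fun L => ?_).const_mul _
    congr 1; ring
  have e2 : Filter.Tendsto (fun L : ℝ => Real.sqrt 2 * Real.exp (-(η ^ 2 * L / 2))) Filter.atTop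
      (nhds (Real.sqrt 2 * 0)) := by
    refine ((ex (η ^ 2 / 2) (by positivity)).congr fun L => ?_).const_mul _
    congr 1; ring
  have tA : Filter.Tendsto (fun L => AA η L) Filter.atTop (nhds (A0 η)) := by
    have := (e2.const_sub (Real.sqrt (1 / (1 + η)))).const_mul ((1 - η) / (1 + η))
    rw [mul_zero, sub_zero] at this
    exact this
  have tB : Filter.Tendsto (fun L => BB η L) Filter.atTop (nhds (B0 η)) := by
    have := ((e8.const_sub 1).pow 2)
    rw [mul_zero, sub_zero, one_pow] at this
    have h := (tendsto_const_nhds (x := B0 η)).div this one_ne_zero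
    rw [div_one] at h
    exact h
  have tD := (tA.const_mul 4).sub ((tB.add_const ε).const_mul (1 - ε))
  have f1 := e8.eventually_lt_const (u := 1) (by norm_num)
  have f2 := tA.eventually_const_lt h1
  have f3 := tD.eventually_const_lt h2
  obtain ⟨L0, hL0⟩ := Filter.eventually_atTop.mp (f1.and (f2.and f3))
  refine ⟨L0, fun L hL => ?_⟩
  obtain ⟨g1, g2, g3⟩ := hL0 L hL
  exact ⟨g1, g2, by linarith⟩

lemma sdecay (s : SchwartzMap ℝ ℂ) : ∃ M : ℝ, ∀ x : ℝ, (1 + x ^ 2) ^ 2 * ‖s x‖ ≤ M := by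
  obtain ⟨C0, h0⟩ := s.decay' 0 0
  obtain ⟨C2, h2⟩ := s.decay' 2 0
  obtain ⟨C4, h4⟩ := s.decay' 4 0
  refine ⟨C0 + 2 * C2 + C4, fun x => ?_⟩
  have a0 := h0 x
  have a2 := h2 x
  have a4 := h4 x
  rw [norm_iteratedFDeriv_zero] at a0 a2 a4
  have e : ‖x‖ ^ 2 = x ^ 2 := by simp
  have e4 : ‖x‖ ^ 4 = x ^ 4 := by
    rw [show (4:ℕ) = 2 * 2 by norm_num, pow_mul, e]; ring
  rw [e] at a2
  rw [e4] at a4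
  have : s.toFun x = s x := rfl
  rw [this] at a0 a2 a4
  linarith

lemma schwartz_sol (a b : ℝ) (u : SchwartzMap ℝ ℂ) : Sol a b u (deriv u)
    (fun x : ℝ => -(deriv (deriv ⇑u) x) + I * (x:ℂ) ^ 2 * u x - (a + b * I) * u x) := by
  set du := SchwartzMap.derivCLM ℂ ℂ u with hdu
  set ddu := SchwartzMap.derivCLM ℂ ℂ du with hddu
  have e1 : deriv ⇑u = ⇑du := by
    ext x; rw [hdu, SchwartzMap.derivCLM_apply]
  have e2 : deriv ⇑du = ⇑ddu := by
    ext x; rw [hddu, SchwartzMap.derivCLM_apply]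
  rw [e1, e2]
  have c0 := u.continuous
  have c2 := ddu.continuous
  refine ⟨?_, ?_, ?_, ?_⟩
  · intro x
    have := (u.differentiable x).hasDerivAt
    rwa [e1] at this
  · intro x
    have := (du.differentiable x).hasDerivAt
    rw [e2] at this
    refine this.congr_deriv ?_
    ring
  · fun_prop
  · obtain ⟨M0, h0⟩ := sdecay u
    obtain ⟨M1, h1⟩ := sdecay du
    obtain ⟨M2, h2⟩ := sdecay ddu
    have key : ∀ (x t : ℝ), 0 ≤ t → (1 + x ^ 2) * t ≤ (1 + x ^ 2) ^ 2 * t := by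
      intro x t ht
      have : (1 + x ^ 2) ≤ (1 + x ^ 2) ^ 2 := by nlinarith [sq_nonneg x]
      gcongr
    have n0 : 0 ≤ M0 := le_trans (by positivity) (h0 0)
    have n1 : 0 ≤ M1 := le_trans (by positivity) (h1 0)
    have n2 : 0 ≤ M2 := le_trans (by positivity) (h2 0)
    set k := ‖(a + b * I : ℂ)‖ with hk
    have hk0 : 0 ≤ k := norm_nonneg _
    have hkM : 0 ≤ k * M0 := by positivity
    refine ⟨M0 + M1 + M2 + k * M0, fun x => ⟨?_, ?_, ?_⟩⟩
    · have := key x _ (norm_nonneg (u x))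
      linarith [h0 x]
    · have := key x _ (norm_nonneg (du x))
      linarith [h1 x]
    · have b1 : ‖-(ddu x) + I * (x:ℂ) ^ 2 * u x - (a + b * I) * u x‖ ≤
          ‖ddu x‖ + x ^ 2 * ‖u x‖ + k * ‖u x‖ := by
        refine (norm_sub_le _ _).trans ?_
        refine add_le_add ((norm_add_le _ _).trans ?_) (by rw [norm_mul])
        rw [norm_neg]
        gcongr
        simp
      have k2 := key x _ (norm_nonneg (ddu x))
      have k0 := key x _ (norm_nonneg (u x))
      have k3 : (1 + x ^ 2) * (x ^ 2 * ‖u x‖) ≤ (1 + x ^ 2) ^ 2 * ‖u x‖ := by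
        have : (1 + x ^ 2) * x ^ 2 ≤ (1 + x ^ 2) ^ 2 := by nlinarith [sq_nonneg x]
        rw [← mul_assoc]
        gcongr
      have k4 : k * ((1 + x ^ 2) * ‖u x‖) ≤ k * M0 := by
        gcongr; exact k0.trans (h0 x)
      calc _ ≤ (1 + x ^ 2) * (‖ddu x‖ + x ^ 2 * ‖u x‖ + k * ‖u x‖) := by gcongr
        _ ≤ _ := by linarith [h0 x, h2 x]

lemma l2norm {f : ℝ → ℂ} (hc : Continuous f) (hi : Integrable (fun x => ‖f x‖ ^ 2)) :
    (eLpNorm f 2 volume).toReal = Real.sqrt (∫ x, ‖f x‖ ^ 2) := by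
  have hm : MemLp f 2 := (memLp_two_iff_integrable_sq_norm hc.aestronglyMeasurable).2 hi
  rw [hm.eLpNorm_eq_integral_rpow_norm (by norm_num) (by norm_num)]
  rw [ENNReal.toReal_ofReal (by positivity), Real.sqrt_eq_rpow]
  norm_num

lemma KK_eq {a b : ℝ} (ha : 0 < a) (hb : 0 < b) : KK a b / 2 =
    Real.sqrt Real.pi * Real.exp (SS a b) / (2 * a ^ ((1:ℝ)/4) * b ^ ((1:ℝ)/4)) := by
  have hA : 0 < a ^ ((1:ℝ)/4) := by positivity
  have hB : 0 < b ^ ((1:ℝ)/4) := by positivity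
  have e1 : Real.sqrt a = (a ^ ((1:ℝ)/4)) ^ 2 := by
    rw [Real.sqrt_eq_rpow, ← Real.rpow_natCast, ← Real.rpow_mul ha.le]; norm_num
  have e2 : Real.sqrt b = (b ^ ((1:ℝ)/4)) ^ 2 := by
    rw [Real.sqrt_eq_rpow, ← Real.rpow_natCast, ← Real.rpow_mul hb.le]; norm_num
  rw [KK, lam, Real.sqrt_div Real.pi_pos.le, e1, e2, ← div_pow, Real.sqrt_sq (by positivity)]
  field_simp

lemma SS_eq {a b : ℝ} (ha : 0 < a) (hb : 0 < b) :
    a * (∫ x in -Real.sqrt (b / a)..Real.sqrt (b / a),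
      ((1:ℂ) + Complex.I * ((b / a : ℝ) : ℂ) - Complex.I * (x:ℂ) ^ 2) ^ ((1:ℂ)/2)).im = SS a b := by
  have hsa : 0 < Real.sqrt a := Real.sqrt_pos.mpr ha
  have hsq := Real.sq_sqrt ha.le
  have e0 : Real.sqrt (b / a) = Real.sqrt b / Real.sqrt a := Real.sqrt_div hb.le a
  have hc : Continuous (fun x => (pp a b x)) := pp_cont a b
  have e1 : ∫ t in (-Real.sqrt b)..Real.sqrt b, pp a b t = (a : ℂ) *
      ∫ x in -Real.sqrt (b / a)..Real.sqrt (b / a), wp (b/a) (x : ℂ) := by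
    have h := intervalIntegral.integral_comp_div (a := -Real.sqrt b) (b := Real.sqrt b)
      (fun s : ℝ => wp (b/a) (s : ℂ)) hsa.ne'
    unfold pp
    rw [intervalIntegral.integral_const_mul, h, e0, neg_div, Complex.real_smul, ← mul_assoc, ← Complex.ofReal_mul, ← sq, hsq]
  have e2 : a * (∫ x in -Real.sqrt (b / a)..Real.sqrt (b / a), wp (b/a) (x : ℂ)).im =
      (∫ t in (-Real.sqrt b)..Real.sqrt b, pp a b t).im := by
    rw [e1, Complex.im_ofReal_mul]
  have e3 : (∫ t in (-Real.sqrt b)..Real.sqrt b, pp a b t).im =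
      ∫ t in (-Real.sqrt b)..Real.sqrt b, (pp a b t).im := by
    have := Complex.imCLM.intervalIntegral_comp_comm
      (hc.intervalIntegrable (μ := volume) (-Real.sqrt b) (Real.sqrt b))
    exact this.symm
  have e4 : ∫ t in (-Real.sqrt b)..Real.sqrt b, (pp a b t).im = SS a b := by
    have hci : Continuous (fun x => (pp a b x).im) := Complex.continuous_im.comp hc
    rw [← intervalIntegral.integral_add_adjacent_intervals (b := 0)
      (hci.intervalIntegrable _ _) (hci.intervalIntegrable _ _),
      intervalIntegral.integral_symm]
    have := Phi_neg a b (Real.sqrt b)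
    unfold Phi at this
    rw [this, SS, Phi]
    ring
  rw [← e4, ← e3, ← e2]
  rfl

lemma regime {η L M : ℝ} (hη : 0 < η) : ∃ C0 : ℝ, 100 ≤ C0 ∧ ∀ C ≥ C0, ∀ a b : ℝ, C ≤ a →
    C * a ^ ((1:ℝ)/3) ≤ b → b ≤ a / C →
    0 < a ∧ 0 < b ∧ 12000000 ≤ η * a ∧ b ≤ a / 100 ∧ 5 * b ^ 2 ≤ η * a ^ 2 ∧ 2 * b ≤ η * a ∧
    L ≤ lam a b * b ∧ M / (η * Real.sqrt b) ≤ η ^ 2 * Real.sqrt a := by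
  refine ⟨100 + 12000000 / η + |L| + |M| / η ^ 3, ?_, ?_⟩
  · have : 0 ≤ 12000000 / η + |L| + |M| / η ^ 3 := by positivity
    linarith
  intro C hC a b h1 h2 h3
  have p1 : 0 < 12000000 / η := by positivity
  have p2 : 0 ≤ |L| := by positivity
  have p3 : 0 ≤ |M| / η ^ 3 := by positivity
  have hC1 : 100 ≤ C := by linarith
  have ha : 0 < a := by linarith
  have ha3 : 1 ≤ a ^ ((1:ℝ)/3) := Real.one_le_rpow (by linarith) (by norm_num)
  have hbC : C ≤ b := by nlinarith
  have hb : 0 < b := by linarith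
  have hCη : 12000000 ≤ η * C := by
    have : 12000000 / η ≤ C := by linarith
    rw [div_le_iff₀ hη] at this; linarith
  have hbc : b * C ≤ a := (le_div_iff₀ (by linarith)).1 h3
  have hb5 : 12000000 * b ≤ η * a := by
    calc 12000000 * b ≤ (η * C) * b := by gcongr
      _ = η * (b * C) := by ring
      _ ≤ _ := by gcongr
  have hb100 : b ≤ a / 100 := by nlinarith
  have hsa : 0 < Real.sqrt a := Real.sqrt_pos.mpr ha
  have hsb : 0 < Real.sqrt b := Real.sqrt_pos.mpr hb
  have qa := Real.sq_sqrt ha.le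
  have qb := Real.sq_sqrt hb.le
  refine ⟨ha, hb, ?_, hb100, ?_, ?_, ?_, ?_⟩
  · calc (12000000:ℝ) ≤ η * C := hCη
      _ ≤ _ := by gcongr
  · have : 5 * b ≤ η * a := by linarith
    have hba : b ≤ a := by linarith
    calc 5 * b ^ 2 = (5 * b) * b := by ring
      _ ≤ (η * a) * a := by gcongr
      _ = _ := by ring
  · linarith
  · have hLC : L ≤ C := by linarith [le_abs_self L]
    refine hLC.trans ?_
    have hcube : C ^ 3 * a ≤ b ^ 3 := by
      have := pow_le_pow_left₀ (by positivity) h2 3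
      rw [mul_pow, ← Real.rpow_natCast (a ^ ((1:ℝ)/3)), ← Real.rpow_mul ha.le] at this
      norm_num at this
      exact this
    apply le_of_sq_le_sq _ (by unfold lam; positivity)
    have : (lam a b * b) ^ 2 = b ^ 3 / a := by
      rw [lam, mul_pow, div_pow, qa, qb]; ring
    rw [this, le_div_iff₀ ha]
    refine le_trans ?_ hcube
    have : C ^ 2 ≤ C ^ 3 := pow_le_pow_right₀ (by linarith) (by norm_num)
    gcongr
  · have hMC : |M| / η ^ 3 ≤ C := by linarith
    have hab : C ≤ Real.sqrt a * Real.sqrt b := by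
      apply le_of_sq_le_sq _ (by positivity)
      rw [mul_pow, qa, qb, sq]
      gcongr
    have : |M| ≤ (Real.sqrt a * Real.sqrt b) * η ^ 3 := by
      rw [div_le_iff₀ (by positivity)] at hMC
      refine hMC.trans ?_
      gcongr
    rw [div_le_iff₀ (by positivity)]
    calc M ≤ |M| := le_abs_self M
      _ ≤ _ := this
      _ = _ := by ring

lemma mk_wkb {η a b : ℝ} (hη : 0 < η) (hη1 : η ≤ 1/4) (ha : 0 < a) (haη : 12000000 ≤ η * a)
    (hb0 : 0 < b) (hb : b ≤ a/100) : ∃ v v1, IsWKB η a b v v1 := by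
  obtain ⟨v, v1, h1, h2, h3, h4, h5, h6⟩ := wkb hη (by linarith) ha haη hb0.le hb
  exact ⟨v, v1, hη, by linarith, ha, hb0, hb, h1, h2, h3, h4, h5, h6⟩

lemma upper_bd (ε : ℝ) (hε : 0 < ε) : ∃ C0 : ℝ, 100 ≤ C0 ∧ ∀ C ≥ C0, ∀ a b : ℝ, C ≤ a →
    C * a ^ ((1:ℝ)/3) ≤ b → b ≤ a / C → ∀ u : SchwartzMap ℝ ℂ,
      ∫ x, ‖u x‖ ^ 2 ≤ (1 + ε) * (KK a b / 2) ^ 2 * ∫ x : ℝ,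
        ‖-(deriv (deriv ⇑u) x) + I * (x:ℂ) ^ 2 * u x - (a + b * I) * u x‖ ^ 2 := by
  obtain ⟨η, hη, hη1, L0, hL⟩ := HH_lim ε hε
  obtain ⟨C0, hC0, hC⟩ := regime (L := max L0 16) (M := 0) hη
  refine ⟨C0, hC0, ?_⟩
  intro C hCC a b h1 h2 h3 u
  obtain ⟨ha, hb, q1, q2, q3, q4, q5, -⟩ := hC C hCC a b h1 h2 h3
  obtain ⟨v, v1, w⟩ := mk_wkb hη hη1 ha q1 hb q2
  refine (w.resolvent_bound (schwartz_sol a b u) hη1 q3 ((le_max_right _ _).trans q5)).trans ?_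
  have := hL _ ((le_max_left _ _).trans q5)
  have hn : 0 ≤ ∫ x : ℝ, ‖-(deriv (deriv ⇑u) x) + I * (x:ℂ) ^ 2 * u x - (a + b * I) * u x‖ ^ 2 :=
    integral_nonneg fun x => by positivity
  refine mul_le_mul_of_nonneg_right ?_ hn
  have h := mul_le_mul_of_nonneg_right this (sq_nonneg (KK a b))
  refine h.trans (le_of_eq ?_)
  ring

lemma lower_bd (ε : ℝ) (hε : 0 < ε) (hε1 : ε < 1) : ∃ C0 : ℝ, 100 ≤ C0 ∧ ∀ C ≥ C0, ∀ a b : ℝ, C ≤ a →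
    C * a ^ ((1:ℝ)/3) ≤ b → b ≤ a / C → 0 < KK a b ∧ ∃ u : SchwartzMap ℝ ℂ,
      0 < ∫ x, ‖u x‖ ^ 2 ∧ (1 - ε) * (KK a b / 2) ^ 2 * ∫ x : ℝ,
        ‖-(deriv (deriv ⇑u) x) + I * (x:ℂ) ^ 2 * u x - (a + b * I) * u x‖ ^ 2 ≤ ∫ x, ‖u x‖ ^ 2 := by
  obtain ⟨η, hη, hη1, L0, hL⟩ := AB_lim ε hε hε1
  obtain ⟨M, hM, ht⟩ := IsWKB.test_fun
  obtain ⟨C0, hC0, hC⟩ := regime (L := L0) (M := M) hη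
  refine ⟨C0, hC0, ?_⟩
  intro C hCC a b h1 h2 h3
  obtain ⟨ha, hb, q1, q2, q3, q4, q5, q6⟩ := hC C hCC a b h1 h2 h3
  obtain ⟨v, v1, w⟩ := mk_wkb hη hη1 ha q1 hb q2
  have hK := w.KK_pos
  obtain ⟨l1, l2, l3⟩ := hL _ q5
  obtain ⟨u, u1, u2⟩ := ht η a b v v1 w q3 q4 q6 l1 (ε / KK a b) (by positivity)
  refine ⟨hK, u, lt_of_lt_of_le (by positivity) u1, ?_⟩
  have h1ε : 0 ≤ 1 - ε := by linarith
  calc _ ≤ (1 - ε) * (KK a b / 2) ^ 2 * (BB η (lam a b * b) / KK a b + ε / KK a b) := by gcongr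
    _ = KK a b * (((1 - ε) * (BB η (lam a b * b) + ε)) / 4) := by
      field_simp
      ring
    _ ≤ KK a b * AA η (lam a b * b) := by gcongr; linarith
    _ ≤ _ := u1

lemma mQ_bd (ε : ℝ) (hε : 0 < ε) (hε1 : ε < 1) : ∃ C : ℝ, 0 < C ∧ ∀ z : ℂ, C ≤ z.re →
    C * z.re ^ ((1:ℝ)/3) ≤ z.im → z.im ≤ z.re / C → 0 < mQ z ∧
      |1 / mQ z - KK z.re z.im / 2| ≤ ε * (KK z.re z.im / 2) := by
  obtain ⟨C1, hC1, hu⟩ := upper_bd ε hε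
  obtain ⟨C2, hC2, hl⟩ := lower_bd ε hε hε1
  refine ⟨max C1 C2, lt_of_lt_of_le (by linarith) (le_max_left C1 C2), ?_⟩
  intro z h1 h2 h3
  have hu := hu _ (le_max_left C1 C2) z.re z.im h1 h2 h3
  obtain ⟨hK, u0, hu0, hu0'⟩ := hl _ (le_max_right C1 C2) z.re z.im h1 h2 h3
  have hz : ((z.re : ℂ) + z.im * I) = z := Complex.re_add_im z
  rw [hz] at hu0'
  have hz' : ∀ u : SchwartzMap ℝ ℂ, _ := fun u => schwartz_sol z.re z.im u
  rw [hz] at hu hz'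
  have hn : ∀ u : SchwartzMap ℝ ℂ, (eLpNorm (fun x : ℝ =>
          -(deriv (deriv ⇑u) x) + Complex.I * (x:ℂ) ^ 2 * u x - z * u x) 2 volume).toReal
        / (eLpNorm (⇑u) 2 volume).toReal = Real.sqrt (∫ x : ℝ,
        ‖-(deriv (deriv ⇑u) x) + I * (x:ℂ) ^ 2 * u x - z * u x‖ ^ 2) /
        Real.sqrt (∫ x, ‖u x‖ ^ 2) := by
    intro u
    rw [l2norm (hz' u).fc (hz' u).f_int, l2norm u.continuous (hz' u).u_int]
  set K := KK z.re z.im / 2 with hKd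
  have hK0 : 0 < K := by positivity
  have hup : 1 / ((1 + ε) * K) ≤ mQ z := by
    apply le_csInf
    · refine ⟨_, u0, ?_, rfl⟩
      rintro rfl
      simp at hu0
    · rintro r ⟨u, hne, rfl⟩
      rw [hn]
      have hpos : 0 < ∫ x, ‖u x‖ ^ 2 := by
        rw [integral_pos_iff_support_of_nonneg (fun x => by positivity) (hz' u).u_int]
        apply IsOpen.measure_pos
        · exact (u.continuous.norm.pow 2).isOpen_support
        · by_contra hemp
          rw [Set.not_nonempty_iff_eq_empty, Function.support_eq_empty_iff] at hemp
          apply hne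
          ext x
          have := congrFun hemp x
          simpa using this
      rw [div_le_div_iff₀ (by positivity) (Real.sqrt_pos.mpr hpos), one_mul, mul_comm]
      apply Real.sqrt_le_iff.2
      constructor
      · positivity
      rw [mul_pow, Real.sq_sqrt (integral_nonneg fun x => by positivity), mul_pow]
      refine (hu u).trans ?_
      refine mul_le_mul_of_nonneg_right ?_ (integral_nonneg fun x => by positivity)
      refine mul_le_mul_of_nonneg_right ?_ (by positivity)
      nlinarith
  have hm0 : 0 < mQ z := lt_of_lt_of_le (by positivity) hup
  have hlo : mQ z ≤ 1 / ((1 - ε) * K) := by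
    have h1e : 0 < 1 - ε := by linarith
    have : mQ z ≤ _ := csInf_le ⟨0, by
      rintro r ⟨u, hne, rfl⟩
      positivity⟩ ⟨u0, by rintro rfl; simp at hu0, rfl⟩
    refine this.trans ?_
    rw [hn, div_le_div_iff₀ (Real.sqrt_pos.mpr hu0) (by positivity), one_mul]
    apply Real.le_sqrt_of_sq_le
    rw [mul_pow, Real.sq_sqrt (integral_nonneg fun x => by positivity), mul_pow, mul_comm]
    refine le_trans ?_ hu0'
    refine mul_le_mul_of_nonneg_right ?_ (integral_nonneg fun x => by positivity)
    refine mul_le_mul_of_nonneg_right ?_ (by positivity)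
    nlinarith
  refine ⟨hm0, ?_⟩
  have h1e : 0 < 1 - ε := by linarith
  rw [div_le_iff₀ (by positivity)] at hup
  rw [le_div_iff₀ (by positivity)] at hlo
  have r1 : 1 / mQ z ≤ (1 + ε) * K := by
    rw [div_le_iff₀ hm0]; linarith
  have r2 : (1 - ε) * K ≤ 1 / mQ z := by
    rw [le_div_iff₀ hm0]; linarith
  rw [abs_le]
  constructor <;> linarith

/-- Precise resolvent asymptotics for the non-self-adjoint harmonic oscillator
`Q = Dₓ² + ix²` in the regime `(Re z)^{1/3} ≪ Im z ≪ Re z`: with `y = Im z / Re z`,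
`‖(Q − z)^{-1}‖ = K(z)(1 + o(1)) + O((Re z)^{-1/4}(Im z)^{-1/4})`, where
`K(z) = √π exp((Re z) Im ∫_{−√y}^{√y} (1 + iy − ix²)^{1/2} dx)
/ (2(Re z)^{1/4}(Im z)^{1/4})`. -/
theorem stmt_11 :
    ∀ ε : ℝ, 0 < ε → ∃ C : ℝ, 0 < C ∧ ∀ z : ℂ,
      C ≤ z.re → C * z.re ^ ((1:ℝ)/3) ≤ z.im → z.im ≤ z.re / C →
      0 < mQ z ∧
      |1 / mQ z
          - Real.sqrt Real.pi *
            Real.exp (z.re *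
              (∫ x in -Real.sqrt (z.im / z.re)..Real.sqrt (z.im / z.re),
                ((1:ℂ) + Complex.I * ((z.im / z.re : ℝ) : ℂ) - Complex.I * (x:ℂ) ^ 2)
                  ^ ((1:ℂ)/2)).im)
            / (2 * z.re ^ ((1:ℝ)/4) * z.im ^ ((1:ℝ)/4))|
        ≤ ε * (Real.sqrt Real.pi *
            Real.exp (z.re *
              (∫ x in -Real.sqrt (z.im / z.re)..Real.sqrt (z.im / z.re),
                ((1:ℂ) + Complex.I * ((z.im / z.re : ℝ) : ℂ) - Complex.I * (x:ℂ) ^ 2)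
                  ^ ((1:ℂ)/2)).im)
            / (2 * z.re ^ ((1:ℝ)/4) * z.im ^ ((1:ℝ)/4)))
          + C * z.re ^ (-(1:ℝ)/4) * z.im ^ (-(1:ℝ)/4) := by
  intro ε hε
  obtain ⟨C, hC, h⟩ := mQ_bd (min ε (1/2)) (by positivity)
    (lt_of_le_of_lt (min_le_right _ _) (by norm_num))
  refine ⟨C, hC, ?_⟩
  intro z h1 h2 h3
  obtain ⟨m0, m1⟩ := h z h1 h2 h3
  refine ⟨m0, ?_⟩
  have ha : 0 < z.re := lt_of_lt_of_le hC h1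
  have hb : 0 < z.im := lt_of_lt_of_le (by positivity) h2
  rw [SS_eq ha hb, ← KK_eq ha hb]
  have hK : 0 ≤ KK z.re z.im := by unfold KK; positivity
  have h4 : min ε (1/2) * (KK z.re z.im / 2) ≤ ε * (KK z.re z.im / 2) := by
    gcongr
    exact min_le_left _ _
  have h5 : 0 ≤ C * z.re ^ (-(1:ℝ)/4) * z.im ^ (-(1:ℝ)/4) := by positivity
  linarith
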